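/- arXiv:1912.05039 — 7 statements merged into one kernel-verified Lean document; each statement's English description precedes it below -/
import Mathlib

section
/- Let ν > 0 and let F : ℂ → ℂ be twice continuously differentiable as a function of two real variables, with ∫_ℂ |F(z)|² e^{−ν|z|²} dλ(z) < ∞. Then F satisfies the magnetic Laplace equation Δ_ν F = 0 on all of ℂ (i.e. −(1/4)(∂_x²F(z) + ∂_y²F(z)) + (ν/2)·conj(z)·(∂_xF(z) + i·∂_yF(z)) = 0 for every z ∈ ℂ) if and only if F is holomorphic on ℂ. -/
open MeasureTheory

/-- The magnetic Laplacian of intensity `ν`: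
`Δ_ν F = -(1/4)(∂_x²F + ∂_y²F) + (ν/2)·conj(z)·(∂_xF + i·∂_yF)`,
where `∂_x`, `∂_y` are the real directional derivatives in the directions `1` and `i`. -/
noncomputable def magLap (ν : ℝ) (F : ℂ → ℂ) : ℂ → ℂ := fun z =>
  -(1 / 4 : ℂ) * (fderiv ℝ (fun w => fderiv ℝ F w 1) z 1
      + fderiv ℝ (fun w => fderiv ℝ F w Complex.I) z Complex.I)
    + ((ν : ℂ) / 2) * (starRingEnd ℂ z) * (fderiv ℝ F z 1 + Complex.I * fderiv ℝ F z Complex.I)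

/-- `F ∈ L²,ν` : gaussian square integrability `∫_ℂ |F(z)|² e^{-ν|z|²} dλ(z) < ∞`. -/
def GaussianL2 (ν : ℝ) (F : ℂ → ℂ) : Prop :=
  Integrable (fun z : ℂ => ‖F z‖ ^ 2 * Real.exp (-ν * ‖z‖ ^ 2))


namespace MagAux

/-- Twice the Wirtinger derivative with respect to conj z. -/
noncomputable def dbar (F : ℂ → ℂ) : ℂ → ℂ := fun z =>
  fderiv ℝ F z 1 + Complex.I * fderiv ℝ F z Complex.I

lemma dbar_contDiff {F : ℂ → ℂ} (hF : ContDiff ℝ 2 F) : ContDiff ℝ 1 (dbar F) := by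
  have h : ContDiff ℝ 1 (fderiv ℝ F) := hF.fderiv_right (by norm_num)
  unfold dbar
  exact (h.clm_apply contDiff_const).add (contDiff_const.mul (h.clm_apply contDiff_const))

lemma lap_eq {F : ℂ → ℂ} (hF : ContDiff ℝ 2 F) (z : ℂ) :
    fderiv ℝ (fun w => fderiv ℝ F w 1) z 1
      + fderiv ℝ (fun w => fderiv ℝ F w Complex.I) z Complex.I
    = fderiv ℝ (dbar F) z 1 - Complex.I * fderiv ℝ (dbar F) z Complex.I := by
  have h : ContDiff ℝ 1 (fderiv ℝ F) := hF.fderiv_right (by norm_num)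
  have hd : DifferentiableAt ℝ (fderiv ℝ F) z := h.differentiable (by norm_num) z
  have key : ∀ u v : ℂ, fderiv ℝ (fun w => fderiv ℝ F w u) z v
      = fderiv ℝ (fderiv ℝ F) z v u := by
    intro u v
    rw [fderiv_clm_apply hd (differentiableAt_const _)]
    simp
  have hs : fderiv ℝ (fderiv ℝ F) z 1 Complex.I = fderiv ℝ (fderiv ℝ F) z Complex.I 1 :=
    (hF.contDiffAt.isSymmSndFDerivAt (by simp)) 1 Complex.I
  have hP : ∀ v : ℂ, fderiv ℝ (dbar F) z v = fderiv ℝ (fderiv ℝ F) z v 1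
      + Complex.I * fderiv ℝ (fderiv ℝ F) z v Complex.I := by
    intro v
    unfold dbar
    have d1 : ∀ u : ℂ, DifferentiableAt ℝ (fun w => fderiv ℝ F w u) z :=
      fun u => hd.clm_apply (differentiableAt_const _)
    rw [fderiv_fun_add (d1 _) ((d1 _).const_mul _), fderiv_const_mul (d1 _)]
    simp [key]
  rw [key, key, hP, hP, hs]
  linear_combination (fderiv ℝ (fderiv ℝ F) z Complex.I Complex.I) * Complex.I_sq

lemma magLap_eq {F : ℂ → ℂ} (ν : ℝ) (hF : ContDiff ℝ 2 F) (z : ℂ) :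
    magLap ν F z = -(1 / 4 : ℂ) *
      (fderiv ℝ (dbar F) z 1 - Complex.I * fderiv ℝ (dbar F) z Complex.I)
      + ((ν : ℂ) / 2) * (starRingEnd ℂ z) * dbar F z := by
  rw [← lap_eq hF]; rfl

lemma dbar_zero_iff {F : ℂ → ℂ} (hF : ContDiff ℝ 2 F) :
    (∀ z, dbar F z = 0) ↔ Differentiable ℂ F := by
  refine forall_congr' fun z => ?_
  rw [differentiableAt_complex_iff_differentiableAt_real]
  have : DifferentiableAt ℝ F z := hF.differentiable (by norm_num) z
  simp only [this, true_and, dbar, smul_eq_mul]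
  constructor
  · intro h
    linear_combination (-Complex.I) * h + (fderiv ℝ F z Complex.I) * Complex.I_sq
  · intro h
    rw [h]; linear_combination (fderiv ℝ F z 1) * Complex.I_sq

/-- The gaussian weight. -/
noncomputable def wt (ν : ℝ) (z : ℂ) : ℝ := Real.exp (-ν * ‖z‖ ^ 2)

lemma wt_fderiv (ν : ℝ) (z : ℂ) :
    HasFDerivAt (fun z => wt ν z) ((-ν * wt ν z * 2) • innerSL ℝ z) z := by
  have h := ((hasStrictFDerivAt_norm_sq z).hasFDerivAt.const_mul (-ν)).exp
  refine h.congr_fderiv ?_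
  ext v
  all_goals simp [wt]
  all_goals ring

lemma wt_contDiff (ν : ℝ) : ContDiff ℝ 1 (wt ν) := by
  unfold wt
  exact (contDiff_const.mul (contDiff_norm_sq ℝ)).exp

/-- conj (dbar F) times the weight. -/
noncomputable def hh (ν : ℝ) (F : ℂ → ℂ) (z : ℂ) : ℂ := starRingEnd ℂ (dbar F z) * (wt ν z : ℂ)

lemma hh_contDiff {F : ℂ → ℂ} (ν : ℝ) (hF : ContDiff ℝ 2 F) : ContDiff ℝ 1 (hh ν F) := by
  unfold hh
  exact (Complex.conjCLE.contDiff.comp (dbar_contDiff hF)).mul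
    (Complex.ofRealCLM.contDiff.comp (wt_contDiff ν))

lemma hh_dbar {F : ℂ → ℂ} (ν : ℝ) (hF : ContDiff ℝ 2 F) (h0 : ∀ z, magLap ν F z = 0) (z : ℂ) :
    dbar (hh ν F) z = 0 := by
  have hP : HasFDerivAt (dbar F) (fderiv ℝ (dbar F) z) z :=
    ((dbar_contDiff hF).differentiable (by norm_num) z).hasFDerivAt
  have h1 : HasFDerivAt (fun z => starRingEnd ℂ (dbar F z))
      ((Complex.conjCLE : ℂ →L[ℝ] ℂ).comp (fderiv ℝ (dbar F) z)) z :=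
    (Complex.conjCLE : ℂ →L[ℝ] ℂ).hasFDerivAt.comp z hP
  have h2 : HasFDerivAt (fun z => (wt ν z : ℂ))
      (Complex.ofRealCLM.comp ((-ν * wt ν z * 2) • innerSL ℝ z)) z :=
    Complex.ofRealCLM.hasFDerivAt.comp z (wt_fderiv ν z)
  have h3 := (h1.mul h2).fderiv
  have h4 := h0 z
  rw [magLap_eq ν hF] at h4
  have h5 := congrArg (starRingEnd ℂ) h4
  simp only [map_add, map_mul, map_neg, map_sub, map_div₀, map_one, map_zero, Complex.conj_I,
    Complex.conj_ofReal, Complex.conj_conj, map_ofNat] at h5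
  have e : dbar (hh ν F) z = fderiv ℝ ((fun z => starRingEnd ℂ (dbar F z)) * fun z => (wt ν z : ℂ)) z 1
     + Complex.I * fderiv ℝ ((fun z => starRingEnd ℂ (dbar F z)) * fun z => (wt ν z : ℂ)) z Complex.I := rfl
  rw [e, h3]
  simp [Complex.inner]
  have hz : (z.re : ℂ) + z.im * Complex.I = z := Complex.re_add_im z
  generalize hA : (starRingEnd ℂ) (dbar F z) = A at *
  generalize (starRingEnd ℂ) (fderiv ℝ (dbar F) z 1) = B at *
  generalize (starRingEnd ℂ) (fderiv ℝ (dbar F) z Complex.I) = C at *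
  linear_combination (-4 * (wt ν z : ℂ)) * h5 - 2 * ν * wt ν z * A * hz

lemma ibp {F h : ℂ → ℂ} {χ : ℂ → ℝ} (hF : ContDiff ℝ 1 F) (hh : ContDiff ℝ 1 h)
    (hχ : ContDiff ℝ 1 χ) (hc : HasCompactSupport χ) (h0 : ∀ z, dbar h z = 0) :
    ∫ z, (χ z : ℂ) ^ 2 * (dbar F z * h z) =
      - ∫ z, F z * (2 * χ z * (fderiv ℝ χ z 1 + Complex.I * fderiv ℝ χ z Complex.I) * h z) := by
  set g : ℂ → ℂ := fun z => (χ z : ℂ) ^ 2 * h z with hg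
  have hχ' : ContDiff ℝ 1 (fun z => (χ z : ℂ)) := Complex.ofRealCLM.contDiff.comp hχ
  have hgc : ContDiff ℝ 1 g := (hχ'.pow 2).mul hh
  have hgs : HasCompactSupport g := by
    refine hc.mono ?_
    intro z hz hz'
    exact hz (by simp [g, hz'])
  have hgs' : ∀ v, HasCompactSupport (fun z => fderiv ℝ g z v) := fun v => hgs.fderiv_apply ℝ v
  have cF : ∀ v, Continuous (fun z => fderiv ℝ F z v) :=
    fun v => (hF.continuous_fderiv (by norm_num)).clm_apply continuous_const
  have cg : ∀ v, Continuous (fun z => fderiv ℝ g z v) :=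
    fun v => (hgc.continuous_fderiv (by norm_num)).clm_apply continuous_const
  have i1 : ∀ v, Integrable (fun z => fderiv ℝ F z v * g z) := fun v =>
    ((cF v).mul hgc.continuous).integrable_of_hasCompactSupport hgs.mul_left
  have i2 : ∀ v, Integrable (fun z => F z * fderiv ℝ g z v) := fun v =>
    (hF.continuous.mul (cg v)).integrable_of_hasCompactSupport (hgs' v).mul_left
  have i3 : Integrable (fun z => F z * g z) :=
    (hF.continuous.mul hgc.continuous).integrable_of_hasCompactSupport hgs.mul_left
  have key : ∀ v, ∫ z, F z * fderiv ℝ g z v = - ∫ z, fderiv ℝ F z v * g z := fun v =>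
    integral_mul_fderiv_eq_neg_fderiv_mul_of_integrable (i1 v) (i2 v) i3
      (fun z _ => hF.differentiable (by norm_num) z)
      (fun z _ => hgc.differentiable (by norm_num) z)
  have e1 : ∫ z, (χ z : ℂ) ^ 2 * (dbar F z * h z) =
      (∫ z, fderiv ℝ F z 1 * g z) + Complex.I * ∫ z, fderiv ℝ F z Complex.I * g z := by
    rw [← integral_const_mul, ← integral_add (i1 _) ((i1 _).const_mul _)]
    congr 1; ext z; simp only [dbar, g]; ring
  have e2 : ∫ z, F z * (2 * χ z * (fderiv ℝ χ z 1 + Complex.I * fderiv ℝ χ z Complex.I) * h z) =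
      (∫ z, F z * fderiv ℝ g z 1) + Complex.I * ∫ z, F z * fderiv ℝ g z Complex.I := by
    rw [← integral_const_mul, ← integral_add (i2 _) ((i2 _).const_mul _)]
    congr 1; ext z
    have d1 : HasFDerivAt (fun z => (χ z : ℂ)) (Complex.ofRealCLM.comp (fderiv ℝ χ z)) z :=
      Complex.ofRealCLM.hasFDerivAt.comp z (hχ.differentiable (by norm_num) z).hasFDerivAt
    have d2 := ((d1.pow 2).mul (hh.differentiable (by norm_num) z).hasFDerivAt).fderiv
    have d3 : fderiv ℝ g z = _ := d2
    have d4 := h0 z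
    simp only [dbar] at d4
    rw [d3]
    simp
    linear_combination (-F z * (χ z : ℂ) ^ 2) * d4
  rw [e1, e2, key, key]; ring

lemma caccioppoli {F : ℂ → ℂ} {χ : ℂ → ℝ} (ν : ℝ) (hF : ContDiff ℝ 2 F)
    (hL2 : GaussianL2 ν F) (h0 : ∀ z, magLap ν F z = 0)
    (hχ : ContDiff ℝ 1 χ) (hc : HasCompactSupport χ) (C : ℝ)
    (hC : ∀ z, ‖fderiv ℝ χ z‖ ≤ C) :
    ∫ z, χ z ^ 2 * (‖dbar F z‖ ^ 2 * wt ν z) ≤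
      16 * C ^ 2 * ∫ z, ‖F z‖ ^ 2 * Real.exp (-ν * ‖z‖ ^ 2) := by
  have hI := ibp (hF.of_le (by norm_num)) (hh_contDiff ν hF) hχ hc (hh_dbar ν hF h0)
  have cw : Continuous (wt ν) := (wt_contDiff ν).continuous
  have cP : Continuous (dbar F) := (dbar_contDiff hF).continuous
  have wpos : ∀ z, 0 ≤ wt ν z := fun z => (Real.exp_pos _).le
  have e1 : ∫ z, (χ z : ℂ) ^ 2 * (dbar F z * hh ν F z) =
      ((∫ z, χ z ^ 2 * (‖dbar F z‖ ^ 2 * wt ν z) : ℝ) : ℂ) := by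
    rw [← integral_complex_ofReal]
    congr 1; ext z
    simp only [hh, ← mul_assoc]
    rw [mul_assoc _ (dbar F z), Complex.mul_conj, Complex.normSq_eq_norm_sq]
    push_cast; ring
  have hIntg : Integrable (fun z => χ z ^ 2 * (‖dbar F z‖ ^ 2 * wt ν z)) := by
    refine Continuous.integrable_of_hasCompactSupport ?_ ?_
    · exact (hχ.continuous.pow 2).mul ((cP.norm.pow 2).mul cw)
    · refine hc.mono ?_
      intro z hz hz'
      exact hz (by simp [hz'])
  have hnn : 0 ≤ ∫ z, χ z ^ 2 * (‖dbar F z‖ ^ 2 * wt ν z) :=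
    integral_nonneg fun z => by have := wpos z; positivity
  have hb : ∫ z, χ z ^ 2 * (‖dbar F z‖ ^ 2 * wt ν z) ≤
      ∫ z, ((1/2 : ℝ) * (χ z ^ 2 * (‖dbar F z‖ ^ 2 * wt ν z)) +
        8 * C ^ 2 * (‖F z‖ ^ 2 * Real.exp (-ν * ‖z‖ ^ 2))) := by
    rw [e1] at hI
    have h1 := congrArg norm hI
    rw [norm_neg, Complex.norm_real, Real.norm_of_nonneg hnn] at h1
    rw [h1]
    refine norm_integral_le_of_norm_le ((hIntg.const_mul _).add (Integrable.const_mul hL2 _)) ?_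
    refine Filter.Eventually.of_forall fun z => ?_
    have n1 : ‖((fderiv ℝ χ z 1 : ℝ) : ℂ) + Complex.I * (fderiv ℝ χ z Complex.I : ℝ)‖ ≤ 2 * C := by
      refine (norm_add_le _ _).trans ?_
      rw [norm_mul, Complex.norm_I, one_mul, Complex.norm_real, Complex.norm_real]
      have a1 := (fderiv ℝ χ z).le_opNorm 1
      have a2 := (fderiv ℝ χ z).le_opNorm Complex.I
      simp only [norm_one, Complex.norm_I, mul_one] at a1 a2
      linarith [hC z]
    generalize ((fderiv ℝ χ z 1 : ℝ) : ℂ) + Complex.I * (fderiv ℝ χ z Complex.I : ℝ) = D at n1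
    have hw : ‖hh ν F z‖ = ‖dbar F z‖ * wt ν z := by
      simp [hh, abs_of_nonneg (wpos z)]
    rw [norm_mul, norm_mul, norm_mul, norm_mul, hw, Complex.norm_real, Complex.norm_ofNat]
    change _ ≤ 1/2 * _ + 8 * C^2 * (‖F z‖ ^ 2 * wt ν z)
    rw [← sq_abs (χ z), ← Real.norm_eq_abs]
    have hw0 := wpos z
    generalize wt ν z = w at *
    have hcc : ‖F z‖ * (2 * ‖χ z‖ * ‖D‖ * (‖dbar F z‖ * w)) ≤
        ‖F z‖ * (2 * ‖χ z‖ * (2 * C) * (‖dbar F z‖ * w)) := by gcongr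
    refine hcc.trans ?_
    have := mul_nonneg hw0 (sq_nonneg (‖χ z‖ * ‖dbar F z‖ - 4 * C * ‖F z‖))
    linarith
  rw [integral_add (hIntg.const_mul _) (Integrable.const_mul hL2 _), integral_const_mul,
    integral_const_mul] at hb
  linarith

lemma cutoffs : ∃ C : ℝ, ∀ n : ℝ, 0 < n → ∃ χ : ℂ → ℝ, ContDiff ℝ 1 χ ∧ HasCompactSupport χ ∧
    (∀ z, ‖fderiv ℝ χ z‖ ≤ C / n) ∧ (∀ z, ‖z‖ ≤ n → χ z = 1) := by
  let f : ContDiffBump (0 : ℂ) := ⟨1, 2, by norm_num, by norm_num⟩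
  have hf : ContDiff ℝ 1 f := f.contDiff
  obtain ⟨C, hC⟩ := (f.hasCompactSupport.fderiv ℝ).exists_bound_of_continuous
    (hf.continuous_fderiv (by norm_num))
  refine ⟨C, fun n hn => ⟨fun z => f (n⁻¹ • z), ?_, ?_, ?_, ?_⟩⟩
  · exact hf.comp (contDiff_const_smul _)
  · exact f.hasCompactSupport.comp_smul (inv_ne_zero hn.ne')
  · intro z
    rw [fderiv_comp_smul, norm_smul, Real.norm_of_nonneg (by positivity), div_eq_inv_mul]
    gcongr
    exact hC _
  · intro z hz
    apply f.one_of_mem_closedBall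
    simp only [mem_closedBall_zero_iff, norm_smul, f]
    rw [Real.norm_of_nonneg (by positivity), inv_mul_le_iff₀ hn]
    simpa using hz

lemma dbar_zero {F : ℂ → ℂ} (ν : ℝ) (hF : ContDiff ℝ 2 F)
    (hL2 : GaussianL2 ν F) (h0 : ∀ z, magLap ν F z = 0) (z₀ : ℂ) : dbar F z₀ = 0 := by
  by_contra hne
  obtain ⟨C, hC⟩ := cutoffs
  have cw : Continuous (wt ν) := (wt_contDiff ν).continuous
  have cP : Continuous (dbar F) := (dbar_contDiff hF).continuous
  have wpos : ∀ z, 0 < wt ν z := fun z => (Real.exp_pos _)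
  have hIntg : ∀ χ : ℂ → ℝ, Continuous χ → HasCompactSupport χ →
      Continuous (fun z => χ z ^ 2 * (‖dbar F z‖ ^ 2 * wt ν z)) ∧
      HasCompactSupport (fun z => χ z ^ 2 * (‖dbar F z‖ ^ 2 * wt ν z)) := by
    intro χ h1 h2
    constructor
    · exact (h1.pow 2).mul ((cP.norm.pow 2).mul cw)
    · refine h2.mono ?_
      intro z hz hz'
      exact hz (by simp [hz'])
  obtain ⟨f, -⟩ : ∃ f : ContDiffBump z₀, f = f := ⟨⟨1, 2, by norm_num, by norm_num⟩, rfl⟩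
  have hf := hIntg f f.continuous f.hasCompactSupport
  have hpos : 0 < ∫ z, f z ^ 2 * (‖dbar F z‖ ^ 2 * wt ν z) := by
    refine hf.1.integral_pos_of_hasCompactSupport_nonneg_nonzero (x := z₀) hf.2 ?_ ?_
    · intro z
      have := (wpos z).le
      simp only [Pi.zero_apply]
      positivity
    · have : f z₀ = 1 := f.one_of_mem_closedBall (by simp [f.rIn_pos.le])
      have := (wpos z₀).ne'
      simp [*]
  set M := ∫ z, ‖F z‖ ^ 2 * Real.exp (-ν * ‖z‖ ^ 2)
  have hle : ∀ᶠ n : ℝ in Filter.atTop,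
      ∫ z, f z ^ 2 * (‖dbar F z‖ ^ 2 * wt ν z) ≤ 16 * (C / n) ^ 2 * M := by
    filter_upwards [Filter.eventually_gt_atTop 0, Filter.eventually_ge_atTop (‖z₀‖ + f.rOut)]
      with n hn hn2
    obtain ⟨χ, c1, c2, c3, c4⟩ := hC n hn
    refine le_trans ?_ (caccioppoli ν hF hL2 h0 c1 c2 _ c3)
    have hχ := hIntg χ c1.continuous c2
    refine integral_mono (hf.1.integrable_of_hasCompactSupport hf.2)
      (hχ.1.integrable_of_hasCompactSupport hχ.2) ?_
    intro z
    have hw := (wpos z).le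
    have hg : 0 ≤ ‖dbar F z‖ ^ 2 * wt ν z := by positivity
    by_cases hz : f.rOut ≤ dist z z₀
    · simp only [f.zero_of_le_dist hz]
      have := mul_nonneg (sq_nonneg (χ z)) hg
      linarith
    · have : ‖z‖ ≤ n := by
        rw [dist_comm, dist_eq_norm] at hz
        have := norm_le_norm_add_norm_sub z₀ z
        linarith
      simp only [c4 z this]
      refine mul_le_mul_of_nonneg_right ?_ hg
      have := f.nonneg (x := z)
      have := f.le_one (x := z)
      nlinarith
  have hlim : Filter.Tendsto (fun n : ℝ => 16 * (C / n) ^ 2 * M) Filter.atTop (nhds 0) := by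
    have := (((Filter.tendsto_id (α := ℝ)).const_div_atTop C).pow 2).const_mul 16 |>.mul_const M
    simpa using this
  have := ge_of_tendsto hlim hle
  linarith

end MagAux

theorem stmt0 (ν : ℝ) (hν : 0 < ν) (F : ℂ → ℂ)
    (hF : ContDiff ℝ 2 F) (hL2 : GaussianL2 ν F) :
    (∀ z : ℂ, magLap ν F z = 0) ↔ Differentiable ℂ F := by
  rw [← MagAux.dbar_zero_iff hF]
  constructor
  · intro h
    exact MagAux.dbar_zero ν hF hL2 h
  · intro h z
    have : MagAux.dbar F = fun _ => 0 := funext h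
    rw [MagAux.magLap_eq ν hF, this]
    simp
end

section
/- Let ν > 0 and let F : ℂ → ℂ be twice continuously differentiable as a function of two real variables. Then the following are equivalent: (i) F ∈ L²,ν, the Wirtinger derivative ∂F/∂z is in L²,ν, and Δ_ν F = 0 on all of ℂ; (ii) F is holomorphic on ℂ and its complex derivative F′ is in L²,ν. (In particular the Bargmann-Dirichlet space 𝒜¹_{2,ν}(ℂ) of entire functions with gaussian-square-integrable derivative coincides with the null space of the magnetic Laplacian Δ_ν restricted to the domain {F ∈ L²,ν : Δ_νF ∈ L²,ν and ∂F/∂z ∈ L²,ν}.) -/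
open MeasureTheory

/-- The Wirtinger derivative `∂F/∂z = (1/2)(∂_x F − i ∂_y F)`. -/
noncomputable def wirtinger (F : ℂ → ℂ) : ℂ → ℂ := fun z =>
  (1 / 2 : ℂ) * (fderiv ℝ F z 1 - Complex.I * fderiv ℝ F z Complex.I)



lemma aux_int_fderiv {𝕜 : Type*} [RCLike 𝕜] {u : ℂ → 𝕜} (hu : ContDiff ℝ 1 u) (hc : HasCompactSupport u) (v : ℂ) :
    ∫ z, fderiv ℝ u z v = 0 := by
  have hcont : Continuous (fun z => fderiv ℝ u z v) :=
    (hu.continuous_fderiv (by norm_num)).clm_apply continuous_const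
  have hcs : HasCompactSupport (fun z => fderiv ℝ u z v) := hc.fderiv_apply (𝕜 := ℝ) v
  have hi := hcont.integrable_of_hasCompactSupport hcs (μ := volume)
  have := integral_mul_fderiv_eq_neg_fderiv_mul_of_integrable (μ := volume)
    (f := fun _ : ℂ => (1:𝕜)) (g := u) (v := v) (by simp) (by simpa using hi)
    (by simpa using hu.continuous.integrable_of_hasCompactSupport hc) (by simp)
    (fun x _ => (hu.differentiable (by norm_num)) x)
  simpa using this

lemma aux_gauss_int {ν : ℝ} (hν : 0 < ν) :
    Integrable (fun z : ℂ => Real.exp (-ν * ‖z‖ ^ 2)) := by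
  have := GaussianFourier.integrable_cexp_neg_mul_sq_norm_add (V := ℂ) (b := (ν:ℂ))
    (by simpa using hν) 0 0
  have := this.norm
  refine this.congr (Filter.Eventually.of_forall fun z => ?_)
  simp only [Complex.norm_exp]
  congr 1
  simp [← Complex.ofReal_pow]

lemma aux_bump : ∃ (f : ℂ → ℝ) (C : ℝ), ContDiff ℝ 2 f ∧ HasCompactSupport f ∧
    (∀ z, 0 ≤ f z) ∧ (∀ z, f z ≤ 1) ∧ (∀ z, ‖z‖ ≤ 1 → f z = 1) ∧
    (∀ z, fderiv ℝ f z z ≤ 0) ∧ (∀ z, ‖fderiv ℝ f z‖ ≤ C) := by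
  let f : ℂ → ℝ := fun z => Real.smoothTransition (2 - ‖z‖ ^ 2)
  have hcd : ContDiff ℝ 2 f := by
    have h1 : ContDiff ℝ 2 Real.smoothTransition := Real.smoothTransition.contDiff (n := 2)
    have h2 : ContDiff ℝ 2 (fun z : ℂ => 2 - ‖z‖ ^ 2) :=
      contDiff_const.sub (contDiff_norm_sq ℝ)
    exact h1.comp h2
  have hcs : HasCompactSupport f := by
    refine HasCompactSupport.of_support_subset_isCompact (isCompact_closedBall (0:ℂ) 2) ?_
    intro z hz
    by_contra h
    apply hz
    apply Real.smoothTransition.zero_of_nonpos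
    simp only [Metric.mem_closedBall, dist_zero_right, not_le] at h
    nlinarith
  obtain ⟨C, hC⟩ := (hcd.continuous_fderiv (by norm_num)).bounded_above_of_compact_support
    (hcs.fderiv (𝕜 := ℝ))
  refine ⟨f, C, hcd, hcs, fun z => Real.smoothTransition.nonneg _,
    fun z => Real.smoothTransition.le_one _, fun z hz => ?_, fun z => ?_, hC⟩
  · apply Real.smoothTransition.one_of_one_le
    have := norm_nonneg z
    nlinarith
  · have h1 : HasDerivAt Real.smoothTransition (deriv Real.smoothTransition (2 - ‖z‖ ^ 2))
        (2 - ‖z‖ ^ 2) :=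
      (((Real.smoothTransition.contDiff (n := 1)).differentiable (by norm_num)) _).hasDerivAt
    have h2 := ((hasStrictFDerivAt_norm_sq (F := ℂ) z).hasFDerivAt).const_sub 2
    have h3 := h1.comp_hasFDerivAt z h2
    have h4 : fderiv ℝ f z = _ := h3.fderiv
    rw [h4]
    have h5 := Real.smoothTransition.monotone.deriv_nonneg (x := 2 - ‖z‖ ^ 2)
    simp
    positivity

lemma aux_cut (f : ℂ → ℝ) (hf : ContDiff ℝ 2 f) (hc : HasCompactSupport f) {R : ℝ} (hR : 0 < R) :
    ContDiff ℝ 2 (fun z : ℂ => f (R⁻¹ • z)) ∧ HasCompactSupport (fun z : ℂ => f (R⁻¹ • z)) ∧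
    ∀ z v : ℂ, fderiv ℝ (fun z : ℂ => f (R⁻¹ • z)) z v = R⁻¹ * fderiv ℝ f (R⁻¹ • z) v := by
  refine ⟨hf.comp (contDiff_const_smul _), hc.comp_smul (by positivity), fun z v => ?_⟩
  rw [fderiv_comp_smul]
  simp

lemma aux_exp_fderiv (ν : ℝ) (z : ℂ) : HasFDerivAt (fun z : ℂ => Real.exp (-ν * ‖z‖ ^ 2))
    ((-2 * ν * Real.exp (-ν * ‖z‖ ^ 2)) • innerSL ℝ z) z := by
  have h2 := ((hasStrictFDerivAt_norm_sq (F := ℂ) z).hasFDerivAt).const_mul (-ν)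
  have := h2.exp
  refine this.congr_fderiv ?_
  ext v; simp; ring

/-- twice the dbar operator -/
noncomputable def dbar (u : ℂ → ℂ) (z : ℂ) : ℂ := fderiv ℝ u z 1 + Complex.I * fderiv ℝ u z Complex.I

lemma dbar_mul {u v : ℂ → ℂ} {z : ℂ} (hu : DifferentiableAt ℝ u z) (hv : DifferentiableAt ℝ v z) :
    dbar (fun w => u w * v w) z = dbar u z * v z + u z * dbar v z := by
  unfold dbar
  rw [fderiv_fun_mul hu hv]
  simp
  ring

lemma dbar_ofReal {f : ℂ → ℝ} {z : ℂ} (hf : DifferentiableAt ℝ f z) :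
    dbar (fun w => (f w : ℂ)) z = (fderiv ℝ f z 1 : ℂ) + Complex.I * (fderiv ℝ f z Complex.I : ℂ) := by
  unfold dbar
  have : fderiv ℝ (fun w => (f w : ℂ)) z = _ := (Complex.ofRealCLM.hasFDerivAt.comp z hf.hasFDerivAt).fderiv
  rw [this]; simp

lemma int_dbar {u : ℂ → ℂ} (hu : ContDiff ℝ 1 u) (hc : HasCompactSupport u) :
    ∫ z, dbar u z = 0 := by
  unfold dbar
  have hcont : ∀ v, Integrable (fun z => fderiv ℝ u z v) := fun v =>
    ((hu.continuous_fderiv (by norm_num)).clm_apply continuous_const).integrable_of_hasCompactSupport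
      (hc.fderiv_apply (𝕜 := ℝ) v)
  rw [integral_add (hcont 1) ((hcont _).const_mul _), integral_const_mul, aux_int_fderiv hu hc,
    aux_int_fderiv hu hc]
  simp

lemma dbar_zero_holo {F : ℂ → ℂ} (hF : Differentiable ℝ F) (h : ∀ z, dbar F z = 0) :
    Differentiable ℂ F := by
  intro z
  rw [differentiableAt_complex_iff_differentiableAt_real]
  refine ⟨hF z, ?_⟩
  have := h z
  unfold dbar at this
  simp only [smul_eq_mul]
  linear_combination (-Complex.I) * this + (fderiv ℝ F z Complex.I) * Complex.I_sq

lemma holo_fderiv {F : ℂ → ℂ} (hF : Differentiable ℂ F) (z v : ℂ) :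
    fderiv ℝ F z v = deriv F z * v := by
  rw [(hF z).fderiv_restrictScalars ℝ]
  simp [mul_comm]

lemma holo_dbar {F : ℂ → ℂ} (hF : Differentiable ℂ F) (z : ℂ) : dbar F z = 0 := by
  unfold dbar
  rw [holo_fderiv hF, holo_fderiv hF]
  linear_combination (deriv F z) * Complex.I_sq

lemma holo_wirt {F : ℂ → ℂ} (hF : Differentiable ℂ F) : wirtinger F = deriv F := by
  ext z
  unfold wirtinger
  rw [holo_fderiv hF, holo_fderiv hF]
  linear_combination (-1/2) * (deriv F z) * Complex.I_sq

lemma lap_eq {F : ℂ → ℂ} (hF : ContDiff ℝ 2 F) (z : ℂ) :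
    fderiv ℝ (fun w => fderiv ℝ F w 1) z 1 + fderiv ℝ (fun w => fderiv ℝ F w Complex.I) z Complex.I
     = fderiv ℝ (dbar F) z 1 - Complex.I * fderiv ℝ (dbar F) z Complex.I := by
  have hd : Differentiable ℝ (fderiv ℝ F) := (hF.fderiv_right (m := 1) (by norm_num)).differentiable (by norm_num)
  have hv : ∀ v, HasFDerivAt (fun w => fderiv ℝ F w v) ((fderiv ℝ (fderiv ℝ F) z).flip v) z := by
    intro v
    have := (hd z).hasFDerivAt.clm_apply (hasFDerivAt_const v z)
    refine this.congr_fderiv ?_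
    ext w; simp
  have hD : HasFDerivAt (dbar F) _ z := (hv 1).add ((hv Complex.I).const_mul Complex.I)
  rw [hD.fderiv, (hv 1).fderiv, (hv Complex.I).fderiv]
  have hs := (hF.contDiffAt (x := z)).isSymmSndFDerivAt (by simp)
  have := hs 1 Complex.I
  simp [this]
  linear_combination (fderiv ℝ (fderiv ℝ F) z Complex.I Complex.I) * Complex.I_sq

lemma dbar_contDiff {F : ℂ → ℂ} (hF : ContDiff ℝ 2 F) : ContDiff ℝ 1 (dbar F) := by
  have hd : ContDiff ℝ 1 (fderiv ℝ F) := hF.fderiv_right (m := 1) (by norm_num)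
  unfold dbar
  exact (hd.clm_apply contDiff_const).add (contDiff_const.mul (hd.clm_apply contDiff_const))

lemma exp_contDiff (ν : ℝ) : ContDiff ℝ 1 (fun z : ℂ => Real.exp (-ν * ‖z‖ ^ 2)) :=
  (contDiff_const.mul (contDiff_norm_sq ℝ)).exp

lemma ofReal_contDiff {f : ℂ → ℝ} (hf : ContDiff ℝ 1 f) : ContDiff ℝ 1 (fun z => (f z : ℂ)) :=
  Complex.ofRealCLM.contDiff.comp hf

lemma conj_contDiff {f : ℂ → ℂ} (hf : ContDiff ℝ 1 f) :
    ContDiff ℝ 1 (fun z => (starRingEnd ℂ) (f z)) :=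
  Complex.conjCLE.contDiff.comp hf

lemma dbar_conj {G : ℂ → ℂ} {z : ℂ} (hG : DifferentiableAt ℝ G z) :
    dbar (fun w => (starRingEnd ℂ) (G w)) z =
      (starRingEnd ℂ) (fderiv ℝ G z 1 - Complex.I * fderiv ℝ G z Complex.I) := by
  have : fderiv ℝ (fun w => (starRingEnd ℂ) (G w)) z = _ :=
    (Complex.conjCLE.toContinuousLinearMap.hasFDerivAt.comp z hG.hasFDerivAt).fderiv
  unfold dbar
  rw [this]
  simp

lemma dbar_exp (ν : ℝ) (z : ℂ) :
    dbar (fun w => ((Real.exp (-ν * ‖w‖ ^ 2) : ℝ) : ℂ)) z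
      = -2 * ν * z * (Real.exp (-ν * ‖z‖ ^ 2) : ℝ) := by
  rw [dbar_ofReal (aux_exp_fderiv ν z).differentiableAt, (aux_exp_fderiv ν z).fderiv]
  have h1 : (inner ℝ z 1 : ℝ) = z.re := by simp [Complex.inner]
  have h2 : (inner ℝ z Complex.I : ℝ) = z.im := by simp [Complex.inner]
  simp only [FunLike.coe_smul, Pi.smul_apply, innerSL_apply_apply, h1, h2, smul_eq_mul]
  push_cast
  linear_combination (-2 * (ν : ℂ) * Complex.exp (-(ν : ℂ) * (‖z‖ : ℂ) ^ 2)) * Complex.re_add_im z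

lemma dbar_K {ν : ℝ} {F : ℂ → ℂ} (hF : ContDiff ℝ 2 F) {z : ℂ} (h : magLap ν F z = 0) :
    dbar (fun w => (starRingEnd ℂ) (dbar F w) * ((Real.exp (-ν * ‖w‖ ^ 2) : ℝ) : ℂ)) z = 0 := by
  have hG := dbar_contDiff hF
  rw [dbar_mul (((conj_contDiff hG).differentiable (by norm_num)) z)
    (((ofReal_contDiff (exp_contDiff ν)).differentiable (by norm_num)) z),
    dbar_exp, dbar_conj ((hG.differentiable (by norm_num)) z), ← lap_eq hF]
  unfold magLap at h
  have h' : fderiv ℝ (fun w => fderiv ℝ F w 1) z 1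
      + fderiv ℝ (fun w => fderiv ℝ F w Complex.I) z Complex.I
      = 2 * ν * (starRingEnd ℂ z) * dbar F z := by
    unfold dbar
    linear_combination (-4) * h
  rw [h']
  simp only [map_mul, map_ofNat, Complex.conj_ofReal, Complex.conj_conj]
  ring

lemma A_bound {ν : ℝ} {F : ℂ → ℂ} (hF : ContDiff ℝ 2 F) (h : ∀ z, magLap ν F z = 0)
    (hL : GaussianL2 ν F) {χ : ℂ → ℝ} (hχ : ContDiff ℝ 2 χ) (hc : HasCompactSupport χ)
    {D : ℝ} (hD : ∀ z, ‖dbar (fun w => (χ w : ℂ)) z‖ ≤ D) :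
    ∫ z, χ z ^ 2 * (‖dbar F z‖ ^ 2 * Real.exp (-ν * ‖z‖ ^ 2)) ≤
      4 * D ^ 2 * ∫ z, ‖F z‖ ^ 2 * Real.exp (-ν * ‖z‖ ^ 2) := by
  have hG := dbar_contDiff hF
  have hF1 : ContDiff ℝ 1 F := hF.of_le (by norm_num)
  have hχ1 : ContDiff ℝ 1 (fun w => (χ w : ℂ)) := ofReal_contDiff (hχ.of_le (by norm_num))
  set K : ℂ → ℂ := fun w => (starRingEnd ℂ) (dbar F w) * ((Real.exp (-ν * ‖w‖ ^ 2) : ℝ) : ℂ) with hKdef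
  have hK : ContDiff ℝ 1 K := (conj_contDiff hG).mul (ofReal_contDiff (exp_contDiff ν))
  set u : ℂ → ℂ := fun w => ((χ w : ℂ) * (χ w : ℂ)) * (F w * K w) with hu
  have hucd : ContDiff ℝ 1 u := (hχ1.mul hχ1).mul (hF1.mul hK)
  have hcC : HasCompactSupport (fun w => (χ w : ℂ)) := hc.comp_left (g := fun x : ℝ => (x : ℂ)) (by simp)
  have hucs : HasCompactSupport u := (hcC.mul_right).mul_right
  have hint := int_dbar hucd hucs
  have hdu : ∀ z, dbar u z = 2 * (χ z : ℂ) * dbar (fun w => (χ w : ℂ)) z * (F z * K z)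
      + (χ z : ℂ) ^ 2 * (dbar F z * K z) := by
    intro z
    have d1 := (hχ1.differentiable (by norm_num)) z
    have d2 := (hF1.differentiable (by norm_num)) z
    have d3 := (hK.differentiable (by norm_num)) z
    rw [hu, dbar_mul (d1.fun_mul d1) (d2.fun_mul d3), dbar_mul d1 d1, dbar_mul d2 d3,
      hKdef, dbar_K hF (h z)]
    ring
  have hpt : ∀ z, (1/2) * (χ z ^ 2 * (‖dbar F z‖ ^ 2 * Real.exp (-ν * ‖z‖ ^ 2)))
      - 2 * D ^ 2 * (‖F z‖ ^ 2 * Real.exp (-ν * ‖z‖ ^ 2)) ≤ (dbar u z).re := by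
    intro z
    have he := Real.exp_pos (-ν * ‖z‖ ^ 2)
    set e := Real.exp (-ν * ‖z‖ ^ 2)
    have hGK : (χ z : ℂ) ^ 2 * (dbar F z * K z) = ((χ z ^ 2 * (‖dbar F z‖ ^ 2 * e) : ℝ) : ℂ) := by
      simp only [hKdef]
      rw [← mul_assoc (dbar F z), Complex.mul_conj, Complex.normSq_eq_norm_sq]
      simp only [Complex.ofReal_mul, Complex.ofReal_pow, e]
    have hn : ‖2 * (χ z : ℂ) * dbar (fun w => (χ w : ℂ)) z * (F z * K z)‖
        ≤ 2 * |χ z| * D * (‖F z‖ * (‖dbar F z‖ * e)) := by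
      simp only [hKdef, norm_mul, Complex.norm_real, Complex.norm_conj, Real.norm_eq_abs,
        Complex.norm_ofNat]
      rw [abs_of_pos he]
      gcongr
      exact hD z
    have hre := (abs_le.mp ((Complex.abs_re_le_norm _).trans hn)).1
    rw [hdu, hGK, Complex.add_re, Complex.ofReal_re]
    have hsq : 0 ≤ e * (|χ z| * ‖dbar F z‖ - 2 * D * ‖F z‖) ^ 2 := by positivity
    rw [← sq_abs (χ z)]
    linarith
  have hGi : Integrable (fun z => χ z ^ 2 * (‖dbar F z‖ ^ 2 * Real.exp (-ν * ‖z‖ ^ 2))) := by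
    apply Continuous.integrable_of_hasCompactSupport
    · exact (hχ.continuous.pow 2).mul ((hG.continuous.norm.pow 2).mul (exp_contDiff ν).continuous)
    · exact (hc.comp_left (g := fun x : ℝ => x ^ 2) (by simp)).mul_right
  have hui : Integrable (dbar u) := by
    apply Continuous.integrable_of_hasCompactSupport
    · have := hucd.continuous_fderiv (by norm_num)
      exact (this.clm_apply continuous_const).add
        (continuous_const.mul (this.clm_apply continuous_const))
    · exact (hucs.fderiv_apply (𝕜 := ℝ) 1).add ((hucs.fderiv_apply (𝕜 := ℝ) Complex.I).mul_left)
  have hre0 : ∫ z, (dbar u z).re = 0 := by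
    have := integral_re hui
    simp only [RCLike.re_to_complex] at this
    rw [this, hint]; simp
  have hle := integral_mono ((hGi.const_mul (1/2)).sub (Integrable.const_mul hL (2 * D ^ 2))) hui.re hpt
  simp only [RCLike.re_to_complex] at hle
  rw [hre0] at hle
  simp only [Pi.sub_apply] at hle
  rw [integral_sub (hGi.const_mul (1/2)) (Integrable.const_mul hL (2 * D ^ 2)),
    integral_const_mul, integral_const_mul] at hle
  linarith

lemma A_main {ν : ℝ} {F : ℂ → ℂ} (hF : ContDiff ℝ 2 F) (h : ∀ z, magLap ν F z = 0)
    (hL : GaussianL2 ν F) : ∀ z, dbar F z = 0 := by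
  obtain ⟨f, C, hf, hfc, hf0, hf1, hfb, hfr, hfC⟩ := aux_bump
  have hG := dbar_contDiff hF
  set g : ℂ → ℝ := fun z => ‖dbar F z‖ ^ 2 * Real.exp (-ν * ‖z‖ ^ 2) with hg
  have hgc : Continuous g := (hG.continuous.norm.pow 2).mul (exp_contDiff ν).continuous
  have hg0 : ∀ z, 0 ≤ g z := fun z => by positivity
  set M := ∫ z, ‖F z‖ ^ 2 * Real.exp (-ν * ‖z‖ ^ 2) with hM
  have hgi : ∀ r : ℝ, IntegrableOn g (Metric.closedBall 0 r) := fun r =>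
    hgc.continuousOn.integrableOn_compact (isCompact_closedBall _ _)
  have hb : ∀ r : ℝ, ∀ R : ℝ, 0 < R → r ≤ R →
      ∫ z in Metric.closedBall (0:ℂ) r, g z ≤ 4 * (R⁻¹ * (2 * C)) ^ 2 * M := by
    intro r R hR hrR
    obtain ⟨h1, h2, h3⟩ := aux_cut f hf hfc hR
    have hD : ∀ z, ‖dbar (fun w => ((f (R⁻¹ • w) : ℝ) : ℂ)) z‖ ≤ R⁻¹ * (2 * C) := by
      intro z
      rw [dbar_ofReal (h1.differentiable (by norm_num) z), h3, h3]
      have b1 := (fderiv ℝ f (R⁻¹ • z)).le_of_opNorm_le (hfC _) 1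
      have b2 := (fderiv ℝ f (R⁻¹ • z)).le_of_opNorm_le (hfC _) Complex.I
      simp only [norm_one, Complex.norm_I, mul_one] at b1 b2
      refine (norm_add_le _ _).trans ?_
      rw [norm_mul, Complex.norm_I, one_mul, Complex.norm_real, Complex.norm_real, norm_mul, norm_mul,
        Real.norm_of_nonneg (by positivity : 0 ≤ R⁻¹), ← mul_add]
      gcongr
      linarith
    have hA := A_bound hF h hL h1 h2 hD
    refine le_trans ?_ hA
    have hi : Integrable (fun z => f (R⁻¹ • z) ^ 2 * g z) := by
      apply Continuous.integrable_of_hasCompactSupport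
      · exact (h1.continuous.pow 2).mul hgc
      · exact (h2.comp_left (g := fun x : ℝ => x ^ 2) (by simp)).mul_right
    calc ∫ z in Metric.closedBall (0:ℂ) r, g z
        = ∫ z in Metric.closedBall (0:ℂ) r, f (R⁻¹ • z) ^ 2 * g z := by
          refine setIntegral_congr_fun measurableSet_closedBall fun z hz => ?_
          have : f (R⁻¹ • z) = 1 := by
            apply hfb
            rw [norm_smul, Real.norm_of_nonneg (by positivity : 0 ≤ R⁻¹)]
            have : ‖z‖ ≤ R := (mem_closedBall_zero_iff.mp hz).trans hrR
            rw [inv_mul_le_iff₀ hR]; simpa using this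
          simp only [this]; ring
      _ ≤ ∫ z, f (R⁻¹ • z) ^ 2 * g z :=
          setIntegral_le_integral hi (Filter.Eventually.of_forall fun z => mul_nonneg (sq_nonneg _) (hg0 z))
  have hz : ∀ r : ℝ, ∫ z in Metric.closedBall (0:ℂ) r, g z = 0 := by
    intro r
    apply le_antisymm
    · have ht : Filter.Tendsto (fun R : ℝ => 4 * (R⁻¹ * (2 * C)) ^ 2 * M) Filter.atTop (nhds 0) := by
        have := (((tendsto_inv_atTop_zero (𝕜 := ℝ)).mul_const (2 * C)).pow 2).const_mul 4 |>.mul_const M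
        simpa using this
      refine ge_of_tendsto ht ?_
      filter_upwards [Filter.eventually_gt_atTop 0, Filter.eventually_ge_atTop r] with R h1 h2
      exact hb r R h1 h2
    · exact integral_nonneg hg0
  have hcov := aecover_closedBall (μ := (volume : Measure ℂ)) (x := (0:ℂ)) (Filter.tendsto_id (x := Filter.atTop (α := ℝ)))
  have hI : Integrable g := hcov.integrable_of_integral_bounded_of_nonneg_ae 0 hgi
    (Filter.Eventually.of_forall hg0) (Filter.Eventually.of_forall fun r => (hz r).le)
  have hI0 : ∫ z, g z = 0 := hcov.integral_eq_of_tendsto 0 hI (by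
    simp only [id, hz]; exact tendsto_const_nhds)
  have hae := (integral_eq_zero_iff_of_nonneg hg0 hI).mp hI0
  have heq := (hgc.ae_eq_iff_eq volume continuous_zero).mp hae
  intro z
  have := congrFun heq z
  simp [hg] at this
  exact this

lemma int_euler {P : ℂ → ℝ} (hP : ContDiff ℝ 1 P) (hc : HasCompactSupport P) :
    Integrable (fun z => 2 * P z + fderiv ℝ P z z) ∧ ∫ z, (2 * P z + fderiv ℝ P z z) = 0 := by
  have h1 : ContDiff ℝ 1 (fun z : ℂ => z.re * P z) := Complex.reCLM.contDiff.mul hP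
  have h2 : ContDiff ℝ 1 (fun z : ℂ => z.im * P z) := Complex.imCLM.contDiff.mul hP
  have c1 : HasCompactSupport (fun z : ℂ => z.re * P z) := hc.mul_left
  have c2 : HasCompactSupport (fun z : ℂ => z.im * P z) := hc.mul_left
  have i1 : Integrable (fun z => fderiv ℝ (fun z : ℂ => z.re * P z) z 1) :=
    ((h1.continuous_fderiv (by norm_num)).clm_apply
      continuous_const).integrable_of_hasCompactSupport (c1.fderiv_apply (𝕜 := ℝ) 1)
  have i2 : Integrable (fun z => fderiv ℝ (fun z : ℂ => z.im * P z) z Complex.I) :=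
    ((h2.continuous_fderiv (by norm_num)).clm_apply
      continuous_const).integrable_of_hasCompactSupport (c2.fderiv_apply (𝕜 := ℝ) Complex.I)
  have key : (fun z => 2 * P z + fderiv ℝ P z z) = fun z =>
      fderiv ℝ (fun z : ℂ => z.re * P z) z 1 + fderiv ℝ (fun z : ℂ => z.im * P z) z Complex.I := by
    ext z
    have hd := (hP.differentiable (by norm_num) z).hasFDerivAt
    have e1 : fderiv ℝ (fun z : ℂ => z.re * P z) z = _ :=
      ((Complex.reCLM.hasFDerivAt (x := z)).mul hd).fderiv
    have e2 : fderiv ℝ (fun z : ℂ => z.im * P z) z = _ :=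
      ((Complex.imCLM.hasFDerivAt (x := z)).mul hd).fderiv
    have ez : fderiv ℝ P z z = z.re * fderiv ℝ P z 1 + z.im * fderiv ℝ P z Complex.I := by
      have : z = z.re • (1 : ℂ) + z.im • Complex.I := by
        simp
      conv_lhs => arg 2; rw [this]
      rw [map_add, map_smul, map_smul]; simp
    rw [e1, e2, ez]
    simp
    ring
  rw [key]
  refine ⟨i1.add i2, ?_⟩
  rw [integral_add i1 i2, aux_int_fderiv h1 c1, aux_int_fderiv h2 c2, add_zero]

lemma C_bound {ν : ℝ} (hν : 0 < ν) {F : ℂ → ℂ} (hF : Differentiable ℂ F) (hF2 : ContDiff ℝ 2 F)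
    (hL : GaussianL2 ν (deriv F)) {χ : ℂ → ℝ} (hχ : ContDiff ℝ 2 χ) (hc : HasCompactSupport χ)
    (h0 : ∀ z, 0 ≤ χ z) (h1 : ∀ z, χ z ≤ 1) (hr : ∀ z, fderiv ℝ χ z z ≤ 0)
    {B : ℝ} (hB0 : 0 ≤ B) (hB : ∀ z, ν * ‖z‖ ^ 2 ≤ 3 → ‖F z‖ ^ 2 ≤ B) :
    ∫ z, χ z * (‖F z‖ ^ 2 * Real.exp (-ν * ‖z‖ ^ 2)) ≤
      ∫ z : ℂ, (3 * B * Real.exp (-ν * ‖z‖ ^ 2)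
        + ν⁻¹ * (‖deriv F z‖ ^ 2 * Real.exp (-ν * ‖z‖ ^ 2))) := by
  have hF1 : ContDiff ℝ 1 F := hF2.of_le (by norm_num)
  have hχ1 : ContDiff ℝ 1 χ := hχ.of_le (by norm_num)
  set P : ℂ → ℝ := fun z => χ z * (‖F z‖ ^ 2 * Real.exp (-ν * ‖z‖ ^ 2)) with hP
  have hPcd : ContDiff ℝ 1 P := hχ1.mul ((hF1.norm_sq ℝ).mul (exp_contDiff ν))
  have hPcs : HasCompactSupport P := hc.mul_right
  have hPi : Integrable P := hPcd.continuous.integrable_of_hasCompactSupport hPcs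
  obtain ⟨hEi, hE0⟩ := int_euler hPcd hPcs
  have hRi : Integrable (fun z : ℂ => 3 * B * Real.exp (-ν * ‖z‖ ^ 2)
        + ν⁻¹ * (‖deriv F z‖ ^ 2 * Real.exp (-ν * ‖z‖ ^ 2))) :=
    ((aux_gauss_int hν).const_mul _).add (Integrable.const_mul hL _)
  have hpt : ∀ z, P z + (2 * P z + fderiv ℝ P z z) ≤ 3 * B * Real.exp (-ν * ‖z‖ ^ 2)
        + ν⁻¹ * (‖deriv F z‖ ^ 2 * Real.exp (-ν * ‖z‖ ^ 2)) := by
    intro z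
    have d1 := (hχ1.differentiable (by norm_num) z).hasFDerivAt
    have d2 := (hF1.differentiable (by norm_num) z).hasFDerivAt.norm_sq
    have d3 : fderiv ℝ P z = _ := (d1.mul (d2.mul (aux_exp_fderiv ν z))).fderiv
    have d4 : fderiv ℝ P z z = χ z * (‖F z‖ ^ 2 * (-2 * ν * Real.exp (-ν * ‖z‖ ^ 2) * ‖z‖ ^ 2)
        + Real.exp (-ν * ‖z‖ ^ 2) * (2 * inner ℝ (F z) (deriv F z * z)))
        + ‖F z‖ ^ 2 * Real.exp (-ν * ‖z‖ ^ 2) * fderiv ℝ χ z z := by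
      rw [d3, ← holo_fderiv hF]
      simp
      ring
    rw [d4]
    simp only [hP]
    have he := Real.exp_pos (-ν * ‖z‖ ^ 2)
    set e := Real.exp (-ν * ‖z‖ ^ 2)
    have k1 : ‖F z‖ ^ 2 * e * fderiv ℝ χ z z ≤ 0 :=
      mul_nonpos_of_nonneg_of_nonpos (by positivity) (hr z)
    have k2 : inner ℝ (F z) (deriv F z * z) ≤ ‖F z‖ * (‖deriv F z‖ * ‖z‖) := by
      simpa using real_inner_le_norm (F z) (deriv F z * z)
    have k3 : 2 * (‖F z‖ * (‖deriv F z‖ * ‖z‖)) ≤ ν * ‖z‖ ^ 2 * ‖F z‖ ^ 2 + ν⁻¹ * ‖deriv F z‖ ^ 2 := by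
      have : 0 ≤ ν⁻¹ * (ν * ‖z‖ * ‖F z‖ - ‖deriv F z‖) ^ 2 := by positivity
      have e1 : ν⁻¹ * (ν * ‖z‖ * ‖F z‖ - ‖deriv F z‖) ^ 2 = ν * ‖z‖ ^ 2 * ‖F z‖ ^ 2
          + ν⁻¹ * ‖deriv F z‖ ^ 2 - 2 * (‖F z‖ * (‖deriv F z‖ * ‖z‖)) := by
        field_simp
        ring
      linarith
    have k4 : (3 - ν * ‖z‖ ^ 2) * ‖F z‖ ^ 2 ≤ 3 * B := by
      by_cases hz : ν * ‖z‖ ^ 2 ≤ 3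
      · have := hB z hz
        have : 0 ≤ ν * ‖z‖ ^ 2 := by positivity
        nlinarith [sq_nonneg ‖F z‖]
      · nlinarith [sq_nonneg ‖F z‖]
    have k5 : (3 * ‖F z‖ ^ 2 - 2 * ν * ‖z‖ ^ 2 * ‖F z‖ ^ 2 + 2 * inner ℝ (F z) (deriv F z * z))
        ≤ 3 * B + ν⁻¹ * ‖deriv F z‖ ^ 2 := by linarith
    have k6 : 0 ≤ 3 * B + ν⁻¹ * ‖deriv F z‖ ^ 2 := by positivity
    have k7 : χ z * e * (3 * ‖F z‖ ^ 2 - 2 * ν * ‖z‖ ^ 2 * ‖F z‖ ^ 2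
        + 2 * inner ℝ (F z) (deriv F z * z)) ≤ e * (3 * B + ν⁻¹ * ‖deriv F z‖ ^ 2) := by
      calc _ ≤ χ z * e * (3 * B + ν⁻¹ * ‖deriv F z‖ ^ 2) :=
            mul_le_mul_of_nonneg_left k5 (mul_nonneg (h0 z) he.le)
        _ ≤ 1 * e * (3 * B + ν⁻¹ * ‖deriv F z‖ ^ 2) := by
            gcongr
            exact h1 z
        _ = _ := by ring
    linarith
  have := integral_mono (hPi.add hEi) hRi hpt
  simp only [Pi.add_apply] at this
  rw [integral_add hPi hEi, hE0, add_zero] at this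
  exact this

lemma C_main {ν : ℝ} (hν : 0 < ν) {F : ℂ → ℂ} (hF : Differentiable ℂ F) (hF2 : ContDiff ℝ 2 F)
    (hL : GaussianL2 ν (deriv F)) : GaussianL2 ν F := by
  obtain ⟨f, C, hf, hfc, hf0, hf1, hfb, hfr, hfC⟩ := aux_bump
  have hgc : Continuous (fun z => ‖F z‖ ^ 2 * Real.exp (-ν * ‖z‖ ^ 2)) :=
    (hF2.continuous.norm.pow 2).mul (exp_contDiff ν).continuous
  have hg0 : ∀ z, 0 ≤ ‖F z‖ ^ 2 * Real.exp (-ν * ‖z‖ ^ 2) := fun z => by positivity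
  obtain ⟨B, hB⟩ := (isCompact_closedBall (0:ℂ) (3 / ν + 1)).exists_bound_of_continuousOn
    (hF2.continuous.norm.pow 2).continuousOn
  have hB' : ∀ z, ν * ‖z‖ ^ 2 ≤ 3 → ‖F z‖ ^ 2 ≤ |B| := by
    intro z hz
    have hz' : ‖z‖ ^ 2 ≤ 3 / ν := by
      rw [le_div_iff₀ hν]; linarith
    have := hB z (by
      rw [mem_closedBall_zero_iff]
      nlinarith [sq_nonneg (‖z‖ - 1)])
    exact (le_abs_self _).trans (this.trans (le_abs_self B))
  have hcov := aecover_closedBall (μ := (volume : Measure ℂ)) (x := (0:ℂ))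
    (Filter.tendsto_id (x := Filter.atTop (α := ℝ)))
  refine hcov.integrable_of_integral_bounded_of_nonneg_ae (∫ z : ℂ, (3 * |B| * Real.exp (-ν * ‖z‖ ^ 2)
        + ν⁻¹ * (‖deriv F z‖ ^ 2 * Real.exp (-ν * ‖z‖ ^ 2))))
    (fun r => hgc.continuousOn.integrableOn_compact (isCompact_closedBall _ _))
    (Filter.Eventually.of_forall hg0) ?_
  filter_upwards [Filter.eventually_gt_atTop 0] with R hR
  obtain ⟨h1, h2, h3⟩ := aux_cut f hf hfc hR
  refine le_trans ?_ (C_bound hν hF hF2 hL h1 h2 (fun z => hf0 _) (fun z => hf1 _) ?_ (abs_nonneg B) hB')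
  · have hi : Integrable (fun z => f (R⁻¹ • z) * (‖F z‖ ^ 2 * Real.exp (-ν * ‖z‖ ^ 2))) :=
      (h1.continuous.mul hgc).integrable_of_hasCompactSupport h2.mul_right
    calc ∫ z in Metric.closedBall (0:ℂ) R, ‖F z‖ ^ 2 * Real.exp (-ν * ‖z‖ ^ 2)
        = ∫ z in Metric.closedBall (0:ℂ) R, f (R⁻¹ • z) * (‖F z‖ ^ 2 * Real.exp (-ν * ‖z‖ ^ 2)) := by
          refine setIntegral_congr_fun measurableSet_closedBall fun z hz => ?_
          have : f (R⁻¹ • z) = 1 := by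
            apply hfb
            rw [norm_smul, Real.norm_of_nonneg (by positivity : 0 ≤ R⁻¹)]
            have : ‖z‖ ≤ R := mem_closedBall_zero_iff.mp hz
            rw [inv_mul_le_iff₀ hR]; simpa using this
          simp only [this]; ring
      _ ≤ ∫ z, f (R⁻¹ • z) * (‖F z‖ ^ 2 * Real.exp (-ν * ‖z‖ ^ 2)) :=
          setIntegral_le_integral hi
            (Filter.Eventually.of_forall fun z => mul_nonneg (hf0 _) (hg0 z))
  · intro z
    rw [h3]
    have := hfr (R⁻¹ • z)
    rw [map_smul] at this
    simpa using this

theorem stmt1 (ν : ℝ) (hν : 0 < ν) (F : ℂ → ℂ) (hF : ContDiff ℝ 2 F) :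
    (GaussianL2 ν F ∧ GaussianL2 ν (wirtinger F) ∧ ∀ z : ℂ, magLap ν F z = 0) ↔
      (Differentiable ℂ F ∧ GaussianL2 ν (deriv F)) := by
  constructor
  · rintro ⟨h1, h2, h3⟩
    have hd := dbar_zero_holo (hF.differentiable (by norm_num)) (A_main hF h3 h1)
    exact ⟨hd, by rwa [holo_wirt hd] at h2⟩
  · rintro ⟨hd, h2⟩
    refine ⟨C_main hν hd hF h2, by rwa [holo_wirt hd], fun z => ?_⟩
    have h0 : dbar F = fun _ => 0 := funext (holo_dbar hd)
    have hz : fderiv ℝ F z 1 + Complex.I * fderiv ℝ F z Complex.I = 0 := holo_dbar hd z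
    unfold magLap
    rw [lap_eq hF, h0, hz]
    simp
end

section
/- Let ν > 0 and let f : ℂ → ℂ be an entire function such that ∫_ℂ |f′(z)|² e^{−ν|z|²} dλ(z) < ∞, where f′ is the complex derivative of f. Then ∫_ℂ |f(z)|² e^{−ν|z|²} dλ(z) < ∞. -/
open MeasureTheory

lemma aux_1d (ν : ℝ) (hν : 0 < ν) (u v : ℝ → ℂ) (hu : ∀ r, HasDerivAt u (v r) r)
    (hv : Continuous v) (M : ℝ) (hM : ∀ r ∈ Set.Icc (0:ℝ) 1, ‖u r‖ ^ 2 ≤ M) (R : ℝ) (hR : 1 ≤ R) :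
    ∫ r in (0:ℝ)..R, r * (‖u r‖ ^ 2 * Real.exp (-ν * r ^ 2)) ≤
      (M + M / ν) + (1 / ν ^ 2) * ∫ r in (0:ℝ)..R, r * (‖v r‖ ^ 2 * Real.exp (-ν * r ^ 2)) := by
  have hcu : Continuous u := continuous_iff_continuousAt.2 fun r => (hu r).continuousAt
  have ca : Continuous fun r : ℝ => r * (‖u r‖ ^ 2 * Real.exp (-ν * r ^ 2)) := by fun_prop
  have cb : Continuous fun r : ℝ => r * (‖v r‖ ^ 2 * Real.exp (-ν * r ^ 2)) := by fun_prop
  have hM0 : 0 ≤ M := (sq_nonneg _).trans (hM 0 (by simp))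
  let Φ : ℝ → ℝ := fun R => (∫ r in (0:ℝ)..R, r * (‖u r‖ ^ 2 * Real.exp (-ν * r ^ 2))) -
    (1 / ν ^ 2) * (∫ r in (0:ℝ)..R, r * (‖v r‖ ^ 2 * Real.exp (-ν * r ^ 2))) +
    (1 / ν) * (‖u R‖ ^ 2 * Real.exp (-ν * R ^ 2))
  have hΦ : ∀ r, HasDerivAt Φ (r * (‖u r‖ ^ 2 * Real.exp (-ν * r ^ 2)) -
      (1 / ν ^ 2) * (r * (‖v r‖ ^ 2 * Real.exp (-ν * r ^ 2))) +
      (1 / ν) * ((2 * inner ℝ (u r) (v r)) * Real.exp (-ν * r ^ 2) +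
        ‖u r‖ ^ 2 * (Real.exp (-ν * r ^ 2) * (-ν * (2 * r))))) r := by
    intro r
    have h1 := ca.integral_hasStrictDerivAt 0 r
    have h2 := cb.integral_hasStrictDerivAt 0 r
    have h3 : HasDerivAt (fun r : ℝ => Real.exp (-ν * r ^ 2))
        (Real.exp (-ν * r ^ 2) * (-ν * (2 * r))) r := by
      have := ((hasDerivAt_pow 2 r).const_mul (-ν)).exp
      simpa using this
    exact (h1.hasDerivAt.sub (h2.hasDerivAt.const_mul _)).add
      (((hu r).norm_sq.mul h3).const_mul _)
  have hanti : AntitoneOn Φ (Set.Ici 1) := by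
    apply antitoneOn_of_deriv_nonpos (convex_Ici 1)
    · exact fun r _ => (hΦ r).continuousAt.continuousWithinAt
    · exact fun r _ => (hΦ r).differentiableAt.differentiableWithinAt
    · intro r hr
      rw [interior_Ici] at hr
      have hr : 1 < r := hr
      rw [(hΦ r).deriv]
      have hin : inner ℝ (u r) (v r) ≤ ‖u r‖ * ‖v r‖ := real_inner_le_norm _ _
      have hE := Real.exp_pos (-ν * r ^ 2)
      set E := Real.exp (-ν * r ^ 2)
      set I := inner ℝ (u r) (v r)
      have key : 2 * I / ν ≤ r * (‖u r‖ ^ 2 + ‖v r‖ ^ 2 / ν ^ 2) := by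
        have e1 : 2 * I / ν ≤ 2 * (‖u r‖ * ‖v r‖) / ν := by gcongr
        have e2 : 2 * (‖u r‖ * ‖v r‖) / ν ≤ ‖u r‖ ^ 2 + ‖v r‖ ^ 2 / ν ^ 2 := by
          have := sq_nonneg (‖u r‖ - ‖v r‖ / ν)
          have e : (‖u r‖ - ‖v r‖ / ν) ^ 2 =
            ‖u r‖ ^ 2 + ‖v r‖ ^ 2 / ν ^ 2 - 2 * (‖u r‖ * ‖v r‖) / ν := by
            field_simp
            ring
          linarith
        have e3 : 0 ≤ ‖u r‖ ^ 2 + ‖v r‖ ^ 2 / ν ^ 2 := by positivity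
        nlinarith
      have : r * (‖u r‖ ^ 2 * E) - 1 / ν ^ 2 * (r * (‖v r‖ ^ 2 * E)) +
        1 / ν * (2 * I * E + ‖u r‖ ^ 2 * (E * (-ν * (2 * r)))) =
        E * (2 * I / ν - r * (‖u r‖ ^ 2 + ‖v r‖ ^ 2 / ν ^ 2)) := by
        field_simp
        ring
      rw [this]
      exact mul_nonpos_of_nonneg_of_nonpos hE.le (by linarith)
  have hle : Φ R ≤ Φ 1 := hanti (by simp) (by simpa using hR) hR
  have hexp : ∀ r : ℝ, Real.exp (-ν * r ^ 2) ≤ 1 := fun r =>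
    Real.exp_le_one_iff.2 (by nlinarith [sq_nonneg r])
  have hb : ∀ r ∈ Set.Icc (0:ℝ) 1, ‖u r‖ ^ 2 * Real.exp (-ν * r ^ 2) ≤ M := fun r hr => by
    have := mul_le_mul (hM r hr) (hexp r) (Real.exp_pos _).le hM0
    simpa using this
  have i1 : ∫ r in (0:ℝ)..1, r * (‖u r‖ ^ 2 * Real.exp (-ν * r ^ 2)) ≤ M := by
    have : ∫ r in (0:ℝ)..1, r * (‖u r‖ ^ 2 * Real.exp (-ν * r ^ 2)) ≤ ∫ r in (0:ℝ)..1, M := by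
      apply intervalIntegral.integral_mono_on zero_le_one (ca.intervalIntegrable _ _)
        (by simp)
      intro r hr
      have := mul_le_mul hr.2 (hb r hr) (by positivity) zero_le_one
      simpa using this
    simpa using this
  have i2 : 0 ≤ ∫ r in (0:ℝ)..1, r * (‖v r‖ ^ 2 * Real.exp (-ν * r ^ 2)) := by
    apply intervalIntegral.integral_nonneg zero_le_one
    intro r hr
    have := hr.1
    positivity
  have i3 : (1 / ν) * (‖u 1‖ ^ 2 * Real.exp (-ν * 1 ^ 2)) ≤ M / ν := by
    have := hb 1 (by simp)
    rw [one_div_mul_eq_div]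
    gcongr
  have i4 : 0 ≤ (1 / ν ^ 2) * ∫ r in (0:ℝ)..1, r * (‖v r‖ ^ 2 * Real.exp (-ν * r ^ 2)) := by
    positivity
  have i5 : 0 ≤ (1 / ν) * (‖u R‖ ^ 2 * Real.exp (-ν * R ^ 2)) := by positivity
  simp only [Φ] at hle
  linarith

open ENNReal in
lemma aux_lint (ν : ℝ) (hν : 0 < ν) (u v : ℝ → ℂ) (hu : ∀ r, HasDerivAt u (v r) r)
    (hv : Continuous v) (M : ℝ) (hM : ∀ r ∈ Set.Icc (0:ℝ) 1, ‖u r‖ ^ 2 ≤ M) :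
    ∫⁻ r in Set.Ioi (0:ℝ), ENNReal.ofReal (r * (‖u r‖ ^ 2 * Real.exp (-ν * r ^ 2))) ≤
      ENNReal.ofReal (M + M / ν) + ENNReal.ofReal (1 / ν ^ 2) *
        ∫⁻ r in Set.Ioi (0:ℝ), ENNReal.ofReal (r * (‖v r‖ ^ 2 * Real.exp (-ν * r ^ 2))) := by
  have hcu : Continuous u := continuous_iff_continuousAt.2 fun r => (hu r).continuousAt
  have hM0 : 0 ≤ M := (sq_nonneg _).trans (hM 0 (by simp))
  have hU : Set.Ioi (0:ℝ) = ⋃ n : ℕ, Set.Ioc (0:ℝ) (n + 1) := by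
    ext x
    simp only [Set.mem_Ioi, Set.mem_iUnion, Set.mem_Ioc, exists_and_left]
    refine ⟨fun h => ⟨h, ?_⟩, fun h => h.1⟩
    obtain ⟨n, hn⟩ := exists_nat_ge x
    exact ⟨n, by linarith⟩
  have hconv : ∀ (w : ℝ → ℂ), Continuous w → ∀ n : ℕ,
      ∫⁻ r in Set.Ioc (0:ℝ) (n + 1), ENNReal.ofReal (r * (‖w r‖ ^ 2 * Real.exp (-ν * r ^ 2))) =
      ENNReal.ofReal (∫ r in (0:ℝ)..(n+1), r * (‖w r‖ ^ 2 * Real.exp (-ν * r ^ 2))) := by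
    intro w hw n
    have cw : Continuous fun r : ℝ => r * (‖w r‖ ^ 2 * Real.exp (-ν * r ^ 2)) := by fun_prop
    have hn : (0:ℝ) ≤ n + 1 := by positivity
    rw [intervalIntegral.integral_of_le hn, ofReal_integral_eq_lintegral_ofReal]
    · exact (intervalIntegrable_iff_integrableOn_Ioc_of_le hn).1 (cw.intervalIntegrable _ _)
    · filter_upwards [ae_restrict_mem measurableSet_Ioc] with r hr
      have := hr.1
      simp only [Pi.zero_apply]
      positivity
  rw [hU, setLIntegral_iUnion_of_directed]
  swap
  · apply Monotone.directed_le
    intro a b hab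
    apply Set.Ioc_subset_Ioc_right
    gcongr
  rw [← hU]
  refine iSup_le fun n => ?_
  rw [hconv u hcu n]
  have hn : (0:ℝ) ≤ n := by positivity
  refine (ENNReal.ofReal_le_ofReal (aux_1d ν hν u v hu hv M hM (n + 1) (by linarith))).trans ?_
  refine ENNReal.ofReal_add_le.trans ?_
  rw [ENNReal.ofReal_mul (p := 1 / ν ^ 2) (by positivity), ← hconv v hv n]
  gcongr
  exact Set.Ioc_subset_Ioi_self

lemma aux_polar (ν : ℝ) (g : ℂ → ℂ) (hg : Continuous g) :
    ∫⁻ z : ℂ, ENNReal.ofReal (‖g z‖ ^ 2 * Real.exp (-ν * ‖z‖ ^ 2)) =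
    ∫⁻ θ in Set.Ioo (-Real.pi) Real.pi, ∫⁻ r in Set.Ioi (0:ℝ),
      ENNReal.ofReal (r * (‖g (r * Complex.exp (θ * Complex.I))‖ ^ 2 * Real.exp (-ν * r ^ 2))) := by
  have hc : Continuous fun p : ℝ × ℝ => ENNReal.ofReal (p.1 *
      (‖g (p.1 * Complex.exp (p.2 * Complex.I))‖ ^ 2 * Real.exp (-ν * p.1 ^ 2))) :=
    ENNReal.continuous_ofReal.comp (by fun_prop)
  rw [← Complex.lintegral_comp_polarCoord_symm]
  have : ∫⁻ p in polarCoord.target, ENNReal.ofReal p.1 • ENNReal.ofReal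
      (‖g (Complex.polarCoord.symm p)‖ ^ 2 * Real.exp (-ν * ‖Complex.polarCoord.symm p‖ ^ 2)) =
      ∫⁻ p in Set.Ioi (0:ℝ) ×ˢ Set.Ioo (-Real.pi) Real.pi, ENNReal.ofReal (p.1 *
      (‖g (p.1 * Complex.exp (p.2 * Complex.I))‖ ^ 2 * Real.exp (-ν * p.1 ^ 2))) := by
    apply setLIntegral_congr_fun (measurableSet_Ioi.prod measurableSet_Ioo)
    intro p hp
    have hp : 0 < p.1 := hp.1
    simp only [smul_eq_mul]
    rw [← ENNReal.ofReal_mul hp.le, Complex.norm_polarCoord_symm, abs_of_pos hp,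
      Complex.polarCoord_symm_apply, Complex.exp_mul_I]
    simp
  rw [this, Measure.volume_eq_prod, ← Measure.prod_restrict, lintegral_prod_symm]
  exact hc.measurable.aemeasurable

theorem stmt2 (ν : ℝ) (hν : 0 < ν) (f : ℂ → ℂ) (hf : Differentiable ℂ f)
    (h : Integrable (fun z : ℂ => ‖deriv f z‖ ^ 2 * Real.exp (-ν * ‖z‖ ^ 2))) :
    Integrable (fun z : ℂ => ‖f z‖ ^ 2 * Real.exp (-ν * ‖z‖ ^ 2)) := by
  have hcf : Continuous f := hf.continuous
  have hcd : Continuous (deriv f) := (hf.contDiff (n := 1)).continuous_deriv le_rfl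
  obtain ⟨K, hK⟩ := (isCompact_closedBall (0:ℂ) 1).exists_bound_of_continuousOn hcf.continuousOn
  have hfin := h.lintegral_lt_top
  refine ⟨by fun_prop, ?_⟩
  rw [hasFiniteIntegral_iff_ofReal (Filter.Eventually.of_forall fun z => by positivity)]
  rw [aux_polar ν _ hcd] at hfin
  rw [aux_polar ν _ hcf]
  have hray : ∀ θ : ℝ, ∫⁻ r in Set.Ioi (0:ℝ),
      ENNReal.ofReal (r * (‖f (r * Complex.exp (θ * Complex.I))‖ ^ 2 * Real.exp (-ν * r ^ 2))) ≤
      ENNReal.ofReal (K ^ 2 + K ^ 2 / ν) + ENNReal.ofReal (1 / ν ^ 2) * ∫⁻ r in Set.Ioi (0:ℝ),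
      ENNReal.ofReal (r * (‖deriv f (r * Complex.exp (θ * Complex.I))‖ ^ 2 *
        Real.exp (-ν * r ^ 2))) := by
    intro θ
    have := aux_lint ν hν (fun r => f (r * Complex.exp (θ * Complex.I)))
      (fun r => deriv f (r * Complex.exp (θ * Complex.I)) * Complex.exp (θ * Complex.I)) ?_
      (by fun_prop) (K ^ 2) ?_
    · simpa only [norm_mul, Complex.norm_exp_ofReal_mul_I, mul_one] using this
    · intro r
      have h1 : HasDerivAt (fun r : ℝ => (r : ℂ) * Complex.exp (θ * Complex.I))
          (Complex.exp (θ * Complex.I)) r := by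
        simpa using (Complex.ofRealCLM.hasDerivAt (x := r)).mul_const (Complex.exp (θ * Complex.I))
      exact (hf _).hasDerivAt.comp r h1
    · intro r hr
      have := hK (r * Complex.exp (θ * Complex.I)) (by
        simp [Complex.norm_exp_ofReal_mul_I, abs_of_nonneg hr.1, hr.2])
      gcongr
  refine (lintegral_mono hray).trans_lt ?_
  rw [lintegral_add_left measurable_const, lintegral_const_mul' _ _ ENNReal.ofReal_ne_top]
  refine ENNReal.add_lt_top.2 ⟨?_, ENNReal.mul_lt_top ENNReal.ofReal_lt_top hfin⟩
  simp [ENNReal.mul_lt_top]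
end

section
/- Let ν > 0 and let φ_ν be the entire function φ_ν(z) = ∑_{j=0}^∞ (ν^{(j+1)/2} / √((j+2)!)) z^j. Then for every integer m ≥ 1, the m-th complex derivative φ_ν^{(m)} does not belong to the Bargmann–Fock space 𝒜^{2,ν}(ℂ), i.e. ∫_ℂ |φ_ν^{(m)}(z)|² e^{−ν|z|²} dλ(z) = ∞. -/
open MeasureTheory

/-- The coefficients of the power series `φ_ν(z) = ∑_j (ν^{(j+1)/2}/√((j+2)!)) z^j`. -/
noncomputable def phiCoeff (ν : ℝ) (j : ℕ) : ℝ :=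
  Real.sqrt ν ^ (j + 1) / Real.sqrt ((j + 2).factorial)

/-- The entire function `φ_ν`. -/
noncomputable def phiNu (ν : ℝ) (z : ℂ) : ℂ :=
  ∑' j : ℕ, (phiCoeff ν j : ℂ) * z ^ j


/-- Bessel's inequality on the circle for an absolutely convergent power series. -/
lemma bessel_circle (b : ℕ → ℂ) (hb : Summable fun k => ‖b k‖) (N : ℕ) (F : ℝ → ℂ)
    (hF : ∀ t : ℝ, HasSum (fun k : ℕ => b k * Complex.exp (Complex.I * k * t)) (F t)) :
    2 * Real.pi * ∑ k ∈ Finset.range N, ‖b k‖ ^ 2 ≤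
      ∫ t in Set.Ioc (-Real.pi) Real.pi, ‖F t‖ ^ 2 := by
  have : Fact (0 < 2 * Real.pi) := ⟨Real.two_pi_pos⟩
  let T := 2 * Real.pi
  let e : ℕ → C(AddCircle T, ℂ) := fun k => b k • fourier (k : ℤ)
  have hs : Summable e := by
    apply Summable.of_norm
    refine hb.congr fun k => ?_
    simp only [e, norm_smul, fourier_norm, mul_one]
  obtain ⟨G, hG⟩ := hs
  have hGF : ∀ t : ℝ, G (t : AddCircle T) = F t := by
    intro t
    have h1 : HasSum (fun k => e k (t : AddCircle T)) (G (t : AddCircle T)) :=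
      hG.map (ContinuousMap.evalCLM ℂ (t : AddCircle T)) (ContinuousMap.evalCLM ℂ (t : AddCircle T)).continuous
    refine h1.unique ((hF t).congr_fun ?_)
    intro k
    simp only [e, ContinuousMap.smul_apply, smul_eq_mul, fourier_coe_apply]
    congr 2
    have : (Real.pi : ℂ) ≠ 0 := by exact_mod_cast Real.pi_ne_zero
    simp only [T]
    push_cast
    field_simp
  let L := ContinuousMap.toLp (E := ℂ) 2 (@AddCircle.haarAddCircle T _) ℂ
  have hL : HasSum (fun k : ℕ => b k • @fourierLp T _ 2 _ (k : ℤ)) (L G) := by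
    have := hG.mapL L
    simpa [e, L] using this
  have hin : ∀ j : ℕ, inner ℂ (@fourierLp T _ 2 _ (j : ℤ)) (L G) = b j := by
    intro j
    have h2 := hL.mapL (innerSL ℂ (@fourierLp T _ 2 _ (j : ℤ)))
    have h3 := (orthonormal_iff_ite.1 (@orthonormal_fourier T _))
    simp only [innerSL_apply_apply, inner_smul_right, h3] at h2
    refine h2.unique ?_
    have := hasSum_ite_eq j (b j)
    refine this.congr_fun ?_
    intro k
    by_cases h : k = j
    · simp [h]
    · have : ¬ j = k := fun h' => h h'.symm
      simp [h, this]
  have hB := ((@orthonormal_fourier T _).comp (fun k : ℕ => (k : ℤ)) Nat.cast_injective).sum_inner_products_le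
    (L G) (s := Finset.range N)
  simp only [Function.comp, hin] at hB
  have hn : ‖L G‖ ^ 2 = ∫ t : AddCircle T, ‖G t‖ ^ 2 ∂AddCircle.haarAddCircle := by
    have := MeasureTheory.ContinuousMap.inner_toLp (𝕜 := ℂ) (@AddCircle.haarAddCircle T _) G G
    have h4 : (‖L G‖ ^ 2 : ℝ) = ((∫ t : AddCircle T, ‖G t‖ ^ 2 ∂AddCircle.haarAddCircle : ℝ) : ℂ) := by
      rw [← integral_complex_ofReal]
      rw [inner_self_eq_norm_sq_to_K] at this
      push_cast
      refine this.trans ?_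
      congr 1
      ext t
      rw [Complex.mul_conj, Complex.normSq_eq_norm_sq]
      push_cast
      rfl
    exact_mod_cast h4
  rw [hn, AddCircle.integral_haarAddCircle, ← AddCircle.integral_preimage T (-Real.pi)] at hB
  simp only [hGF, smul_eq_mul] at hB
  have hT : -Real.pi + T = Real.pi := by simp only [T]; ring
  rw [hT] at hB
  have hTp : 0 < T := Real.two_pi_pos
  rw [inv_mul_eq_div, le_div_iff₀ hTp] at hB
  linarith [hB, mul_comm T (∑ k ∈ Finset.range N, ‖b k‖ ^ 2)]

lemma phiCoeff_pos (ν : ℝ) (hν : 0 < ν) (j : ℕ) : 0 < phiCoeff ν j := by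
  unfold phiCoeff; positivity

lemma phiNu_series (ν : ℝ) (hν : 0 < ν) :
    HasFPowerSeriesOnBall (phiNu ν)
      (FormalMultilinearSeries.ofScalars ℂ (fun j => (phiCoeff ν j : ℂ))) 0 ⊤ := by
  have hr : (FormalMultilinearSeries.ofScalars ℂ (fun j => (phiCoeff ν j : ℂ))).radius = ⊤ := by
    apply FormalMultilinearSeries.ofScalars_radius_eq_top_of_tendsto
    · exact Filter.Eventually.of_forall fun n => by
        exact_mod_cast (phiCoeff_pos ν hν n).ne'
    · have h : ∀ n : ℕ, Real.sqrt ν / Real.sqrt ((n : ℝ) + 3) =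
          ‖(phiCoeff ν n.succ : ℂ)‖ / ‖(phiCoeff ν n : ℂ)‖ := by
        intro n
        rw [Complex.norm_real, Complex.norm_real, Real.norm_of_nonneg (phiCoeff_pos ν hν _).le,
          Real.norm_of_nonneg (phiCoeff_pos ν hν _).le]
        unfold phiCoeff
        have h1 : ((n.succ + 2).factorial : ℝ) = ((n : ℝ) + 3) * ((n + 2).factorial : ℝ) := by
          rw [show n.succ + 2 = (n + 2) + 1 from rfl, Nat.factorial_succ]
          push_cast; ring
        rw [h1, Real.sqrt_mul (by positivity)]
        have : 0 < Real.sqrt ν := Real.sqrt_pos.2 hν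
        have : 0 < Real.sqrt ((n : ℝ) + 3) := by positivity
        have : 0 < Real.sqrt ((n + 2).factorial : ℝ) := by positivity
        simp only [Nat.succ_eq_add_one]
        field_simp
        ring
      refine Filter.Tendsto.congr h ?_
      apply Filter.Tendsto.div_atTop tendsto_const_nhds
      exact Real.tendsto_sqrt_atTop.comp
        (Filter.tendsto_atTop_add_const_right _ _ tendsto_natCast_atTop_atTop)
  have := (FormalMultilinearSeries.ofScalars ℂ (fun j => (phiCoeff ν j : ℂ))).hasFPowerSeriesOnBall
    (by rw [hr]; exact ENNReal.zero_lt_top)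
  rw [hr] at this
  convert! this using 1
  ext z
  have := FormalMultilinearSeries.ofScalars_sum_eq (fun j => (phiCoeff ν j : ℂ)) z
  unfold FormalMultilinearSeries.ofScalarsSum at this
  rw [this]
  simp [phiNu]

/-- Taylor coefficients of the `m`-th derivative. -/
noncomputable def dCoeff (ν : ℝ) (m k : ℕ) : ℝ :=
  ((k + m).factorial : ℝ) / (k.factorial : ℝ) * phiCoeff ν (k + m)

lemma phiNu_diff (ν : ℝ) (hν : 0 < ν) : Differentiable ℂ (phiNu ν) := by
  have := (phiNu_series ν hν).differentiableOn
  intro z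
  exact (this z (by simp)).differentiableAt (by simp)

lemma deriv_diff (ν : ℝ) (hν : 0 < ν) (m : ℕ) : Differentiable ℂ (iteratedDeriv m (phiNu ν)) :=
  (phiNu_diff ν hν).contDiff.differentiable_iteratedDeriv m (WithTop.coe_lt_top _)

lemma deriv_hasSum (ν : ℝ) (hν : 0 < ν) (m : ℕ) (z : ℂ) :
    HasSum (fun k => (dCoeff ν m k : ℂ) * z ^ k) (iteratedDeriv m (phiNu ν) z) := by
  have h := Complex.hasSum_taylorSeries_of_entire (deriv_diff ν hν m) 0 z
  refine h.congr_fun fun k => ?_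
  have h1 : iteratedDeriv k (iteratedDeriv m (phiNu ν)) 0 = iteratedDeriv (k + m) (phiNu ν) 0 := by
    simp only [iteratedDeriv_eq_iterate, Function.iterate_add_apply]
  have h2 := (phiNu_series ν hν).factorial_smul 1 (k + m)
  rw [h1, iteratedDeriv, ← h2, FormalMultilinearSeries.ofScalars_apply_eq]
  have : (k.factorial : ℂ) ≠ 0 := by exact_mod_cast k.factorial_ne_zero
  simp only [dCoeff, sub_zero, smul_eq_mul, nsmul_eq_mul]
  push_cast
  field_simp
  simp

lemma dCoeff_pos (ν : ℝ) (hν : 0 < ν) (m k : ℕ) : 0 < dCoeff ν m k := by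
  have := phiCoeff_pos ν hν (k + m)
  unfold dCoeff; positivity

/-- lower bound for each term -/
lemma term_lower (ν : ℝ) (hν : 0 < ν) (m : ℕ) (hm : 1 ≤ m) (k : ℕ) :
    ν ^ m / (2 * ((m : ℝ) + 2)) * (1 / ((k : ℝ) + 1)) ≤ dCoeff ν m k ^ 2 * (k.factorial / ν ^ (k + 1)) := by
  have h1 : dCoeff ν m k ^ 2 * (k.factorial / ν ^ (k + 1)) =
      ν ^ m * (((k + m).factorial : ℝ) / (k.factorial * ((k + m + 1) * (k + m + 2)))) := by
    unfold dCoeff phiCoeff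
    rw [mul_pow, div_pow, div_pow, Real.sq_sqrt (by positivity), ← pow_mul, mul_comm (k + m + 1) 2,
      pow_mul, Real.sq_sqrt hν.le, Nat.factorial_succ (k + m + 1), Nat.factorial_succ (k + m)]
    push_cast
    field_simp
    ring
  have h2 : ((k : ℝ) + m) * k.factorial ≤ ((k + m).factorial : ℝ) := by
    obtain ⟨n, rfl⟩ : ∃ n, m = n + 1 := ⟨m - 1, by omega⟩
    have := Nat.factorial_le (show k ≤ k + n by omega)
    rw [← add_assoc, Nat.factorial_succ]
    push_cast
    rw [← add_assoc]
    have : (k.factorial : ℝ) ≤ (k + n).factorial := by exact_mod_cast this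
    gcongr
  rw [h1, div_mul_eq_mul_div, mul_div_assoc]
  refine mul_le_mul_of_nonneg_left ?_ (by positivity)
  have hm' : (1 : ℝ) ≤ m := by exact_mod_cast hm
  have hk : (0 : ℝ) ≤ k := by positivity
  have hf : (0 : ℝ) < k.factorial := by positivity
  rw [div_div, div_le_div_iff₀ (by positivity) (by positivity)]
  have h3 : ((k : ℝ) + m + 1) * (k + m + 2) ≤ (2 * (k + m)) * ((k + 1) * (m + 2)) := by
    apply mul_le_mul
    · linarith
    · nlinarith
    · positivity
    · positivity
  nlinarith [mul_le_mul_of_nonneg_left h3 hf.le, mul_le_mul_of_nonneg_right h2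
    (show (0 : ℝ) ≤ 2 * ((k + 1) * (m + 2)) by positivity)]

lemma radial_integrable (ν : ℝ) (hν : 0 < ν) (k : ℕ) :
    IntegrableOn (fun r : ℝ => r ^ (2 * k + 1) * Real.exp (-ν * r ^ 2)) (Set.Ioi 0) := by
  have := integrableOn_rpow_mul_exp_neg_mul_sq hν (s := ((2 * k + 1 : ℕ) : ℝ))
    (by linarith [(Nat.cast_nonneg (2 * k + 1) : (0 : ℝ) ≤ ((2 * k + 1 : ℕ) : ℝ))])
  simpa only [Real.rpow_natCast] using this

lemma radial_integral (ν : ℝ) (hν : 0 < ν) (k : ℕ) :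
    ∫ r in Set.Ioi (0 : ℝ), r ^ (2 * k + 1) * Real.exp (-ν * r ^ 2) =
      k.factorial / ν ^ (k + 1) / 2 := by
  have := integral_rpow_mul_exp_neg_mul_rpow (p := 2) (q := ((2 * k + 1 : ℕ) : ℝ)) (b := ν)
    (by norm_num) (by linarith [(Nat.cast_nonneg (2 * k + 1) : (0 : ℝ) ≤ ((2 * k + 1 : ℕ) : ℝ))]) hν
  simp only [Real.rpow_natCast, Real.rpow_two] at this
  rw [this]
  have e1 : (((2 * k + 1 : ℕ) : ℝ) + 1) / 2 = (k : ℝ) + 1 := by push_cast; ring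
  have e2 : -(((2 * k + 1 : ℕ) : ℝ) + 1) / 2 = -((k + 1 : ℕ) : ℝ) := by push_cast; ring
  rw [e1, e2, Real.Gamma_nat_eq_factorial, Real.rpow_neg hν.le, Real.rpow_natCast]
  field_simp

lemma angular_lower (ν : ℝ) (hν : 0 < ν) (m N : ℕ) (r : ℝ) (hr : 0 < r) :
    ENNReal.ofReal (∑ k ∈ Finset.range N, 2 * Real.pi * dCoeff ν m k ^ 2 *
      (r ^ (2 * k + 1) * Real.exp (-ν * r ^ 2))) ≤
    ∫⁻ t in Set.Ioo (-Real.pi) Real.pi, ENNReal.ofReal r *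
      ENNReal.ofReal (‖iteratedDeriv m (phiNu ν) (Complex.polarCoord.symm (r, t))‖ ^ 2 *
        Real.exp (-ν * ‖Complex.polarCoord.symm (r, t)‖ ^ 2)) := by
  let g := iteratedDeriv m (phiNu ν)
  let F : ℝ → ℂ := fun t => g (r * Complex.exp (Complex.I * t))
  have hgc : Continuous g := (deriv_diff ν hν m).continuous
  have hFc : Continuous F := by
    simp only [F]; fun_prop
  have hpol : ∀ t : ℝ, Complex.polarCoord.symm (r, t) = r * Complex.exp (Complex.I * t) := by
    intro t
    rw [Complex.polarCoord_symm_apply, mul_comm Complex.I, Complex.exp_mul_I]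
    push_cast
    rfl
  have hB := bessel_circle (fun k => (dCoeff ν m k : ℂ) * (r : ℂ) ^ k)
    ((deriv_hasSum ν hν m r).summable.norm) N F (by
      intro t
      refine (deriv_hasSum ν hν m (r * Complex.exp (Complex.I * t))).congr_fun fun k => ?_
      rw [mul_pow, ← Complex.exp_nat_mul, mul_assoc]
      congr 3
      ring)
  have hnorm : ∀ t : ℝ, ‖Complex.polarCoord.symm (r, t)‖ = r := by
    intro t
    rw [hpol, norm_mul, mul_comm Complex.I, Complex.norm_exp_ofReal_mul_I, Complex.norm_real,
      Real.norm_of_nonneg hr.le, mul_one]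
  have hrew : ∀ t : ℝ, ENNReal.ofReal r *
      ENNReal.ofReal (‖iteratedDeriv m (phiNu ν) (Complex.polarCoord.symm (r, t))‖ ^ 2 *
        Real.exp (-ν * ‖Complex.polarCoord.symm (r, t)‖ ^ 2)) =
      ENNReal.ofReal (‖F t‖ ^ 2 * (r * Real.exp (-ν * r ^ 2))) := by
    intro t
    rw [hnorm, hpol, ← ENNReal.ofReal_mul hr.le]
    congr 1
    simp only [F, g]
    ring
  simp only [hrew]
  rw [setLIntegral_congr Ioo_ae_eq_Ioc, ← ofReal_integral_eq_lintegral_ofReal]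
  · apply ENNReal.ofReal_le_ofReal
    rw [integral_mul_const]
    refine le_trans (le_of_eq ?_) (mul_le_mul_of_nonneg_right hB (by positivity))
    rw [Finset.mul_sum, Finset.sum_mul]
    refine Finset.sum_congr rfl fun k _ => ?_
    rw [norm_mul, norm_pow, Complex.norm_real, Complex.norm_real, Real.norm_of_nonneg hr.le,
      Real.norm_of_nonneg (dCoeff_pos ν hν m k).le]
    ring
  · have : Continuous fun t => ‖F t‖ ^ 2 * (r * Real.exp (-ν * r ^ 2)) := by fun_prop
    exact (this.integrableOn_Icc).mono_set Set.Ioc_subset_Icc_self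
  · exact Filter.Eventually.of_forall fun t => by positivity

lemma total_lower (ν : ℝ) (hν : 0 < ν) (m N : ℕ) :
    ENNReal.ofReal (∑ k ∈ Finset.range N, Real.pi * (dCoeff ν m k ^ 2 *
      (k.factorial / ν ^ (k + 1)))) ≤
    ∫⁻ z : ℂ, ENNReal.ofReal (‖iteratedDeriv m (phiNu ν) z‖ ^ 2 * Real.exp (-ν * ‖z‖ ^ 2)) := by
  have hgc : Continuous (iteratedDeriv m (phiNu ν)) := (deriv_diff ν hν m).continuous
  rw [← Complex.lintegral_comp_polarCoord_symm, polarCoord_target, Measure.volume_eq_prod,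
    setLIntegral_prod]
  swap
  · have : Measurable (fun p : ℝ × ℝ => Complex.polarCoord.symm p) := by
      simp only [Complex.polarCoord_symm_apply]
      fun_prop
    apply Measurable.aemeasurable
    simp only [smul_eq_mul]
    have := hgc.measurable
    fun_prop
  have hint : ∀ k ∈ Finset.range N, IntegrableOn (fun r : ℝ => 2 * Real.pi * dCoeff ν m k ^ 2 *
      (r ^ (2 * k + 1) * Real.exp (-ν * r ^ 2))) (Set.Ioi 0) :=
    fun k _ => (radial_integrable ν hν k).const_mul _
  calc _ = ENNReal.ofReal (∫ r in Set.Ioi (0 : ℝ), ∑ k ∈ Finset.range N,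
            2 * Real.pi * dCoeff ν m k ^ 2 * (r ^ (2 * k + 1) * Real.exp (-ν * r ^ 2))) := by
        rw [integral_finsetSum _ hint]
        congr 1
        refine Finset.sum_congr rfl fun k _ => ?_
        rw [integral_const_mul, radial_integral ν hν]
        ring
    _ = ∫⁻ r in Set.Ioi (0 : ℝ), ENNReal.ofReal (∑ k ∈ Finset.range N,
            2 * Real.pi * dCoeff ν m k ^ 2 * (r ^ (2 * k + 1) * Real.exp (-ν * r ^ 2))) := by
        rw [ofReal_integral_eq_lintegral_ofReal (integrable_finsetSum _ hint)]
        refine (ae_restrict_iff' measurableSet_Ioi).2 (Filter.Eventually.of_forall fun r hr => ?_)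
        have hr' : 0 < r := hr
        simp only [Pi.zero_apply]
        positivity
    _ ≤ _ := by
        refine setLIntegral_mono' measurableSet_Ioi fun r hr => ?_
        exact angular_lower ν hν m N r hr

theorem stmt5 (ν : ℝ) (hν : 0 < ν) (m : ℕ) (hm : 1 ≤ m) :
    ∫⁻ z : ℂ, ENNReal.ofReal (‖iteratedDeriv m (phiNu ν) z‖ ^ 2 * Real.exp (-ν * ‖z‖ ^ 2)) = ⊤ := by
  have h1 : Filter.Tendsto (fun N : ℕ => ENNReal.ofReal (Real.pi * (ν ^ m / (2 * ((m : ℝ) + 2))) *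
      ∑ k ∈ Finset.range N, 1 / ((k : ℝ) + 1))) Filter.atTop (nhds ⊤) :=
    ENNReal.tendsto_ofReal_atTop.comp
      (Real.tendsto_sum_range_one_div_nat_succ_atTop.const_mul_atTop (by positivity))
  refine top_unique (le_of_tendsto' h1 fun N => le_trans ?_ (total_lower ν hν m N))
  apply ENNReal.ofReal_le_ofReal
  rw [Finset.mul_sum]
  refine Finset.sum_le_sum fun k _ => ?_
  rw [mul_assoc]
  exact mul_le_mul_of_nonneg_left (term_lower ν hν m hm k) Real.pi_pos.le
end

section
/- Let ν > 0 and ℓ ∈ ℕ. Let F : ℂ → ℂ be a smooth function (as a function of two real variables) with ∫_ℂ |F(w)|² e^{−ν|w|²} dλ(w) < ∞ which satisfies the eigenvalue equation Δ_ν F = ν ℓ F on ℂ. Then F satisfies the reproducing formula: for every z ∈ ℂ, F(z) = (ν/π) ∫_ℂ e^{ν z · conj(w)} L_ℓ(ν |z − w|²) F(w) e^{−ν|w|²} dλ(w). -/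
open MeasureTheory

/-- The Laguerre polynomial `L_n(x) = ∑_{k=0}^n binom(n,k) (−x)^k / k!`. -/
noncomputable def laguerre (n : ℕ) (x : ℝ) : ℝ :=
  ∑ k ∈ Finset.range (n + 1), (n.choose k : ℝ) * (-x) ^ k / (k.factorial : ℝ)


open Polynomial in
noncomputable def lagP (n : ℕ) : ℝ[X] :=
  ∑ k ∈ Finset.range (n + 1), Polynomial.monomial k ((n.choose k : ℝ) * (-1) ^ k / (k.factorial : ℝ))

lemma lagP_eval (n : ℕ) (x : ℝ) : (lagP n).eval x = laguerre n x := by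
  simp only [lagP, laguerre, Polynomial.eval_finsetSum, Polynomial.eval_monomial]
  refine Finset.sum_congr rfl fun k _ => ?_
  rw [neg_pow x k]; ring

lemma lagP_coeff (n k : ℕ) : (lagP n).coeff k = (n.choose k : ℝ) * (-1) ^ k / (k.factorial : ℝ) := by
  simp only [lagP, Polynomial.finsetSum_coeff, Polynomial.coeff_monomial]
  rw [Finset.sum_ite_eq' (Finset.range (n+1)) k]
  split_ifs with h
  · rfl
  · have : n < k := by simpa using h
    simp [Nat.choose_eq_zero_of_lt this]

lemma lagP_ode (n : ℕ) : (Polynomial.X : Polynomial ℝ) * (lagP n).derivative.derivative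
    + (1 - Polynomial.X) * (lagP n).derivative + Polynomial.C (n : ℝ) * lagP n = 0 := by
  have hrec : ∀ k : ℕ, (k + 1 : ℝ) ^ 2 * (lagP n).coeff (k + 1) = (k - n) * (lagP n).coeff k := by
    intro k
    rw [lagP_coeff, lagP_coeff, Nat.factorial_succ]
    have h1 : (n.choose (k+1) : ℝ) * (k + 1) = n.choose k * (n - k) := by
      rcases le_or_gt k n with h | h
      · have := Nat.choose_succ_right_eq n k
        have h2 : ((n.choose (k+1) * (k+1) : ℕ) : ℝ) = ((n.choose k * (n - k) : ℕ) : ℝ) := by rw [this]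
        push_cast [Nat.cast_sub h] at h2
        exact h2
      · simp [Nat.choose_eq_zero_of_lt h, Nat.choose_eq_zero_of_lt (Nat.lt_succ_of_lt h)]
    have hf : (k.factorial : ℝ) ≠ 0 := by positivity
    push_cast
    field_simp
    rw [pow_succ]
    linear_combination (-(-1)^k) * h1
  ext k
  rcases k with _ | k
  · have := hrec 0
    simp [sub_mul, Polynomial.coeff_derivative] at this ⊢
    linarith
  · have := hrec (k+1)
    simp only [sub_mul, one_mul, Polynomial.coeff_add, Polynomial.coeff_sub, Polynomial.coeff_X_mul, Polynomial.coeff_C_mul,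
      Polynomial.coeff_derivative, Polynomial.coeff_zero]
    push_cast at this ⊢
    linarith

lemma comb (m n : ℕ) (hm : m ≤ n) :
    ∑ k ∈ Finset.range (n + 1), (lagP n).coeff k * ((k + m).factorial : ℝ)
      = if m = n then (-1) ^ n * (n.factorial : ℝ) else 0 := by
  have h1 := fwdDiff_iter_eq_sum_shift (1 : ℕ) (fun x : ℕ ↦ (x.choose m : ℤ)) n m
  have h2 : (fwdDiff (1:ℕ))^[n] (fun x : ℕ ↦ (x.choose m : ℤ)) m = if m = n then 1 else 0 := by
    split_ifs with h
    · subst h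
      have := congrFun (fwdDiff_iter_choose 0 m) m
      simpa using this
    · obtain ⟨k, rfl⟩ := Nat.exists_eq_add_of_lt (lt_of_le_of_ne hm h)
      have : m + k + 1 = (k + 1) + m := by ring
      rw [this, Function.iterate_add_apply]
      have h3 : (fwdDiff (1:ℕ))^[m] (fun x : ℕ ↦ (x.choose m : ℤ)) = fun _ => 1 := by
        simpa using fwdDiff_iter_choose 0 m
      rw [h3, Function.iterate_succ_apply, fwdDiff_const, fwdDiff_iter_eq_sum_shift]
      simp
  rw [h2] at h1
  have h4 : (if m = n then (1:ℝ) else 0) = ∑ k ∈ Finset.range (n + 1), (-1 : ℝ) ^ (n - k) * n.choose k * ((m + k).choose m : ℝ) := by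
    have := congrArg (Int.cast : ℤ → ℝ) h1
    push_cast at this
    simpa using this
  have h5 : ∑ k ∈ Finset.range (n + 1), (lagP n).coeff k * ((k + m).factorial : ℝ)
     = (-1)^n * m.factorial * ∑ k ∈ Finset.range (n + 1), (-1 : ℝ) ^ (n - k) * n.choose k * ((m + k).choose m : ℝ) := by
    rw [Finset.mul_sum]
    refine Finset.sum_congr rfl fun k hk => ?_
    have hk : k ≤ n := by simpa [Nat.lt_succ_iff] using hk
    have e : (-1:ℝ)^n * (-1)^(n-k) = (-1)^k := by
      obtain ⟨j, rfl⟩ := Nat.exists_eq_add_of_le hk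
      rw [Nat.add_sub_cancel_left, pow_add, mul_assoc, ← mul_pow]; simp
    have f : ((m + k).choose m : ℝ) * m.factorial * k.factorial = (k + m).factorial := by
      have := Nat.add_choose_mul_factorial_mul_factorial m k
      rw [← Nat.choose_symm_add] at this
      rw [add_comm k m]
      exact_mod_cast this
    have hf : (k.factorial : ℝ) ≠ 0 := by positivity
    rw [lagP_coeff, ← f, ← e]
    field_simp
  rw [h5, ← h4]
  split_ifs with h
  · simp [h]
  · simp

lemma lag_norm_comb (n : ℕ) :
    ∑ m ∈ Finset.range (n + 1), ∑ k ∈ Finset.range (n + 1), (lagP n).coeff m * ((lagP n).coeff k * ((k + m).factorial : ℝ)) = 1 := by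
  simp_rw [← Finset.mul_sum]
  rw [Finset.sum_congr rfl (fun m hm => by rw [comb m n (by simpa [Nat.lt_succ_iff] using hm)])]
  simp [lagP_coeff]
  have hf : (n.factorial : ℝ) ≠ 0 := by positivity
  field_simp
  rw [← pow_mul, mul_comm, pow_mul]; simp

lemma int_mono {ν : ℝ} (hν : 0 < ν) (j : ℕ) :
    IntegrableOn (fun r : ℝ => r * (ν * r ^ 2) ^ j * Real.exp (-ν * r ^ 2)) (Set.Ioi 0) ∧
    ∫ r in Set.Ioi (0:ℝ), r * (ν * r ^ 2) ^ j * Real.exp (-ν * r ^ 2) = j.factorial / (2 * ν) := by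
  have e : ∀ r ∈ Set.Ioi (0:ℝ), r * (ν * r ^ 2) ^ j * Real.exp (-ν * r ^ 2) =
      ν ^ j * (r ^ (2 * j + 1 : ℝ) * Real.exp (-ν * r ^ (2:ℝ))) := by
    intro r hr
    have : r ^ (2 * j + 1 : ℝ) = r ^ (2 * j + 1) := by
      rw [← Real.rpow_natCast]; push_cast; rfl
    rw [this, Real.rpow_two, mul_pow, ← pow_mul, pow_succ]; ring
  have hq : (-1 : ℝ) < 2 * j + 1 := by have : (0:ℝ) ≤ j := by positivity
                                       linarith
  constructor
  · rw [integrableOn_congr_fun e measurableSet_Ioi]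
    exact (integrableOn_rpow_mul_exp_neg_mul_rpow hq (by norm_num) hν).const_mul _
  · rw [setIntegral_congr_fun measurableSet_Ioi e, integral_const_mul,
      integral_rpow_mul_exp_neg_mul_rpow (by norm_num) hq hν]
    have h1 : ((2 * j + 1 : ℝ) + 1) / 2 = j + 1 := by ring
    have h2 : -((2 * j + 1 : ℝ) + 1) / 2 = -((j + 1 : ℕ) : ℝ) := by push_cast; ring
    rw [h1, h2, Real.Gamma_nat_eq_factorial, Real.rpow_neg hν.le, Real.rpow_natCast, pow_succ]
    field_simp

lemma lag_sq (n : ℕ) (x : ℝ) : laguerre n x ^ 2 = ∑ m ∈ Finset.range (n + 1), ∑ k ∈ Finset.range (n + 1),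
    (lagP n).coeff m * (lagP n).coeff k * x ^ (k + m) := by
  have : laguerre n x = ∑ m ∈ Finset.range (n + 1), (lagP n).coeff m * x ^ m := by
    unfold laguerre
    refine Finset.sum_congr rfl fun k _ => ?_
    rw [lagP_coeff, neg_pow x k]; ring
  rw [this, sq, Finset.sum_mul_sum]
  refine Finset.sum_congr rfl fun k _ => Finset.sum_congr rfl fun m _ => ?_
  ring

lemma lag_int {ν : ℝ} (hν : 0 < ν) (n : ℕ) :
    IntegrableOn (fun r : ℝ => r * (laguerre n (ν * r ^ 2) ^ 2 * Real.exp (-ν * r ^ 2))) (Set.Ioi 0) ∧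
    ∫ r in Set.Ioi (0:ℝ), r * (laguerre n (ν * r ^ 2) ^ 2 * Real.exp (-ν * r ^ 2)) = 1 / (2 * ν) := by
  have e : (fun r : ℝ => r * (laguerre n (ν * r ^ 2) ^ 2 * Real.exp (-ν * r ^ 2))) =
     fun r => ∑ m ∈ Finset.range (n + 1), ∑ k ∈ Finset.range (n + 1),
      (lagP n).coeff m * (lagP n).coeff k * (r * (ν * r ^ 2) ^ (k + m) * Real.exp (-ν * r ^ 2)) := by
    funext r
    rw [lag_sq, Finset.sum_mul, Finset.mul_sum]
    refine Finset.sum_congr rfl fun m _ => ?_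
    rw [Finset.sum_mul, Finset.mul_sum]
    refine Finset.sum_congr rfl fun k _ => ?_
    ring
  have hi : ∀ m k, IntegrableOn (fun r : ℝ => (lagP n).coeff m * (lagP n).coeff k * (r * (ν * r ^ 2) ^ (k + m) * Real.exp (-ν * r ^ 2))) (Set.Ioi 0) :=
    fun m k => (int_mono hν (k+m)).1.const_mul _
  rw [e]
  constructor
  · exact integrable_finsetSum _ fun m _ => integrable_finsetSum _ fun k _ => hi m k
  · rw [integral_finsetSum _ fun m _ => integrable_finsetSum _ fun k _ => hi m k]
    simp_rw [integral_finsetSum _ fun k _ => hi _ k, integral_const_mul, (int_mono hν _).2]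
    rw [← lag_norm_comb n, Finset.sum_div]
    refine Finset.sum_congr rfl fun m _ => ?_
    rw [Finset.sum_div]
    refine Finset.sum_congr rfl fun k _ => ?_
    ring

lemma lag_cont (n : ℕ) : Continuous (laguerre n) := by
  have : laguerre n = fun x => (lagP n).eval x := by funext x; rw [lagP_eval]
  rw [this]; exact (lagP n).continuous


lemma hasDerivAt_param {Φ Φ' : ℝ → ℝ → ℂ} (hΦ : Continuous (Function.uncurry Φ))
    (hΦ' : Continuous (Function.uncurry Φ'))
    (hd : ∀ r θ, HasDerivAt (fun r => Φ r θ) (Φ' r θ) r) (a b r : ℝ) :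
    HasDerivAt (fun r => ∫ θ in a..b, Φ r θ) (∫ θ in a..b, Φ' r θ) r := by
  have hc : ∀ s, Continuous (Φ s) := fun s => hΦ.comp (Continuous.prodMk_right s)
  have hc' : ∀ s, Continuous (Φ' s) := fun s => hΦ'.comp (Continuous.prodMk_right s)
  have hK : IsCompact (Metric.closedBall r 1 ×ˢ Set.uIcc a b) :=
    (isCompact_closedBall r 1).prod isCompact_uIcc
  obtain ⟨C, hC⟩ := hK.exists_bound_of_continuousOn hΦ'.continuousOn
  refine (intervalIntegral.hasDerivAt_integral_of_dominated_loc_of_deriv_le (bound := fun _ => C)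
    (s := Metric.closedBall r 1) (Metric.closedBall_mem_nhds r one_pos) ?_ ?_ ?_ ?_ ?_ ?_).2
  · exact Filter.Eventually.of_forall fun s => (hc s).aestronglyMeasurable
  · exact (hc r).intervalIntegrable _ _
  · exact (hc' r).aestronglyMeasurable
  · refine Filter.Eventually.of_forall fun t ht x hx => ?_
    exact hC (x, t) ⟨hx, Set.uIoc_subset_uIcc ht⟩
  · exact intervalIntegrable_const
  · exact Filter.Eventually.of_forall fun t _ x _ => hd x t

lemma ode_unique {ν : ℝ} (hν : 0 < ν) (l : ℕ) (h hd1 hdd : ℝ → ℂ)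
    (hh : ∀ r, HasDerivAt h (hd1 r) r) (hhd : ∀ r, HasDerivAt hd1 (hdd r) r)
    (h0 : h 0 = 0) (hd0 : hd1 0 = 0)
    (ode : ∀ r : ℝ, 0 < r → hdd r = (2 * ν * r - r⁻¹ : ℝ) • hd1 r - (4 * ν * l : ℝ) • h r) :
    ∀ r : ℝ, 0 ≤ r → h r = 0 := by
  intro R hR
  set C : ℝ := 4 * ν * R + 4 * ν * l + 1 with hC
  set φ : ℝ → ℝ := fun t => Real.exp (-(C * t)) * (‖h t‖ ^ 2 + ‖hd1 t‖ ^ 2) with hφ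
  have hd : ∀ t, HasDerivAt φ (Real.exp (-(C * t)) * (-C) * (‖h t‖ ^ 2 + ‖hd1 t‖ ^ 2)
      + Real.exp (-(C * t)) * (2 * inner ℝ (h t) (hd1 t) + 2 * inner ℝ (hd1 t) (hdd t))) t := by
    intro t
    have h1 : HasDerivAt (fun t : ℝ => -(C * t)) (-C) t := by
      simpa using ((hasDerivAt_id' t).const_mul C).fun_neg
    exact h1.exp.mul ((hh t).norm_sq.add (hhd t).norm_sq)
  have hanti : AntitoneOn φ (Set.Icc 0 R) := by
    refine antitoneOn_of_deriv_nonpos (convex_Icc 0 R)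
      (fun t _ => (hd t).continuousAt.continuousWithinAt)
      (fun t _ => (hd t).differentiableAt.differentiableWithinAt) ?_
    intro t ht
    rw [interior_Icc] at ht
    obtain ⟨ht0, htR⟩ := ht
    rw [(hd t).deriv, ode t ht0, inner_sub_right, inner_smul_right, inner_smul_right,
      real_inner_self_eq_norm_sq, mul_assoc, ← mul_add]
    refine mul_nonpos_of_nonneg_of_nonpos (Real.exp_pos _).le ?_
    have i1 : |inner ℝ (h t) (hd1 t)| ≤ ‖h t‖ * ‖hd1 t‖ := abs_real_inner_le_norm _ _
    rw [real_inner_comm (h t) (hd1 t)]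
    set i := inner ℝ (h t) (hd1 t)
    set A := ‖h t‖
    set B := ‖hd1 t‖
    have i2 := abs_le.1 i1
    have j : 2 * (A * B) ≤ A ^ 2 + B ^ 2 := by nlinarith [sq_nonneg (A - B)]
    have k1 : 0 ≤ t⁻¹ * B ^ 2 := by positivity
    have k2 : ν * t * B ^ 2 ≤ ν * R * B ^ 2 := by gcongr
    have k3 : 0 ≤ ν * R * A ^ 2 := by positivity
    have k4 : (ν * l) * (-(2 * i)) ≤ (ν * l) * (A ^ 2 + B ^ 2) := by
      apply mul_le_mul_of_nonneg_left _ (by positivity)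
      linarith
    have k5 : 0 ≤ ν * l * (A ^ 2 + B ^ 2) := by positivity
    have k6 : 2 * i ≤ A ^ 2 + B ^ 2 := by linarith
    rw [hC]
    nlinarith
  have := hanti (Set.left_mem_Icc.2 hR) (Set.right_mem_Icc.2 hR) hR
  have z : φ 0 = 0 := by simp [hφ, h0, hd0]
  rw [z] at this
  have pos := Real.exp_pos (-(C * R))
  have s : ‖h R‖ ^ 2 + ‖hd1 R‖ ^ 2 ≤ 0 := by
    by_contra hcon
    push Not at hcon
    have := mul_pos pos hcon
    simp only [hφ] at *
    linarith
  have : ‖h R‖ ^ 2 = 0 := le_antisymm (by linarith [sq_nonneg ‖hd1 R‖]) (sq_nonneg _)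
  simpa using this

lemma rlin (T : ℂ →L[ℝ] ℂ) (w : ℂ) : T w = w.re * T 1 + w.im * T Complex.I := by
  have : w = w.re • (1 : ℂ) + w.im • Complex.I := by
    apply Complex.ext <;> simp
  conv_lhs => rw [this]
  rw [map_add, map_smul, map_smul]; simp

lemma rlin2 (T : ℂ →L[ℝ] ℂ →L[ℝ] ℂ) (w v : ℂ) : T w v = w.re * T 1 v + w.im * T Complex.I v := by
  have : w = w.re • (1 : ℂ) + w.im • Complex.I := by
    apply Complex.ext <;> simp
  conv_lhs => rw [this]
  rw [map_add, map_smul, map_smul]; simp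

lemma polar_pt {ν : ℝ} {l : ℕ} {G : ℂ → ℂ} (hG : ContDiff ℝ (⊤ : ℕ∞) G)
    (heig : ∀ z : ℂ, magLap ν G z = (ν : ℂ) * (l : ℂ) * G z) (r : ℝ) (e : ℂ) (he : e.re ^ 2 + e.im ^ 2 = 1) :
    (r : ℂ) ^ 2 * fderiv ℝ (fderiv ℝ G) (r * e) e e + (r - 2 * ν * r ^ 3) * fderiv ℝ G (r * e) e
      + 4 * ν * l * r ^ 2 * G (r * e) =
    2 * ν * r ^ 2 * Complex.I * fderiv ℝ G (r * e) (r * (Complex.I * e)) -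
      (fderiv ℝ (fderiv ℝ G) (r * e) (r * (Complex.I * e)) (r * (Complex.I * e))
        + fderiv ℝ G (r * e) (-(r * e))) := by
  have h := heig (r * e)
  have hG2 : ContDiff ℝ 2 G := contDiff_infty.1 hG 2
  have hd : Differentiable ℝ (fderiv ℝ G) :=
    (hG2.fderiv_right (m := 1) (by norm_num)).differentiable (by simp)
  have h2 : ∀ v u z, fderiv ℝ (fun w => fderiv ℝ G w v) z u = fderiv ℝ (fderiv ℝ G) z u v := by
    intro v u z
    rw [fderiv_clm_apply (hd z) (differentiableAt_const v)]
    simp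
  unfold magLap at h
  rw [h2, h2] at h
  set T := fderiv ℝ (fderiv ℝ G) (r * e)
  set D := fderiv ℝ G (r * e)
  have sym : T 1 Complex.I = T Complex.I 1 := by
    have := (hG2.contDiffAt (x := (r * e : ℂ))).isSymmSndFDerivAt (by simp)
    exact this 1 Complex.I
  have he' : (e.re : ℂ) ^ 2 + (e.im : ℂ) ^ 2 = 1 := by exact_mod_cast he
  have hconj : (starRingEnd ℂ) (r * e) = r * (e.re - e.im * Complex.I) := by
    rw [map_mul, Complex.conj_ofReal]
    congr 1
    apply Complex.ext <;> simp
  rw [hconj] at h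
  rw [rlin2 T e e, rlin (T 1) e, rlin (T Complex.I) e, rlin D e, rlin2 T (r * (Complex.I * e)),
    rlin (T 1) (r * (Complex.I * e)), rlin (T Complex.I) (r * (Complex.I * e)),
    rlin D (r * (Complex.I * e)), rlin D (-(r * e))]
  simp only [Complex.mul_re, Complex.mul_im, Complex.ofReal_re, Complex.ofReal_im, Complex.I_re, Complex.I_im,
    Complex.neg_re, Complex.neg_im]
  push_cast
  rw [sym]
  have I2 := Complex.I_sq
  generalize T 1 1 = a at *
  generalize T Complex.I 1 = b at *
  generalize T Complex.I Complex.I = c at *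
  generalize D 1 = d1 at *
  generalize D Complex.I = d2 at *
  generalize (e.re : ℂ) = x at *
  generalize (e.im : ℂ) = y at *
  generalize G (r * e) = g at *
  linear_combination (-4 * (r:ℂ)^2) * h + (r:ℂ)^2 * (a + c) * he' + (-2 * (r:ℂ)^3 * y * ν * d2) * I2

/-- unit circle point -/
noncomputable def ept (θ : ℝ) : ℂ := Real.cos θ + Real.sin θ * Complex.I

lemma ept_cont : Continuous ept := by unfold ept; fun_prop

lemma ept_deriv (θ : ℝ) : HasDerivAt ept (Complex.I * ept θ) θ := by
  have h1 := (Real.hasDerivAt_cos θ).ofReal_comp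
  have h2 := ((Real.hasDerivAt_sin θ).ofReal_comp).mul_const Complex.I
  refine (h1.add h2).congr_deriv ?_
  unfold ept
  push_cast
  linear_combination (-Complex.sin θ) * Complex.I_sq

lemma ept_sq (θ : ℝ) : (ept θ).re ^ 2 + (ept θ).im ^ 2 = 1 := by
  simp only [ept, Complex.add_re, Complex.add_im, Complex.ofReal_re, Complex.ofReal_im, Complex.mul_re,
    Complex.mul_im, Complex.I_re, Complex.I_im]
  have := Real.cos_sq_add_sin_sq θ
  linarith

lemma ept_norm (θ : ℝ) : ‖ept θ‖ = 1 := by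
  have h : ‖ept θ‖ ^ 2 = 1 := by
    rw [Complex.sq_norm, Complex.normSq_apply]; linarith [ept_sq θ]
  have := norm_nonneg (ept θ)
  nlinarith

lemma radial {ν : ℝ} (hν : 0 < ν) {l : ℕ} {G : ℂ → ℂ} (hG : ContDiff ℝ (⊤ : ℕ∞) G)
    (heig : ∀ z : ℂ, magLap ν G z = (ν : ℂ) * (l : ℂ) * G z) (r : ℝ) (hr : 0 ≤ r) :
    ∫ θ in (-Real.pi)..Real.pi, G (r * ept θ) = 2 * Real.pi * G 0 * (laguerre l (ν * r ^ 2) : ℝ) := by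
  have hG2 : ContDiff ℝ 2 G := contDiff_infty.1 hG 2
  have hd1 : Differentiable ℝ G := hG2.differentiable (by simp)
  have hf1 : ContDiff ℝ 1 (fderiv ℝ G) := hG2.fderiv_right (m := 1) (by norm_num)
  have hd2 : Differentiable ℝ (fderiv ℝ G) := hf1.differentiable (by simp)
  have c0 : Continuous G := hG2.continuous
  have c1 : Continuous (fderiv ℝ G) := hf1.continuous
  have c2 : Continuous (fderiv ℝ (fderiv ℝ G)) := hf1.continuous_fderiv (by simp)
  have ce := ept_cont
  set P : ℝ → ℝ → ℂ := fun r θ => G (r * ept θ) with hP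
  set P1 : ℝ → ℝ → ℂ := fun r θ => fderiv ℝ G (r * ept θ) (ept θ) with hP1
  set P2 : ℝ → ℝ → ℂ := fun r θ => fderiv ℝ (fderiv ℝ G) (r * ept θ) (ept θ) (ept θ) with hP2
  have cP : Continuous (Function.uncurry P) := by
    simp only [hP, Function.uncurry_def]; fun_prop
  have cP1 : Continuous (Function.uncurry P1) := by
    simp only [hP1, Function.uncurry_def]; fun_prop
  have cP2 : Continuous (Function.uncurry P2) := by
    simp only [hP2, Function.uncurry_def]; fun_prop
  have hline : ∀ (r θ : ℝ), HasDerivAt (fun r : ℝ => (r : ℂ) * ept θ) (ept θ) r := by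
    intro r θ
    simpa using ((hasDerivAt_id' r).ofReal_comp).mul_const (ept θ)
  have dP : ∀ r θ, HasDerivAt (fun r => P r θ) (P1 r θ) r := by
    intro r θ
    exact (hd1 _).hasFDerivAt.comp_hasDerivAt r (hline r θ)
  have dP1 : ∀ r θ, HasDerivAt (fun r => P1 r θ) (P2 r θ) r := by
    intro r θ
    have := (hd2 (r * ept θ)).hasFDerivAt.comp_hasDerivAt r (hline r θ)
    simpa using this.clm_apply (hasDerivAt_const r (ept θ))
  -- circle derivatives
  have hcirc : ∀ (r θ : ℝ), HasDerivAt (fun θ : ℝ => (r : ℂ) * ept θ) (r * (Complex.I * ept θ)) θ :=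
    fun r θ => (ept_deriv θ).const_mul _
  have hcirc2 : ∀ (r θ : ℝ), HasDerivAt (fun θ : ℝ => (r : ℂ) * (Complex.I * ept θ)) (-(r * ept θ)) θ := by
    intro r θ
    refine (((ept_deriv θ).const_mul Complex.I).const_mul (r : ℂ)).congr_deriv ?_
    linear_combination (r * ept θ) * Complex.I_sq
  have dθ : ∀ r θ : ℝ, HasDerivAt (fun θ => G (r * ept θ)) (fderiv ℝ G (r * ept θ) (r * (Complex.I * ept θ))) θ :=
    fun r θ => (hd1 _).hasFDerivAt.comp_hasDerivAt θ (hcirc r θ)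
  have dθθ : ∀ r θ : ℝ, HasDerivAt (fun θ => fderiv ℝ G (r * ept θ) (r * (Complex.I * ept θ)))
      (fderiv ℝ (fderiv ℝ G) (r * ept θ) (r * (Complex.I * ept θ)) (r * (Complex.I * ept θ))
        + fderiv ℝ G (r * ept θ) (-(r * ept θ))) θ := by
    intro r θ
    have := (hd2 (r * ept θ)).hasFDerivAt.comp_hasDerivAt θ (hcirc r θ)
    exact this.clm_apply (hcirc2 r θ)
  have hper : ept (-Real.pi) = ept Real.pi := by simp [ept]
  set g : ℝ → ℂ := fun r => ∫ θ in (-Real.pi)..Real.pi, P r θ with hg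
  set g1 : ℝ → ℂ := fun r => ∫ θ in (-Real.pi)..Real.pi, P1 r θ with hg1
  set g2 : ℝ → ℂ := fun r => ∫ θ in (-Real.pi)..Real.pi, P2 r θ with hg2
  have dg : ∀ r, HasDerivAt g (g1 r) r := fun r => hasDerivAt_param cP cP1 dP _ _ r
  have dg1 : ∀ r, HasDerivAt g1 (g2 r) r := fun r => hasDerivAt_param cP1 cP2 dP1 _ _ r
  have gode : ∀ r : ℝ, (r : ℂ) ^ 2 * g2 r + (r - 2 * ν * r ^ 3) * g1 r + 4 * ν * l * r ^ 2 * g r = 0 := by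
    intro r
    have q0 : Continuous (P r) := cP.comp (Continuous.prodMk_right r)
    have q1 : Continuous (P1 r) := cP1.comp (Continuous.prodMk_right r)
    have q2 : Continuous (P2 r) := cP2.comp (Continuous.prodMk_right r)
    simp only [hg, hg1, hg2]
    rw [← intervalIntegral.integral_const_mul, ← intervalIntegral.integral_const_mul,
      ← intervalIntegral.integral_const_mul, ← intervalIntegral.integral_add,
      ← intervalIntegral.integral_add]
    rotate_left
    · exact Continuous.intervalIntegrable (by fun_prop) _ _
    · exact Continuous.intervalIntegrable (by fun_prop) _ _
    · exact Continuous.intervalIntegrable (by fun_prop) _ _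
    · exact Continuous.intervalIntegrable (by fun_prop) _ _
    have key : ∀ θ : ℝ, HasDerivAt (fun θ => 2 * ν * r ^ 2 * Complex.I * G (r * ept θ)
        - fderiv ℝ G (r * ept θ) (r * (Complex.I * ept θ)))
        ((r : ℂ) ^ 2 * P2 r θ + (r - 2 * ν * r ^ 3) * P1 r θ + 4 * ν * l * r ^ 2 * P r θ) θ := by
      intro θ
      refine (((dθ r θ).const_mul _).sub (dθθ r θ)).congr_deriv ?_
      exact (polar_pt hG heig r (ept θ) (ept_sq θ)).symm
    rw [intervalIntegral.integral_eq_sub_of_hasDerivAt (fun θ _ => key θ)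
      (Continuous.intervalIntegrable (by fun_prop) _ _)]
    rw [hper]; ring
  -- the Laguerre solution
  set p := lagP l with hp
  set q : ℝ → ℝ := fun r => p.eval (ν * r ^ 2) with hq
  set q1 : ℝ → ℝ := fun r => p.derivative.eval (ν * r ^ 2) * (2 * ν * r) with hq1
  set q2 : ℝ → ℝ := fun r => p.derivative.derivative.eval (ν * r ^ 2) * (2 * ν * r) * (2 * ν * r)
    + p.derivative.eval (ν * r ^ 2) * (2 * ν) with hq2
  have dsq : ∀ r : ℝ, HasDerivAt (fun r : ℝ => ν * r ^ 2) (2 * ν * r) r := by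
    intro r
    refine ((hasDerivAt_pow 2 r).const_mul ν).congr_deriv ?_
    norm_num; ring
  have dq : ∀ r, HasDerivAt q (q1 r) r := by
    intro r
    have a := (p.hasDerivAt (ν * r ^ 2)).comp r (dsq r)
    exact a
  have dq1 : ∀ r, HasDerivAt q1 (q2 r) r := by
    intro r
    have a := (p.derivative.hasDerivAt (ν * r ^ 2)).comp r (dsq r)
    have b : HasDerivAt (fun r : ℝ => 2 * ν * r) (2 * ν) r := by
      simpa using (hasDerivAt_id' r).const_mul (2 * ν)
    exact a.mul b
  have qode : ∀ r : ℝ, r ^ 2 * q2 r + (r - 2 * ν * r ^ 3) * q1 r + 4 * ν * l * r ^ 2 * q r = 0 := by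
    intro r
    have := congrArg (Polynomial.eval (ν * r ^ 2)) (lagP_ode l)
    simp only [Polynomial.eval_add, Polynomial.eval_sub, Polynomial.eval_mul, Polynomial.eval_X, Polynomial.eval_C, Polynomial.eval_one,
      Polynomial.eval_zero] at this
    simp only [hq, hq1, hq2]
    linear_combination (4 * ν * r ^ 2) * this
  have g0 : g 0 = 2 * Real.pi * G 0 := by
    simp only [hg, hP, Complex.ofReal_zero, zero_mul, intervalIntegral.integral_const, Complex.real_smul]
    push_cast; ring
  have g10 : g1 0 = 0 := by
    have : ∀ θ : ℝ, HasDerivAt (fun θ => fderiv ℝ G 0 (-Complex.I * ept θ)) (fderiv ℝ G 0 (ept θ)) θ := by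
      intro θ
      have := (fderiv ℝ G 0).hasFDerivAt.comp_hasDerivAt θ ((ept_deriv θ).const_mul (-Complex.I))
      refine this.congr_deriv ?_
      congr 1
      linear_combination (-ept θ) * Complex.I_sq
    simp only [hg1, hP1, Complex.ofReal_zero, zero_mul]
    rw [intervalIntegral.integral_eq_sub_of_hasDerivAt (fun θ _ => this θ)
      (Continuous.intervalIntegrable (by fun_prop) _ _), hper, sub_self]
  have q0 : q 0 = 1 := by
    simp [hq, hp, lagP_eval, laguerre, Finset.sum_range_succ']
  have q10 : q1 0 = 0 := by simp [hq1]
  set A := g 0 with hA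
  have := ode_unique hν l (fun r => g r - A * (q r : ℂ)) (fun r => g1 r - A * (q1 r : ℂ))
    (fun r => g2 r - A * (q2 r : ℂ))
    (fun r => (dg r).sub ((dq r).ofReal_comp.const_mul A))
    (fun r => (dg1 r).sub ((dq1 r).ofReal_comp.const_mul A))
    (by simp [q0, hA]) (by simp [q10, g10]) (by
      intro r hr
      have e1 := gode r
      have e2 : ((r ^ 2 * q2 r + (r - 2 * ν * r ^ 3) * q1 r + 4 * ν * l * r ^ 2 * q r : ℝ) : ℂ) = 0 := by
        rw [qode r]; simp
      push_cast at e2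
      have hr' : (r : ℂ) ≠ 0 := by exact_mod_cast hr.ne'
      have hi : (r : ℂ) * (r : ℂ)⁻¹ = 1 := mul_inv_cancel₀ hr'
      simp only [Complex.real_smul]
      push_cast
      apply mul_left_cancel₀ (pow_ne_zero 2 hr')
      linear_combination e1 - A * e2 + r * (g1 r - A * q1 r) * hi) r hr
  have h3 : g r = A * (q r : ℂ) := sub_eq_zero.1 this
  rw [show (∫ θ in (-Real.pi)..Real.pi, G (r * ept θ)) = g r from rfl, h3, g0]
  simp [hq, hp, lagP_eval]

lemma at_zero {ν : ℝ} (hν : 0 < ν) {l : ℕ} {G : ℂ → ℂ} (hG : ContDiff ℝ (⊤ : ℕ∞) G)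
    (heig : ∀ z : ℂ, magLap ν G z = (ν : ℂ) * (l : ℂ) * G z)
    (hi : Integrable (fun w : ℂ => ((laguerre l (ν * ‖w‖ ^ 2) * Real.exp (-ν * ‖w‖ ^ 2) : ℝ) : ℂ) * G w)) :
    ∫ w : ℂ, ((laguerre l (ν * ‖w‖ ^ 2) * Real.exp (-ν * ‖w‖ ^ 2) : ℝ) : ℂ) * G w
      = ((Real.pi / ν : ℝ) : ℂ) * G 0 := by
  have cG : Continuous G := hG.continuous
  have cL := lag_cont l
  have ce := ept_cont
  set f : ℂ → ℂ := fun w => ((laguerre l (ν * ‖w‖ ^ 2) * Real.exp (-ν * ‖w‖ ^ 2) : ℝ) : ℂ) * G w with hf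
  have cf : Continuous f := by
    simp only [hf]; fun_prop
  have hsymm : ∀ p : ℝ × ℝ, Complex.polarCoord.symm p = p.1 * ept p.2 := fun p => by
    rw [Complex.polarCoord_symm_apply]; rfl
  have hint : IntegrableOn (fun p : ℝ × ℝ => p.1 • f (p.1 * ept p.2))
      (Set.Ioi (0:ℝ) ×ˢ Set.Ioo (-Real.pi) Real.pi) (volume.prod volume) := by
    refine ⟨(Continuous.aestronglyMeasurable (by fun_prop)), ?_⟩
    have h1 := Complex.lintegral_comp_polarCoord_symm (fun w => ‖f w‖ₑ)
    have h2 := hi.2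
    unfold HasFiniteIntegral at h2 ⊢
    rw [← h1] at h2
    refine lt_of_eq_of_lt ?_ h2
    rw [show polarCoord.target = Set.Ioi (0:ℝ) ×ˢ Set.Ioo (-Real.pi) Real.pi from rfl, Measure.volume_eq_prod]
    refine setLIntegral_congr_fun (measurableSet_Ioi.prod measurableSet_Ioo) ?_
    rintro p hp
    have hp1 : 0 < p.1 := hp.1
    simp only [hsymm, enorm_smul, smul_eq_mul]
    congr 1
    exact Real.enorm_eq_ofReal hp1.le
  rw [← Complex.integral_comp_polarCoord_symm]
  simp_rw [hsymm]
  rw [show polarCoord.target = Set.Ioi (0:ℝ) ×ˢ Set.Ioo (-Real.pi) Real.pi from rfl,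
    Measure.volume_eq_prod, setIntegral_prod _ hint]
  have inner_eq : ∀ r ∈ Set.Ioi (0:ℝ), ∫ θ in Set.Ioo (-Real.pi) Real.pi, r • f (r * ept θ)
      = ((r * (laguerre l (ν * r ^ 2) ^ 2 * Real.exp (-ν * r ^ 2)) : ℝ) : ℂ) * (2 * Real.pi * G 0) := by
    intro r hr
    have hr0 : 0 < r := hr
    have hn : ∀ θ, ‖(r : ℂ) * ept θ‖ = r := fun θ => by
      rw [norm_mul, ept_norm, Complex.norm_real, Real.norm_of_nonneg hr0.le, mul_one]
    simp only [hf, hn]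
    rw [integral_smul, integral_const_mul, ← integral_Ioc_eq_integral_Ioo,
      ← intervalIntegral.integral_of_le (by linarith [Real.pi_pos]), radial hν hG heig r hr0.le]
    rw [Complex.real_smul]
    push_cast
    ring
  rw [setIntegral_congr_fun measurableSet_Ioi inner_eq, integral_mul_const, integral_complex_ofReal, (lag_int hν l).2]
  push_cast
  have : (ν : ℂ) ≠ 0 := by exact_mod_cast hν.ne'
  field_simp

lemma shift_eig {ν : ℝ} {l : ℕ} {F : ℂ → ℂ} (hF : ContDiff ℝ (⊤ : ℕ∞) F)
    (heig : ∀ z : ℂ, magLap ν F z = (ν : ℂ) * (l : ℂ) * F z) (z u : ℂ) :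
    magLap ν (fun u => Complex.exp (-ν * starRingEnd ℂ z * u) * F (z + u)) u
      = (ν : ℂ) * (l : ℂ) * (Complex.exp (-ν * starRingEnd ℂ z * u) * F (z + u)) := by
  have hF2 : ContDiff ℝ 2 F := contDiff_infty.1 hF 2
  have hd1 : Differentiable ℝ F := hF2.differentiable (by simp)
  have hd2 : Differentiable ℝ (fderiv ℝ F) :=
    (hF2.fderiv_right (m := 1) (by norm_num)).differentiable (by simp)
  set c : ℂ := -ν * starRingEnd ℂ z with hc
  have hexp : ∀ u, HasFDerivAt (fun u : ℂ => Complex.exp (c * u))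
      ((ContinuousLinearMap.toSpanSingleton ℂ (Complex.exp (c * u) * c)).restrictScalars ℝ) u := by
    intro u
    have : HasDerivAt (fun u : ℂ => Complex.exp (c * u)) (Complex.exp (c * u) * c) u := by
      simpa using ((hasDerivAt_id' u).const_mul c).cexp
    exact this.hasFDerivAt.restrictScalars ℝ
  have prodrule : ∀ (H : ℂ → ℂ), Differentiable ℝ H → ∀ u v,
      fderiv ℝ (fun u => Complex.exp (c * u) * H (z + u)) u v
        = Complex.exp (c * u) * (fderiv ℝ H (z + u) v + c * v * H (z + u)) := by
    intro H hH u v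
    have h2 : HasFDerivAt (fun u => H (z + u)) (fderiv ℝ H (z + u)) u := by
      have := (hH (z + u)).hasFDerivAt.comp u ((hasFDerivAt_id u).const_add z)
      simp only [ContinuousLinearMap.comp_id] at this
      exact this
    rw [((hexp u).fun_mul h2).fderiv]
    simp
    ring
  have second : ∀ u v, fderiv ℝ (fun w => fderiv ℝ (fun u => Complex.exp (c * u) * F (z + u)) w v) u v
      = Complex.exp (c * u) * (fderiv ℝ (fun w => fderiv ℝ F w v) (z + u) v
        + 2 * c * v * fderiv ℝ F (z + u) v + c ^ 2 * v ^ 2 * F (z + u)) := by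
    intro u v
    have hv : Differentiable ℝ (fun w => fderiv ℝ F w v) := fun w =>
      (hd2 w).clm_apply (differentiableAt_const v)
    have e : (fun w => fderiv ℝ (fun u => Complex.exp (c * u) * F (z + u)) w v)
        = fun w => Complex.exp (c * w) * (fun x => fderiv ℝ F x v + c * v * F x) (z + w) := by
      funext w; exact prodrule F hd1 w v
    rw [e, prodrule (fun x => fderiv ℝ F x v + c * v * F x) (hv.add (hd1.const_mul _)) u v]
    have e2 : fderiv ℝ (fun x => fderiv ℝ F x v + c * v * F x) (z + u) v
        = fderiv ℝ (fun w => fderiv ℝ F w v) (z + u) v + c * v * fderiv ℝ F (z + u) v := by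
      rw [fderiv_fun_add (hv _) ((hd1 _).const_mul _), fderiv_const_mul (hd1 _)]
      simp
    rw [e2]
    ring
  have h := heig (z + u)
  unfold magLap at h ⊢
  rw [second u 1, second u Complex.I, prodrule F hd1 u 1, prodrule F hd1 u Complex.I]
  rw [map_add] at h
  rw [Complex.I_sq]
  have I2 := Complex.I_sq
  generalize Complex.exp (c * u) = E at *
  have hz : (ν : ℂ) * starRingEnd ℂ z = -c := by rw [hc]; ring
  clear_value c
  generalize starRingEnd ℂ z = zb at *
  generalize starRingEnd ℂ u = ub at *
  generalize fderiv ℝ F (z + u) 1 = d1 at *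
  generalize fderiv ℝ F (z + u) Complex.I = d2 at *
  linear_combination E * h - E * (d1 + Complex.I * d2) / 2 * hz + E * ν / 2 * ub * c * F (z + u) * I2

theorem stmt6 (ν : ℝ) (hν : 0 < ν) (ℓ : ℕ) (F : ℂ → ℂ)
    (hF : ContDiff ℝ (⊤ : ℕ∞) F)
    (hL2 : Integrable (fun w : ℂ => ‖F w‖ ^ 2 * Real.exp (-ν * ‖w‖ ^ 2)))
    (heig : ∀ z : ℂ, magLap ν F z = (ν : ℂ) * (ℓ : ℂ) * F z) :
    ∀ z : ℂ, F z = ((ν / Real.pi : ℝ) : ℂ) *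
      ∫ w : ℂ, Complex.exp ((ν : ℂ) * z * (starRingEnd ℂ w)) *
        ((laguerre ℓ (ν * ‖z - w‖ ^ 2) : ℝ) : ℂ) * F w *
        ((Real.exp (-ν * ‖w‖ ^ 2) : ℝ) : ℂ) := by
  intro z
  set G : ℂ → ℂ := fun u => Complex.exp (-ν * starRingEnd ℂ z * u) * F (z + u) with hGdef
  have hG : ContDiff ℝ (⊤ : ℕ∞) G := by
    have h1 : ContDiff ℝ (⊤ : ℕ∞) (fun u : ℂ => Complex.exp (-ν * starRingEnd ℂ z * u)) :=
      (contDiff_const.mul contDiff_id).cexp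
    exact h1.mul (hF.comp (contDiff_const.add contDiff_id))
  have hGe : ∀ u, magLap ν G u = (ν : ℂ) * (ℓ : ℂ) * G u := shift_eig hF heig z
  have cG : Continuous G := hG.continuous
  have cL := lag_cont ℓ
  -- norm identity: |z+u|^2 expansions
  have hns : ∀ w : ℂ, ((‖w‖ ^ 2 : ℝ) : ℂ) = w * starRingEnd ℂ w := fun w => by
    rw [Complex.mul_conj, Complex.normSq_eq_norm_sq]
  have hGn : ∀ u, ‖G u‖ ^ 2 * Real.exp (-ν * ‖u‖ ^ 2)
      = Real.exp (ν * ‖z‖ ^ 2) * (‖F (z + u)‖ ^ 2 * Real.exp (-ν * ‖z + u‖ ^ 2)) := by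
    intro u
    simp only [hGdef]
    rw [norm_mul, Complex.norm_exp, mul_pow, ← Real.exp_nat_mul]
    have : Real.exp (((2:ℕ):ℝ) * (-ν * starRingEnd ℂ z * u).re) * Real.exp (-ν * ‖u‖ ^ 2)
        = Real.exp (ν * ‖z‖ ^ 2) * Real.exp (-ν * ‖z + u‖ ^ 2) := by
      rw [← Real.exp_add, ← Real.exp_add]
      congr 1
      simp only [Complex.sq_norm, Complex.normSq_apply]
      simp
      ring
    linear_combination (‖F (z + u)‖ ^ 2) * this
  have hG2 : Integrable (fun u : ℂ => ‖G u‖ ^ 2 * Real.exp (-ν * ‖u‖ ^ 2)) := by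
    simp_rw [hGn]
    exact (hL2.comp_add_left z).const_mul _
  have hLL : Integrable (fun u : ℂ => laguerre ℓ (ν * ‖u‖ ^ 2) ^ 2 * Real.exp (-ν * ‖u‖ ^ 2)) := by
    have := (integrable_fun_norm_addHaar (volume : Measure ℂ)
      (f := fun r : ℝ => laguerre ℓ (ν * r ^ 2) ^ 2 * Real.exp (-ν * r ^ 2))).2 (by
        simpa [Complex.finrank_real_complex] using (lag_int hν ℓ).1)
    exact this
  have hi : Integrable (fun w : ℂ => ((laguerre ℓ (ν * ‖w‖ ^ 2) * Real.exp (-ν * ‖w‖ ^ 2) : ℝ) : ℂ) * G w) := by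
    refine (hG2.add hLL).mono' (Continuous.aestronglyMeasurable (by fun_prop)) ?_
    refine Filter.Eventually.of_forall fun w => ?_
    rw [norm_mul, Complex.norm_real, norm_mul, Real.norm_eq_abs, Real.norm_eq_abs, Real.abs_exp]
    simp only [Pi.add_apply]
    rw [← sq_abs (laguerre ℓ (ν * ‖w‖ ^ 2))]
    set a := |laguerre ℓ (ν * ‖w‖ ^ 2)|
    set b := ‖G w‖
    have : a * b ≤ b ^ 2 + a ^ 2 := by nlinarith [sq_nonneg (a - b), sq_nonneg a, sq_nonneg b]
    have := mul_le_mul_of_nonneg_right this (Real.exp_pos (-ν * ‖w‖ ^ 2)).le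
    linarith
  have key := at_zero hν hG hGe hi
  have hG0 : G 0 = F z := by simp [hGdef]
  rw [hG0] at key
  rw [← integral_add_left_eq_self _ z]
  have e : ∀ u : ℂ, Complex.exp ((ν : ℂ) * z * (starRingEnd ℂ (z + u))) *
        ((laguerre ℓ (ν * ‖z - (z + u)‖ ^ 2) : ℝ) : ℂ) * F (z + u) *
        ((Real.exp (-ν * ‖z + u‖ ^ 2) : ℝ) : ℂ)
      = ((laguerre ℓ (ν * ‖u‖ ^ 2) * Real.exp (-ν * ‖u‖ ^ 2) : ℝ) : ℂ) * G u := by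
    intro u
    have h1 : ‖z - (z + u)‖ = ‖u‖ := by simp
    rw [h1]
    simp only [hGdef]
    have h2 : Complex.exp ((ν : ℂ) * z * (starRingEnd ℂ (z + u))) * ((Real.exp (-ν * ‖z + u‖ ^ 2) : ℝ) : ℂ)
       = ((Real.exp (-ν * ‖u‖ ^ 2) : ℝ) : ℂ) * Complex.exp (-ν * starRingEnd ℂ z * u) := by
      rw [Complex.ofReal_exp, Complex.ofReal_exp, ← Complex.exp_add, ← Complex.exp_add]
      congr 1
      have a1 := hns (z + u)
      have a2 := hns u
      rw [map_add] at *
      rw [Complex.ofReal_mul, Complex.ofReal_mul, a1, a2]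
      push_cast
      ring
    rw [Complex.ofReal_mul]
    linear_combination ((laguerre ℓ (ν * ‖u‖ ^ 2) : ℝ) : ℂ) * F (z + u) * h2
  simp_rw [e]
  rw [key, ← mul_assoc, ← Complex.ofReal_mul]
  have : ν / Real.pi * (Real.pi / ν) = 1 := by
    have := Real.pi_ne_zero
    field_simp
  rw [this]; simp
end

section
/- Let ν > 0, let m ≥ 1 be an integer, and let f : ℂ → ℂ be an entire function with Taylor expansion f(z) = ∑_{j=0}^∞ a_j z^j. Then, as an identity in [0, ∞], ∫_ℂ |f^{(m)}(z)|² e^{−ν|z|²} dλ(z) = (π/ν) ∑_{j=m}^∞ ( (j!)² / ( (j−m)! ν^{j−m} ) ) |a_j|². In particular, f belongs to the generalized Bargmann-Dirichlet space 𝒜_m^{2,ν}(ℂ) if and only if ∑_{j=m}^∞ ( (j!)² / ( (j−m)! ν^{j−m} ) ) |a_j|² < ∞. -/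
open MeasureTheory

lemma coeff_unique (f : ℂ → ℂ) (a b : ℕ → ℂ)
    (ha : ∀ z : ℂ, HasSum (fun j : ℕ => a j * z ^ j) (f z))
    (hb : ∀ z : ℂ, HasSum (fun j : ℕ => b j * z ^ j) (f z)) : a = b := by
  have key : ∀ c : ℕ → ℂ, (∀ z : ℂ, HasSum (fun j : ℕ => c j * z ^ j) (f z)) →
      HasFPowerSeriesAt f (FormalMultilinearSeries.ofScalars ℂ c) 0 := by
    intro c hc
    rw [hasFPowerSeriesAt_iff]
    refine Filter.Eventually.of_forall fun z => ?_
    simpa [FormalMultilinearSeries.coeff_ofScalars, mul_comm] using hc z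
  have h := (key a ha).eq_formalMultilinearSeries (key b hb)
  funext n
  have := congrArg (fun p => FormalMultilinearSeries.coeff p n) h
  simpa [FormalMultilinearSeries.coeff_ofScalars] using this

lemma hasSum_deriv (m : ℕ) (f : ℂ → ℂ) (a : ℕ → ℂ)
    (hf : Differentiable ℂ f)
    (ha : ∀ z : ℂ, HasSum (fun j : ℕ => a j * z ^ j) (f z)) (z : ℂ) :
    HasSum (fun j : ℕ => (((j + m).factorial : ℂ) / (j.factorial : ℂ) * a (j + m)) * z ^ j)
      (iteratedDeriv m f z) := by
  have hA : a = fun n => (n.factorial : ℂ)⁻¹ * iteratedDeriv n f 0 := by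
    refine coeff_unique f _ _ ha fun z => ?_
    convert! Complex.hasSum_taylorSeries_of_entire hf 0 z using 1
    funext n
    simp; ring
  have hd : Differentiable ℂ (iteratedDeriv m f) :=
    (hf.contDiff (n := ⊤)).differentiable_iteratedDeriv m (by exact_mod_cast WithTop.coe_lt_top _)
  convert! Complex.hasSum_taylorSeries_of_entire hd 0 z using 1
  funext n
  have : iteratedDeriv n (iteratedDeriv m f) = iteratedDeriv (n + m) f := by
    simp only [iteratedDeriv_eq_iterate, Function.iterate_add_apply]
  rw [this, hA]
  have := Nat.factorial_ne_zero (n+m)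
  have : ((n+m).factorial : ℂ) ≠ 0 := by exact_mod_cast this
  simp
  field_simp

lemma int_exp (n : ℤ) : ∫ θ in (-Real.pi)..Real.pi, Complex.exp ((n * Complex.I) * (θ : ℂ)) =
    if n = 0 then 2 * (Real.pi : ℂ) else 0 := by
  split_ifs with h
  · subst h
    simp; ring
  · rw [integral_exp_mul_complex (by simp [h])]
    have : Complex.exp ((n * Complex.I) * (Real.pi : ℂ)) =
        Complex.exp ((n * Complex.I) * ((-Real.pi : ℝ) : ℂ)) := by
      rw [Complex.exp_eq_exp_iff_exists_int]
      exact ⟨n, by push_cast; ring⟩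
    rw [this]; simp

lemma coeff_int (c : ℕ → ℂ) (hc : Summable fun j => ‖c j‖) (F : ℝ → ℂ)
    (hF : ∀ θ : ℝ, HasSum (fun j : ℕ => c j * Complex.exp ((j * Complex.I) * θ)) (F θ)) (k : ℕ) :
    ∫ θ in (-Real.pi)..Real.pi, F θ * Complex.exp (-(k * Complex.I) * (θ : ℂ)) =
      2 * Real.pi * c k := by
  have h := intervalIntegral.hasSum_integral_of_dominated_convergence (μ := volume)
    (a := -Real.pi) (b := Real.pi)
    (F := fun (j : ℕ) (θ : ℝ) => c j * Complex.exp ((j * Complex.I) * θ) *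
      Complex.exp (-(k * Complex.I) * (θ : ℂ)))
    (f := fun θ => F θ * Complex.exp (-(k * Complex.I) * (θ : ℂ)))
    (fun j _ => ‖c j‖) (fun j => by
      apply Continuous.aestronglyMeasurable; fun_prop)
    (fun j => Filter.Eventually.of_forall fun θ _ => by
      simp [Complex.norm_exp])
    (Filter.Eventually.of_forall fun θ _ => hc) (by simp)
    (Filter.Eventually.of_forall fun θ _ => (hF θ).mul_right _)
  have e : ∀ j : ℕ, (∫ θ in (-Real.pi)..Real.pi, c j * Complex.exp ((j * Complex.I) * θ) *
      Complex.exp (-(k * Complex.I) * (θ : ℂ))) = if j = k then 2 * Real.pi * c k else 0 := by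
    intro j
    have : ∀ θ : ℝ, c j * Complex.exp ((j * Complex.I) * θ) *
      Complex.exp (-(k * Complex.I) * (θ : ℂ)) =
      c j * Complex.exp ((((j - k : ℤ) : ℂ) * Complex.I) * θ) := by
      intro θ
      rw [mul_assoc, ← Complex.exp_add]; congr 2; push_cast; ring
    simp only [this, intervalIntegral.integral_const_mul, int_exp]
    by_cases hjk : j = k
    · subst hjk; simp; ring
    · have : (j - k : ℤ) ≠ 0 := by omega
      simp [hjk, this]
  simp only [e] at h
  exact h.unique (hasSum_ite_eq k _)

lemma parseval (c : ℕ → ℂ) (hc : Summable fun j => ‖c j‖) (F : ℝ → ℂ) (hFc : Continuous F)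
    (hF : ∀ θ : ℝ, HasSum (fun j : ℕ => c j * Complex.exp ((j * Complex.I) * θ)) (F θ)) :
    HasSum (fun j => 2 * Real.pi * ‖c j‖ ^ 2) (∫ θ in (-Real.pi)..Real.pi, ‖F θ‖ ^ 2) := by
  obtain ⟨B, hB⟩ : ∃ B, ∀ θ, ‖F θ‖ ≤ B := ⟨∑' j, ‖c j‖, fun θ => by
    rw [← (hF θ).tsum_eq]
    refine (norm_tsum_le_tsum_norm ?_).trans (le_of_eq ?_)
    all_goals simp [Complex.norm_exp, hc]⟩
  have h := intervalIntegral.hasSum_integral_of_dominated_convergence (μ := volume)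
    (a := -Real.pi) (b := Real.pi)
    (F := fun (j : ℕ) (θ : ℝ) => F θ * (starRingEnd ℂ) (c j * Complex.exp ((j * Complex.I) * θ)))
    (f := fun θ => F θ * (starRingEnd ℂ) (F θ))
    (fun j _ => B * ‖c j‖) (fun j => by
      apply Continuous.aestronglyMeasurable; fun_prop)
    (fun j => Filter.Eventually.of_forall fun θ _ => by
      simp only [norm_mul, RCLike.norm_conj, Complex.norm_exp]
      simp
      gcongr; exact hB θ)
    (Filter.Eventually.of_forall fun θ _ => hc.mul_left B) (by simp)
    (Filter.Eventually.of_forall fun θ _ => by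
      refine HasSum.mul_left _ ?_
      exact Complex.hasSum_conj'.mpr (by simpa using hF θ))
  have e : ∀ j : ℕ, (∫ θ in (-Real.pi)..Real.pi, F θ *
      (starRingEnd ℂ) (c j * Complex.exp ((j * Complex.I) * θ))) =
      ((2 * Real.pi * ‖c j‖ ^ 2 : ℝ) : ℂ) := by
    intro j
    have : ∀ θ : ℝ, F θ * (starRingEnd ℂ) (c j * Complex.exp ((j * Complex.I) * θ)) =
      (starRingEnd ℂ) (c j) * (F θ * Complex.exp (-(j * Complex.I) * (θ : ℂ))) := by
      intro θ
      rw [map_mul, ← Complex.exp_conj]; simp; ring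
    simp only [this, intervalIntegral.integral_const_mul, coeff_int c hc F hF]
    push_cast
    rw [← Complex.conj_mul']; ring
  simp only [e] at h
  have e2 : ∀ θ, F θ * (starRingEnd ℂ) (F θ) = ((‖F θ‖ ^ 2 : ℝ) : ℂ) := by
    intro θ; rw [Complex.mul_conj']; push_cast; rfl
  simp only [e2, intervalIntegral.integral_ofReal] at h
  exact Complex.hasSum_ofReal.mp h

lemma radial_s16 (ν : ℝ) (hν : 0 < ν) (j : ℕ) :
    ∫⁻ r in Set.Ioi (0 : ℝ), ENNReal.ofReal (r ^ (2 * j + 1) * Real.exp (-ν * r ^ 2)) =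
    ENNReal.ofReal (j.factorial / (2 * ν ^ (j + 1))) := by
  have h := integral_rpow_mul_exp_neg_mul_rpow (p := 2) (q := 2 * j + 1) (b := ν) (by norm_num)
    (by have : (0:ℝ) ≤ j := by positivity
        linarith) hν
  have hI := integrableOn_rpow_mul_exp_neg_mul_rpow (p := 2) (s := 2 * j + 1) (b := ν)
    (by have : (0:ℝ) ≤ j := by positivity
        linarith) (by norm_num) hν
  have e : ∀ x : ℝ, x ^ (2 * (j:ℝ) + 1) * Real.exp (-ν * x ^ (2:ℝ)) =
      x ^ (2 * j + 1) * Real.exp (-ν * x ^ 2) := by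
    intro x
    rw [show (2 * (j:ℝ) + 1) = ((2 * j + 1 : ℕ) : ℝ) by push_cast; ring, Real.rpow_natCast,
      Real.rpow_two]
  simp only [e] at h hI
  rw [← ofReal_integral_eq_lintegral_ofReal hI, h]
  · congr 1
    rw [show (2 * (j:ℝ) + 1 + 1) / 2 = j + 1 by ring, Real.Gamma_nat_eq_factorial,
      show -(2 * (j:ℝ) + 1 + 1) / 2 = -((j + 1 : ℕ) : ℝ) by push_cast; ring,
      Real.rpow_neg hν.le, Real.rpow_natCast]
    field_simp
  · filter_upwards [ae_restrict_mem measurableSet_Ioi] with r hr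
    have : 0 < r := hr
    positivity

lemma fock (ν : ℝ) (hν : 0 < ν) (g : ℂ → ℂ) (b : ℕ → ℂ) (hg : Continuous g)
    (hb : ∀ z : ℂ, HasSum (fun j : ℕ => b j * z ^ j) (g z)) :
    ∫⁻ z : ℂ, ENNReal.ofReal (‖g z‖ ^ 2 * Real.exp (-ν * ‖z‖ ^ 2)) =
      ∑' j : ℕ, ENNReal.ofReal (Real.pi * j.factorial / ν ^ (j + 1) * ‖b j‖ ^ 2) := by
  rw [← Complex.lintegral_comp_polarCoord_symm]
  have hz : ∀ p : ℝ × ℝ, Complex.polarCoord.symm p = p.1 * Complex.exp (Complex.I * p.2) := by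
    intro p
    rw [Complex.polarCoord_symm_apply, mul_comm Complex.I, Complex.exp_mul_I]
    push_cast; rfl
  have hpar : ∀ r : ℝ, HasSum (fun j => 2 * Real.pi * (‖b j‖ ^ 2 * r ^ (2 * j)))
      (∫ θ in (-Real.pi)..Real.pi, ‖g (r * Complex.exp (Complex.I * θ))‖ ^ 2) := by
    intro r
    have := parseval (fun j => b j * (r : ℂ) ^ j) (hb r).summable.norm
      (fun θ => g (r * Complex.exp (Complex.I * θ))) (by fun_prop) (fun θ => by
        convert hb (r * Complex.exp (Complex.I * θ)) using 2 with j
        rw [mul_pow, ← Complex.exp_nat_mul]; ring_nf)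
    convert this using 3 with j
    simp [mul_pow, ← pow_mul, mul_comm]
    rw [mul_comm j 2, pow_mul, pow_mul, sq_abs]
    exact Or.inl rfl
  have inner : ∀ r : ℝ, 0 < r → (∫⁻ θ in Set.Ioo (-Real.pi) Real.pi, ENNReal.ofReal r *
      ENNReal.ofReal (‖g (r * Complex.exp (Complex.I * θ))‖ ^ 2 * Real.exp (-ν * r ^ 2))) =
      ∑' j : ℕ, ENNReal.ofReal (2 * Real.pi * ‖b j‖ ^ 2) *
        ENNReal.ofReal (r ^ (2 * j + 1) * Real.exp (-ν * r ^ 2)) := by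
    intro r hr
    have e1 : ∀ θ : ℝ, ENNReal.ofReal r *
      ENNReal.ofReal (‖g (r * Complex.exp (Complex.I * θ))‖ ^ 2 * Real.exp (-ν * r ^ 2)) =
      ENNReal.ofReal (r * Real.exp (-ν * r ^ 2)) *
      ENNReal.ofReal (‖g (r * Complex.exp (Complex.I * θ))‖ ^ 2) := by
      intro θ
      rw [← ENNReal.ofReal_mul hr.le, ← ENNReal.ofReal_mul (by positivity)]
      congr 1; ring
    simp only [e1]
    rw [lintegral_const_mul' _ _ ENNReal.ofReal_ne_top, ← ofReal_integral_eq_lintegral_ofReal]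
    · rw [← integral_Ioc_eq_integral_Ioo, ← intervalIntegral.integral_of_le
        (by linarith [Real.pi_pos]), ← (hpar r).tsum_eq,
        ENNReal.ofReal_tsum_of_nonneg (fun j => by positivity) (hpar r).summable,
        ← ENNReal.tsum_mul_left]
      refine tsum_congr fun j => ?_
      rw [← ENNReal.ofReal_mul (by positivity), ← ENNReal.ofReal_mul (by positivity)]
      congr 1; ring
    · refine IntegrableOn.mono_set (t := Set.Icc (-Real.pi) Real.pi) ?_ Set.Ioo_subset_Icc_self
      exact Continuous.integrableOn_Icc (by fun_prop)
    · exact Filter.Eventually.of_forall fun θ => by positivity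
  rw [show polarCoord.target = Set.Ioi (0 : ℝ) ×ˢ Set.Ioo (-Real.pi) Real.pi from rfl,
    Measure.volume_eq_prod, setLIntegral_prod]
  · calc _ = ∫⁻ r in Set.Ioi (0 : ℝ), ∑' j : ℕ, ENNReal.ofReal (2 * Real.pi * ‖b j‖ ^ 2) *
        ENNReal.ofReal (r ^ (2 * j + 1) * Real.exp (-ν * r ^ 2)) := by
          refine setLIntegral_congr_fun measurableSet_Ioi fun r hr => ?_
          have hr' : 0 < r := hr
          simp only [← inner r hr', smul_eq_mul, hz, norm_mul, Complex.norm_real,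
            Real.norm_eq_abs, abs_of_pos hr']
          simp [Complex.norm_exp]
      _ = _ := by
          rw [lintegral_tsum (fun j => by fun_prop)]
          refine tsum_congr fun j => ?_
          rw [lintegral_const_mul' _ _ ENNReal.ofReal_ne_top, radial_s16 ν hν,
            ← ENNReal.ofReal_mul (by positivity)]
          congr 1; field_simp
  · simp only [hz]
    apply Measurable.aemeasurable
    simp only [smul_eq_mul]
    have : Continuous fun p : ℝ × ℝ => (p.1 : ℂ) * Complex.exp (Complex.I * p.2) := by fun_prop
    refine Measurable.mul (by fun_prop) (Measurable.ennreal_ofReal (Continuous.measurable ?_))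
    fun_prop

theorem stmt16 (ν : ℝ) (hν : 0 < ν) (m : ℕ) (hm : 1 ≤ m) (f : ℂ → ℂ) (a : ℕ → ℂ)
    (hf : Differentiable ℂ f)
    (ha : ∀ z : ℂ, HasSum (fun j : ℕ => a j * z ^ j) (f z)) :
    (∫⁻ z : ℂ, ENNReal.ofReal (‖iteratedDeriv m f z‖ ^ 2 * Real.exp (-ν * ‖z‖ ^ 2)) =
      ENNReal.ofReal (Real.pi / ν) *
        ∑' j : ℕ, ENNReal.ofReal
          (((j + m).factorial : ℝ) ^ 2 / ((j.factorial : ℝ) * ν ^ j) * ‖a (j + m)‖ ^ 2)) ∧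
    (Integrable (fun z : ℂ => ‖iteratedDeriv m f z‖ ^ 2 * Real.exp (-ν * ‖z‖ ^ 2)) ↔
      Summable (fun j : ℕ =>
        ((j + m).factorial : ℝ) ^ 2 / ((j.factorial : ℝ) * ν ^ j) * ‖a (j + m)‖ ^ 2)) := by
  have hd : Continuous (iteratedDeriv m f) :=
    (hf.contDiff (n := ⊤)).continuous_iteratedDeriv m (by exact_mod_cast le_top)
  have main : ∫⁻ z : ℂ, ENNReal.ofReal (‖iteratedDeriv m f z‖ ^ 2 * Real.exp (-ν * ‖z‖ ^ 2)) =
      ENNReal.ofReal (Real.pi / ν) *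
        ∑' j : ℕ, ENNReal.ofReal
          (((j + m).factorial : ℝ) ^ 2 / ((j.factorial : ℝ) * ν ^ j) * ‖a (j + m)‖ ^ 2) := by
    rw [fock ν hν _ _ hd (hasSum_deriv m f a hf ha), ← ENNReal.tsum_mul_left]
    refine tsum_congr fun j => ?_
    rw [← ENNReal.ofReal_mul (by positivity)]
    congr 1
    have : (j.factorial : ℝ) ≠ 0 := by exact_mod_cast Nat.factorial_ne_zero j
    simp only [norm_mul, norm_div, Complex.norm_natCast]
    field_simp
    ring
  refine ⟨main, ?_⟩
  rw [← lintegral_ofReal_ne_top_iff_integrable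
    (Continuous.aestronglyMeasurable (by fun_prop))
    (Filter.Eventually.of_forall fun z => by positivity), main]
  have hc : ENNReal.ofReal (Real.pi / ν) ≠ 0 := by
    have : 0 < Real.pi / ν := by positivity
    simpa using this
  constructor
  · intro h
    have h2 : ∑' j : ℕ, ENNReal.ofReal
          (((j + m).factorial : ℝ) ^ 2 / ((j.factorial : ℝ) * ν ^ j) * ‖a (j + m)‖ ^ 2) ≠ ⊤ :=
      fun h3 => h (by rw [h3, ENNReal.mul_top hc])
    have := ENNReal.summable_toReal h2
    refine this.congr fun j => ?_
    rw [ENNReal.toReal_ofReal (by positivity)]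
  · intro h
    exact ENNReal.mul_ne_top ENNReal.ofReal_ne_top h.tsum_ofReal_ne_top
end

section
/- Let ν > 0, let m ≥ 2 be an integer, and let F : ℂ → ℂ be smooth as a function of two real variables. Then the following are equivalent: (i) F ∈ L²,ν, the m-th iterated Wirtinger derivative ∂^m F/∂z^m is in L²,ν, and Δ_ν F = 0 on all of ℂ; (ii) F is holomorphic on ℂ and its m-th complex derivative F^{(m)} is in L²,ν. (In particular the generalized Bargmann-Dirichlet space 𝒜_m^{2,ν}(ℂ) coincides with the null space of the magnetic Laplacian Δ_ν restricted to the domain {F ∈ L²,ν : Δ_νF ∈ L²,ν and ∂^mF/∂z^m ∈ L²,ν}.) -/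
open MeasureTheory

/-- Truncation profile. -/
noncomputable def qq (s : ℝ) : ℝ := (max 0 s) ^ 2

theorem qq_hasDerivAt (s : ℝ) : HasDerivAt qq (2 * max 0 s) s := by
  rcases lt_trichotomy s 0 with h | h | h
  · have : qq =ᶠ[nhds s] fun _ => 0 := by
      filter_upwards [Iio_mem_nhds h] with t ht
      have ht : t < 0 := ht
      simp [qq, max_eq_left ht.le]
    rw [max_eq_left h.le, mul_zero]
    exact (hasDerivAt_const s (0 : ℝ)).congr_of_eventuallyEq this
  · subst h
    have h1 : HasDerivAt (fun t : ℝ => t ^ 2) 0 0 := by simpa using hasDerivAt_pow 2 (0 : ℝ)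
    rw [hasDerivAt_iff_isLittleO] at h1 ⊢
    refine Asymptotics.IsBigO.trans_isLittleO ?_ h1
    refine Asymptotics.IsBigO.of_bound 1 (Filter.Eventually.of_forall fun t => ?_)
    rcases le_total t 0 with ht | ht
    · simp [qq, max_eq_left ht]; positivity
    · simp [qq, max_eq_right ht]
  · have : qq =ᶠ[nhds s] fun t => t ^ 2 := by
      filter_upwards [Ioi_mem_nhds h] with t ht
      have ht : 0 < t := ht
      simp [qq, max_eq_right ht.le]
    rw [max_eq_right h.le]
    exact (by simpa using hasDerivAt_pow 2 s : HasDerivAt (fun t : ℝ => t ^ 2) (2 * s) s).congr_of_eventuallyEq this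

theorem qq_contDiff : ContDiff ℝ 1 qq := by
  rw [contDiff_one_iff_deriv]
  refine ⟨fun s => (qq_hasDerivAt s).differentiableAt, ?_⟩
  have : deriv qq = fun s => 2 * max 0 s := funext fun s => (qq_hasDerivAt s).deriv
  rw [this]; fun_prop

/-- linear truncation -/
noncomputable def pp (R : ℝ) (z : ℂ) : ℝ := max 0 (1 - ‖z‖ ^ 2 / R ^ 2)

/-- truncated gaussian weight -/
noncomputable def ww (ν R : ℝ) (z : ℂ) : ℝ := qq (1 - ‖z‖ ^ 2 / R ^ 2) * Real.exp (-ν * ‖z‖ ^ 2)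

theorem ww_eq (ν R : ℝ) (z : ℂ) : ww ν R z = pp R z ^ 2 * Real.exp (-ν * ‖z‖ ^ 2) := rfl

theorem pp_nonneg (R : ℝ) (z : ℂ) : 0 ≤ pp R z := le_max_left _ _

theorem pp_le_one (R : ℝ) (z : ℂ) : pp R z ≤ 1 := by
  have : 0 ≤ ‖z‖ ^ 2 / R ^ 2 := by positivity
  exact max_le zero_le_one (by linarith)

theorem pp_eq_zero {R : ℝ} (hR : 0 < R) {z : ℂ} (hz : R ≤ ‖z‖) : pp R z = 0 := by
  apply max_eq_left
  have : 1 ≤ ‖z‖ ^ 2 / R ^ 2 := by rw [one_le_div (by positivity)]; gcongr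
  linarith

theorem ww_nonneg (ν R : ℝ) (z : ℂ) : 0 ≤ ww ν R z := by
  rw [ww_eq]; positivity

theorem ww_le (ν R : ℝ) (z : ℂ) : ww ν R z ≤ Real.exp (-ν * ‖z‖ ^ 2) := by
  rw [ww_eq]
  have := pow_le_one₀ (pp_nonneg R z) (pp_le_one R z) (n := 2)
  have := Real.exp_pos (-ν * ‖z‖ ^ 2)
  nlinarith

theorem ww_contDiff (ν R : ℝ) : ContDiff ℝ 1 (ww ν R) := by
  unfold ww
  have h : ContDiff ℝ 1 (fun z : ℂ => ‖z‖ ^ 2) := contDiff_norm_sq ℝ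
  exact (qq_contDiff.comp (contDiff_const.sub (h.div_const _))).mul
    (Real.contDiff_exp.comp (contDiff_const.mul h))

theorem ww_fderiv (ν R : ℝ) (z v : ℂ) : fderiv ℝ (ww ν R) z v =
    -2 * (z.re * v.re + z.im * v.im) *
      ((2 * pp R z / R ^ 2 + ν * pp R z ^ 2) * Real.exp (-ν * ‖z‖ ^ 2)) := by
  have h : HasFDerivAt (fun z : ℂ => ‖z‖ ^ 2) (2 • (innerSL ℝ z)) z :=
    (hasStrictFDerivAt_norm_sq z).hasFDerivAt
  have h1 : HasFDerivAt (fun z : ℂ => 1 - ‖z‖ ^ 2 / R ^ 2) (-((R ^ 2)⁻¹ • (2 • (innerSL ℝ z)))) z := by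
    have := (h.const_smul ((R ^ 2)⁻¹)).const_sub 1
    refine this.congr_of_eventuallyEq (Filter.Eventually.of_forall fun t => ?_)
    simp [div_eq_inv_mul]
  have h2 := (qq_hasDerivAt (1 - ‖z‖ ^ 2 / R ^ 2)).comp_hasFDerivAt z h1
  have h3 := (Real.hasDerivAt_exp (-ν * ‖z‖ ^ 2)).comp_hasFDerivAt z (h.const_mul (-ν))
  have h4 : HasFDerivAt (ww ν R) _ z := h2.mul h3
  rw [h4.fderiv]
  have hi : inner ℝ z v = z.re * v.re + z.im * v.im := by
    rw [Complex.inner]; simp; ring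
  simp [hi, qq, pp]
  ring

theorem ww_hasCompactSupport (ν : ℝ) {R : ℝ} (hR : 0 < R) : HasCompactSupport (ww ν R) := by
  refine HasCompactSupport.intro (isCompact_closedBall 0 R) fun z hz => ?_
  have : R ≤ ‖z‖ := by simp at hz; exact hz.le
  simp [ww_eq, pp_eq_zero hR this]

theorem int_fderiv_zero (u : ℂ → ℂ) (hu : ContDiff ℝ 1 u) (hc : HasCompactSupport u) (v : ℂ) :
    Integrable (fun z => fderiv ℝ u z v) ∧ ∫ z, fderiv ℝ u z v = 0 := by
  have hi : Integrable (fun z => fderiv ℝ u z v) := by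
    have h1 : Continuous (fun z => fderiv ℝ u z v) :=
      (hu.continuous_fderiv one_ne_zero).clm_apply continuous_const
    exact h1.integrable_of_hasCompactSupport (hc.fderiv_apply ℝ v)
  refine ⟨hi, ?_⟩
  have := integral_mul_fderiv_eq_neg_fderiv_mul_of_integrable (𝕜 := ℂ) (μ := (volume : Measure ℂ))
    (f := fun _ : ℂ => (1 : ℂ)) (g := u) (v := v) (by simp) (by simpa using hi)
    (by simpa using hu.continuous.integrable_of_hasCompactSupport hc)
    (by intro x _; fun_prop) (fun x _ => hu.differentiable one_ne_zero x)
  simpa using this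

/-- Derivative of `w * g` with `w` the weight. -/
theorem fderiv_ww_mul (ν R : ℝ) (g : ℂ → ℂ) (z v : ℂ) (hg : DifferentiableAt ℝ g z) :
    fderiv ℝ (fun z => (ww ν R z : ℂ) * g z) z v =
      (fderiv ℝ (ww ν R) z v : ℝ) * g z + (ww ν R z : ℂ) * fderiv ℝ g z v := by
  have h1 : HasFDerivAt (fun z => (ww ν R z : ℂ)) (Complex.ofRealCLM.comp (fderiv ℝ (ww ν R) z)) z :=
    Complex.ofRealCLM.hasFDerivAt.comp z
      ((ww_contDiff ν R).differentiable one_ne_zero z).hasFDerivAt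
  have h2 : HasFDerivAt (fun z => (ww ν R z : ℂ) * g z) _ z := h1.mul hg.hasFDerivAt
  rw [h2.fderiv]
  simp
  ring

theorem ww_mono {ν R S : ℝ} (hR : 0 < R) (hRS : R ≤ S) (z : ℂ) : ww ν R z ≤ ww ν S z := by
  rw [ww_eq, ww_eq]
  have h : pp R z ≤ pp S z := by
    unfold pp; gcongr
  have := pp_nonneg R z
  gcongr

theorem cacc_pointwise (ν R : ℝ) (F G : ℂ → ℂ) (hF : ContDiff ℝ 1 F) (hG : ContDiff ℝ 1 G)
    (hFG : ∀ z, G z = (1 / 2 : ℂ) * (fderiv ℝ F z 1 + Complex.I * fderiv ℝ F z Complex.I))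
    (hdG : ∀ z, wirtinger G z = ν * (starRingEnd ℂ z) * G z) (z : ℂ) :
    wirtinger (fun z => (ww ν R z : ℂ) * (G z * starRingEnd ℂ (F z))) z =
      ((‖G z‖ ^ 2 * ww ν R z : ℝ) : ℂ) - ((2 * pp R z / R ^ 2 * Real.exp (-ν * ‖z‖ ^ 2) : ℝ) : ℂ) *
        (starRingEnd ℂ z * G z * starRingEnd ℂ (F z)) := by
  have hFd := (hF.differentiable one_ne_zero z).hasFDerivAt
  have hGd := (hG.differentiable one_ne_zero z).hasFDerivAt
  have hcF : HasFDerivAt (fun z => starRingEnd ℂ (F z))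
      ((Complex.conjCLE : ℂ →L[ℝ] ℂ).comp (fderiv ℝ F z)) z :=
    (Complex.conjCLE : ℂ →L[ℝ] ℂ).hasFDerivAt.comp z hFd
  have hgd : HasFDerivAt (fun z => G z * starRingEnd ℂ (F z)) _ z := hGd.mul hcF
  have hfd : ∀ v, fderiv ℝ (fun z => G z * starRingEnd ℂ (F z)) z v =
      G z * starRingEnd ℂ (fderiv ℝ F z v) + starRingEnd ℂ (F z) * fderiv ℝ G z v := by
    intro v
    rw [hgd.fderiv]; simp
  have hdGz := hdG z
  have hFGz := congrArg (starRingEnd ℂ) (hFG z)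
  simp only [map_mul, map_add, map_div₀, map_one, Complex.conj_I, map_ofNat] at hFGz
  unfold wirtinger at hdGz ⊢
  rw [fderiv_ww_mul _ _ _ _ _ hgd.differentiableAt, fderiv_ww_mul _ _ _ _ _ hgd.differentiableAt,
    hfd, hfd, ww_fderiv, ww_fderiv]
  have hz : starRingEnd ℂ z = (z.re : ℂ) - z.im * Complex.I := by
    apply Complex.ext <;> simp
  have hn : ((‖G z‖ ^ 2 : ℝ) : ℂ) = G z * starRingEnd ℂ (G z) := by
    rw [Complex.mul_conj, Complex.normSq_eq_norm_sq]
  rw [Complex.ofReal_mul (‖G z‖ ^ 2), hn, ww_eq]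
  simp only [Complex.one_re, Complex.one_im, Complex.I_re, Complex.I_im]
  push_cast
  generalize (fderiv ℝ F z 1) = F1 at *
  generalize (fderiv ℝ F z Complex.I) = F2 at *
  generalize (fderiv ℝ G z 1) = G1 at *
  generalize (fderiv ℝ G z Complex.I) = G2 at *
  generalize (starRingEnd ℂ) (F z) = cF at *
  generalize (starRingEnd ℂ) (G z) = cG at *
  generalize (starRingEnd ℂ) F1 = cF1 at *
  generalize (starRingEnd ℂ) F2 = cF2 at *
  generalize Complex.exp (-ν * ‖z‖ ^ 2) = e at *
  generalize (pp R z : ℂ) = p at *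
  rw [hz] at hdGz ⊢
  linear_combination (p ^ 2 * e * cF) * hdGz - (p ^ 2 * e * G z) * hFGz

theorem cacc (ν : ℝ) (F G : ℂ → ℂ) (hF : ContDiff ℝ 1 F) (hG : ContDiff ℝ 1 G)
    (hFG : ∀ z, G z = (1 / 2 : ℂ) * (fderiv ℝ F z 1 + Complex.I * fderiv ℝ F z Complex.I))
    (hdG : ∀ z, wirtinger G z = ν * (starRingEnd ℂ z) * G z) (hL : GaussianL2 ν F)
    (R : ℝ) (hR : 0 < R) :
    ∫ z, ‖G z‖ ^ 2 * ww ν R z ≤ 4 / R ^ 2 * ∫ z, ‖F z‖ ^ 2 * Real.exp (-ν * ‖z‖ ^ 2) := by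
  set u : ℂ → ℂ := fun z => (ww ν R z : ℂ) * (G z * starRingEnd ℂ (F z)) with hu
  have hwc : ContDiff ℝ 1 (fun z => (ww ν R z : ℂ)) :=
    Complex.ofRealCLM.contDiff.comp (ww_contDiff ν R)
  have hcF : ContDiff ℝ 1 (fun z => starRingEnd ℂ (F z)) :=
    (Complex.conjCLE : ℂ →L[ℝ] ℂ).contDiff.comp hF
  have huc : ContDiff ℝ 1 u := hwc.mul (hG.mul hcF)
  have hus : HasCompactSupport u := by
    have : HasCompactSupport (fun z => (ww ν R z : ℂ)) :=
      (ww_hasCompactSupport ν hR).comp_left (g := fun x : ℝ => (x : ℂ)) (by simp)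
    exact this.mul_right
  obtain ⟨i1, e1⟩ := int_fderiv_zero u huc hus 1
  obtain ⟨i2, e2⟩ := int_fderiv_zero u huc hus Complex.I
  have iD : Integrable (wirtinger u) := (i1.sub (i2.const_mul Complex.I)).const_mul _
  have eD : ∫ z, wirtinger u z = 0 := by
    unfold wirtinger
    rw [integral_const_mul, integral_sub i1 (i2.const_mul _), integral_const_mul, e1, e2]; simp
  have iG : Integrable (fun z => ‖G z‖ ^ 2 * ww ν R z) := by
    apply Continuous.integrable_of_hasCompactSupport
    · exact (hG.continuous.norm.pow 2).mul (ww_contDiff ν R).continuous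
    · exact (ww_hasCompactSupport ν hR).mul_left
  have hre : ∫ z, (wirtinger u z).re = 0 := by
    have := integral_re iD
    simp only [RCLike.re_eq_complex_re] at this
    rw [this, eD]; simp
  have hpt : ∀ z, ‖G z‖ ^ 2 * ww ν R z - 4 / R ^ 2 * (‖F z‖ ^ 2 * Real.exp (-ν * ‖z‖ ^ 2))
      ≤ 2 * (wirtinger u z).re := by
    intro z
    rw [hu, cacc_pointwise ν R F G hF hG hFG hdG z, Complex.sub_re, Complex.ofReal_re,
      Complex.re_ofReal_mul]
    have h1 : (starRingEnd ℂ z * G z * starRingEnd ℂ (F z)).re ≤ ‖z‖ * ‖G z‖ * ‖F z‖ := by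
      refine (Complex.re_le_norm _).trans (by simp)
    set e := Real.exp (-ν * ‖z‖ ^ 2) with he
    have hepos : 0 < e := Real.exp_pos _
    have hp := pp_nonneg R z
    rw [ww_eq, ← he]
    have h2 : pp R z * ‖z‖ ≤ pp R z * R := by
      rcases le_total R ‖z‖ with h | h
      · simp [pp_eq_zero hR h]
      · gcongr
    have h3 : 2 * pp R z / R ^ 2 * e * (starRingEnd ℂ z * G z * starRingEnd ℂ (F z)).re
        ≤ 2 * (pp R z * R) / R ^ 2 * e * (‖G z‖ * ‖F z‖) := by
      calc _ ≤ 2 * pp R z / R ^ 2 * e * (‖z‖ * ‖G z‖ * ‖F z‖) := by gcongr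
        _ = 2 * (pp R z * ‖z‖) / R ^ 2 * e * (‖G z‖ * ‖F z‖) := by ring
        _ ≤ _ := by gcongr
    have h4 : 2 * (2 * (pp R z * R) / R ^ 2 * e * (‖G z‖ * ‖F z‖)) ≤
        ‖G z‖ ^ 2 * (pp R z ^ 2 * e) + 4 / R ^ 2 * (‖F z‖ ^ 2 * e) := by
      have : ‖G z‖ ^ 2 * (pp R z ^ 2 * e) + 4 / R ^ 2 * (‖F z‖ ^ 2 * e) -
        2 * (2 * (pp R z * R) / R ^ 2 * e * (‖G z‖ * ‖F z‖)) =
          e * (‖G z‖ * pp R z - 2 / R * ‖F z‖) ^ 2 := by field_simp; ring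
      have h5 : 0 ≤ e * (‖G z‖ * pp R z - 2 / R * ‖F z‖) ^ 2 := by positivity
      linarith
    linarith
  have := integral_mono (iG.sub (hL.const_mul (4 / R ^ 2))) (iD.re.const_mul 2) hpt
  simp only [Pi.sub_apply, RCLike.re_eq_complex_re] at this
  rw [integral_sub iG (hL.const_mul _), integral_const_mul, integral_const_mul, hre] at this
  linarith

theorem cacc_zero (ν : ℝ) (F G : ℂ → ℂ) (hF : ContDiff ℝ 1 F) (hG : ContDiff ℝ 1 G)
    (hFG : ∀ z, G z = (1 / 2 : ℂ) * (fderiv ℝ F z 1 + Complex.I * fderiv ℝ F z Complex.I))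
    (hdG : ∀ z, wirtinger G z = ν * (starRingEnd ℂ z) * G z) (hL : GaussianL2 ν F) (z : ℂ) :
    G z = 0 := by
  set R := ‖z‖ + 1 with hRdef
  have hR : 0 < R := by positivity
  have iG : ∀ S, 0 < S → Integrable (fun z => ‖G z‖ ^ 2 * ww ν S z) := by
    intro S hS
    apply Continuous.integrable_of_hasCompactSupport
    · exact (hG.continuous.norm.pow 2).mul (ww_contDiff ν S).continuous
    · exact (ww_hasCompactSupport ν hS).mul_left
  have hnn : ∀ z, 0 ≤ ‖G z‖ ^ 2 * ww ν R z := fun z => by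
    have := ww_nonneg ν R z
    positivity
  set C := ∫ z, ‖F z‖ ^ 2 * Real.exp (-ν * ‖z‖ ^ 2) with hC
  have hle : ∫ z, ‖G z‖ ^ 2 * ww ν R z ≤ 0 := by
    have ht : Filter.Tendsto (fun S : ℝ => 4 / S ^ 2 * C) Filter.atTop (nhds 0) := by
      have h0 : Filter.Tendsto (fun S : ℝ => 4 / S ^ 2) Filter.atTop (nhds 0) :=
        Filter.Tendsto.div_atTop tendsto_const_nhds (Filter.tendsto_pow_atTop (by norm_num))
      simpa using h0.mul_const C
    refine ge_of_tendsto ht ?_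
    filter_upwards [Filter.eventually_ge_atTop R] with S hS
    refine le_trans ?_ (cacc ν F G hF hG hFG hdG hL S (hR.trans_le hS))
    refine integral_mono (iG R hR) (iG S (hR.trans_le hS)) fun z => ?_
    have := ww_mono (ν := ν) hR hS z
    simp only
    gcongr
  have h0 : ∫ z, ‖G z‖ ^ 2 * ww ν R z = 0 := le_antisymm hle (integral_nonneg hnn)
  rw [integral_eq_zero_iff_of_nonneg hnn (iG R hR)] at h0
  have hcont : Continuous (fun z => ‖G z‖ ^ 2 * ww ν R z) :=
    (hG.continuous.norm.pow 2).mul (ww_contDiff ν R).continuous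
  have h1 := congrFun ((Continuous.ae_eq_iff_eq volume hcont continuous_const).1 h0) z
  have hpos : 0 < ww ν R z := by
    rw [ww_eq]
    have : 0 < pp R z := by
      refine lt_max_of_lt_right ?_
      have : ‖z‖ ^ 2 / R ^ 2 < 1 := by
        rw [div_lt_one (by positivity)]
        have := norm_nonneg z
        rw [hRdef]; nlinarith
      linarith
    positivity
  have h2 : ‖G z‖ ^ 2 * ww ν R z = 0 := h1
  rcases mul_eq_zero.1 h2 with h | h
  · simpa using h
  · exact absurd h hpos.ne'

theorem holo_of_i (ν : ℝ) (F : ℂ → ℂ) (hF : ContDiff ℝ (⊤ : ℕ∞) F) (hL : GaussianL2 ν F)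
    (hM : ∀ z : ℂ, magLap ν F z = 0) : Differentiable ℂ F := by
  have hF1 : ContDiff ℝ 1 F := hF.of_le (by exact_mod_cast le_top)
  have hF2 : ContDiff ℝ 2 F := contDiff_infty.1 hF 2
  have hd : ContDiff ℝ 1 (fderiv ℝ F) := hF2.fderiv_right (by norm_num)
  have hdv : ∀ v, ContDiff ℝ 1 (fun z => fderiv ℝ F z v) := fun v => hd.clm_apply contDiff_const
  have hdd : ∀ v z w, fderiv ℝ (fun z => fderiv ℝ F z v) z w = fderiv ℝ (fderiv ℝ F) z w v := by
    intro v z w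
    rw [fderiv_clm_apply (hd.differentiable one_ne_zero z) (by fun_prop)]
    simp
  set G : ℂ → ℂ := fun z => (1 / 2 : ℂ) * (fderiv ℝ F z 1 + Complex.I * fderiv ℝ F z Complex.I)
    with hGdef
  have hG : ContDiff ℝ 1 G := contDiff_const.mul ((hdv 1).add (contDiff_const.mul (hdv Complex.I)))
  have hdG : ∀ z, wirtinger G z = ν * (starRingEnd ℂ z) * G z := by
    intro z
    have h1 := ((hdv 1).differentiable one_ne_zero z).hasFDerivAt
    have h2 := ((hdv Complex.I).differentiable one_ne_zero z).hasFDerivAt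
    have h3 : HasFDerivAt G _ z := (h1.add (h2.const_mul Complex.I)).const_mul (1 / 2 : ℂ)
    have hs := (hF2.contDiffAt (x := z)).isSymmSndFDerivAt (by simp) 1 Complex.I
    have hm := hM z
    unfold magLap at hm
    unfold wirtinger
    rw [h3.fderiv]
    simp only [hdd] at hm
    simp [hdd, hGdef, hs]
    generalize fderiv ℝ (fderiv ℝ F) z Complex.I Complex.I = a at *
    generalize fderiv ℝ (fderiv ℝ F) z 1 1 = b at *
    generalize fderiv ℝ (fderiv ℝ F) z Complex.I 1 = c at *
    linear_combination -hm - (a / 4) * Complex.I_sq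
  intro z
  rw [differentiableAt_complex_iff_differentiableAt_real]
  refine ⟨hF1.differentiable one_ne_zero z, ?_⟩
  have := cacc_zero ν F G hF1 hG (fun _ => rfl) hdG hL z
  simp only [hGdef] at this
  rw [smul_eq_mul]
  linear_combination (-2 * Complex.I) * this + (fderiv ℝ F z Complex.I) * Complex.I_sq

theorem fderiv_real_eq (f : ℂ → ℂ) (hf : Differentiable ℂ f) (z v : ℂ) :
    fderiv ℝ f z v = deriv f z * v := by
  rw [(hf z).hasDerivAt.complexToReal_fderiv.fderiv]; simp

theorem dir_pointwise (ν R : ℝ) (f : ℂ → ℂ) (hf : Differentiable ℂ f) (z : ℂ) :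
    fderiv ℝ (fun z => (ww ν R z : ℂ) * (f z * starRingEnd ℂ (f z) * (z.re : ℂ))) z 1 +
    fderiv ℝ (fun z => (ww ν R z : ℂ) * (f z * starRingEnd ℂ (f z) * (z.im : ℂ))) z Complex.I =
    (((2 * ‖f z‖ ^ 2 + 2 * (starRingEnd ℂ (f z) * deriv f z * z).re) * ww ν R z
      - 2 * ‖z‖ ^ 2 * ((2 * pp R z / R ^ 2 + ν * pp R z ^ 2) * Real.exp (-ν * ‖z‖ ^ 2))
        * ‖f z‖ ^ 2 : ℝ) : ℂ) := by
  have hFd : HasFDerivAt f (fderiv ℝ f z) z := ((hf z).restrictScalars ℝ).hasFDerivAt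
  have hcF : HasFDerivAt (fun z => starRingEnd ℂ (f z))
      ((Complex.conjCLE : ℂ →L[ℝ] ℂ).comp (fderiv ℝ f z)) z :=
    (Complex.conjCLE : ℂ →L[ℝ] ℂ).hasFDerivAt.comp z hFd
  have hre : HasFDerivAt (fun z : ℂ => (z.re : ℂ)) (Complex.ofRealCLM.comp Complex.reCLM) z :=
    (Complex.ofRealCLM.comp Complex.reCLM).hasFDerivAt
  have him : HasFDerivAt (fun z : ℂ => (z.im : ℂ)) (Complex.ofRealCLM.comp Complex.imCLM) z :=
    (Complex.ofRealCLM.comp Complex.imCLM).hasFDerivAt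
  have h1 : HasFDerivAt (fun z => f z * starRingEnd ℂ (f z) * (z.re : ℂ)) _ z := (hFd.mul hcF).mul hre
  have h2 : HasFDerivAt (fun z => f z * starRingEnd ℂ (f z) * (z.im : ℂ)) _ z := (hFd.mul hcF).mul him
  rw [fderiv_ww_mul _ _ _ _ _ h1.differentiableAt, fderiv_ww_mul _ _ _ _ _ h2.differentiableAt,
    h1.fderiv, h2.fderiv, ww_fderiv, ww_fderiv]
  have hn : ((‖f z‖ : ℂ)) ^ 2 = f z * starRingEnd ℂ (f z) := by
    rw [Complex.mul_conj, Complex.normSq_eq_norm_sq]; simp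
  have hnz : ((‖z‖ : ℂ)) ^ 2 = (z.re : ℂ) ^ 2 + (z.im : ℂ) ^ 2 := by
    rw [← Complex.ofReal_pow, ← Complex.normSq_eq_norm_sq, Complex.normSq_apply]; push_cast; ring
  have hr : (2 : ℂ) * (((starRingEnd ℂ (f z) * deriv f z * z).re : ℝ) : ℂ) =
      starRingEnd ℂ (f z) * deriv f z * z + f z * starRingEnd ℂ (deriv f z) * starRingEnd ℂ z := by
    have := Complex.add_conj (starRingEnd ℂ (f z) * deriv f z * z)
    simp only [map_mul, Complex.conj_conj] at this
    rw [this]; push_cast; rfl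
  have hz : starRingEnd ℂ z = (z.re : ℂ) - z.im * Complex.I := by
    apply Complex.ext <;> simp
  have hz' : z = (z.re : ℂ) + z.im * Complex.I := (Complex.re_add_im z).symm
  rw [ww_eq]
  simp only [Complex.ofReal_sub, Complex.ofReal_add, Complex.ofReal_mul, Complex.ofReal_pow,
    Complex.ofReal_ofNat, hr, hn]
  simp [fderiv_real_eq f hf]
  simp only [hnz]
  rw [hz]
  generalize (starRingEnd ℂ) (f z) = cF at *
  generalize (starRingEnd ℂ) (deriv f z) = cG at *
  generalize deriv f z = G at *
  generalize f z = F at *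
  generalize Complex.exp _ = e at *
  generalize (pp R z : ℂ) = p at *
  linear_combination (-p ^ 2 * e * cF * G) * hz'

theorem dir_bound (ν : ℝ) (hν : 0 < ν) (f : ℂ → ℂ) (hf : Differentiable ℂ f)
    (hL : GaussianL2 ν (deriv f)) : GaussianL2 ν f := by
  set K : Set ℂ := Metric.closedBall 0 (Real.sqrt (3 / ν)) with hK
  have hfc : Continuous f := hf.continuous
  have hec : Continuous (fun z : ℂ => ‖f z‖ ^ 2 * Real.exp (-ν * ‖z‖ ^ 2)) := by fun_prop
  set B : ℂ → ℝ := fun z => 3 * K.indicator (fun z => ‖f z‖ ^ 2 * Real.exp (-ν * ‖z‖ ^ 2)) z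
    + 1 / ν * (‖deriv f z‖ ^ 2 * Real.exp (-ν * ‖z‖ ^ 2)) with hB
  have iB : Integrable B := by
    refine Integrable.add (Integrable.const_mul ?_ _) (hL.const_mul _)
    rw [integrable_indicator_iff Metric.isClosed_closedBall.measurableSet]
    exact hec.continuousOn.integrableOn_compact (isCompact_closedBall _ _)
  have hf1 : ContDiff ℝ 1 f := (hf.contDiff (n := 1)).restrict_scalars ℝ
  have iF : ∀ S, 0 < S → Integrable (fun z => ‖f z‖ ^ 2 * ww ν S z) := by
    intro S hS
    apply Continuous.integrable_of_hasCompactSupport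
    · exact (hfc.norm.pow 2).mul (ww_contDiff ν S).continuous
    · exact (ww_hasCompactSupport ν hS).mul_left
  have key : ∀ R, 0 < R → ∫ z, ‖f z‖ ^ 2 * ww ν R z ≤ ∫ z, B z := by
    intro R hR
    have hwc : ContDiff ℝ 1 (fun z => (ww ν R z : ℂ)) :=
      Complex.ofRealCLM.contDiff.comp (ww_contDiff ν R)
    have hws : HasCompactSupport (fun z => (ww ν R z : ℂ)) :=
      (ww_hasCompactSupport ν hR).comp_left (g := fun x : ℝ => (x : ℂ)) (by simp)
    have hcF : ContDiff ℝ 1 (fun z => starRingEnd ℂ (f z)) :=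
      (Complex.conjCLE : ℂ →L[ℝ] ℂ).contDiff.comp hf1
    have hre : ContDiff ℝ 1 (fun z : ℂ => (z.re : ℂ)) :=
      (Complex.ofRealCLM.comp Complex.reCLM).contDiff
    have him : ContDiff ℝ 1 (fun z : ℂ => (z.im : ℂ)) :=
      (Complex.ofRealCLM.comp Complex.imCLM).contDiff
    obtain ⟨i1, e1⟩ := int_fderiv_zero
      (fun z => (ww ν R z : ℂ) * (f z * starRingEnd ℂ (f z) * (z.re : ℂ)))
      (hwc.mul ((hf1.mul hcF).mul hre)) hws.mul_right 1
    obtain ⟨i2, e2⟩ := int_fderiv_zero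
      (fun z => (ww ν R z : ℂ) * (f z * starRingEnd ℂ (f z) * (z.im : ℂ)))
      (hwc.mul ((hf1.mul hcF).mul him)) hws.mul_right Complex.I
    have i3 := i1.add i2
    have e3 := integral_add i1 i2
    rw [e1, e2, add_zero] at e3
    have e4 := integral_re i3
    simp only [Pi.add_apply] at e4
    rw [e3] at e4
    have i4 := i3.re
    simp only [Pi.add_apply] at i4
    simp only [dir_pointwise ν R f hf, RCLike.re_eq_complex_re, Complex.ofReal_re,
      Complex.zero_re] at e4 i4
    have hmono := integral_mono (i4.add (iF R hR)) iB (fun z => ?_)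
    · simp only [Pi.add_apply] at hmono
      rw [integral_add i4 (iF R hR), e4] at hmono
      linarith
    · simp only [Pi.add_apply, hB]
      have h1 : (starRingEnd ℂ (f z) * deriv f z * z).re ≤ ‖f z‖ * ‖deriv f z‖ * ‖z‖ := by
        refine (Complex.re_le_norm _).trans (by simp)
      have hw0 := ww_nonneg ν R z
      have hw1 := ww_le ν R z
      have hweq := ww_eq ν R z
      have hp := pp_nonneg R z
      set e := Real.exp (-ν * ‖z‖ ^ 2) with he
      have hepos : 0 < e := Real.exp_pos _
      have h2 : 2 * (‖f z‖ * ‖deriv f z‖ * ‖z‖) ≤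
          ν * ‖z‖ ^ 2 * ‖f z‖ ^ 2 + 1 / ν * ‖deriv f z‖ ^ 2 := by
        have : ν * ‖z‖ ^ 2 * ‖f z‖ ^ 2 + 1 / ν * ‖deriv f z‖ ^ 2 -
          2 * (‖f z‖ * ‖deriv f z‖ * ‖z‖) = 1 / ν * (ν * ‖z‖ * ‖f z‖ - ‖deriv f z‖) ^ 2 := by
          field_simp; ring
        have h5 : 0 ≤ 1 / ν * (ν * ‖z‖ * ‖f z‖ - ‖deriv f z‖) ^ 2 := by positivity
        linarith
      have h3 : 0 ≤ 2 * ‖z‖ ^ 2 * (2 * pp R z / R ^ 2 * e) * ‖f z‖ ^ 2 := by positivity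
      have h4 : 1 / ν * ‖deriv f z‖ ^ 2 * ww ν R z ≤ 1 / ν * ‖deriv f z‖ ^ 2 * e := by gcongr
      have h5 : (3 - ν * ‖z‖ ^ 2) * ‖f z‖ ^ 2 * ww ν R z ≤
          3 * K.indicator (fun z => ‖f z‖ ^ 2 * Real.exp (-ν * ‖z‖ ^ 2)) z := by
        by_cases hz : z ∈ K
        · rw [Set.indicator_of_mem hz, ← he]
          have : ‖f z‖ ^ 2 * ww ν R z ≤ ‖f z‖ ^ 2 * e := by gcongr
          have : 0 ≤ ν * ‖z‖ ^ 2 * (‖f z‖ ^ 2 * ww ν R z) := by positivity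
          linarith
        · rw [Set.indicator_of_notMem hz]
          have hz' : Real.sqrt (3 / ν) < ‖z‖ := by simpa [hK] using hz
          have h6 : 3 / ν < ‖z‖ ^ 2 := Real.lt_sq_of_sqrt_lt hz'
          rw [div_lt_iff₀ hν] at h6
          have : 0 ≤ (ν * ‖z‖ ^ 2 - 3) * (‖f z‖ ^ 2 * ww ν R z) := by
            apply mul_nonneg (by linarith); positivity
          linarith
      have h7 : 2 * (starRingEnd ℂ (f z) * deriv f z * z).re * ww ν R z ≤
          (ν * ‖z‖ ^ 2 * ‖f z‖ ^ 2 + 1 / ν * ‖deriv f z‖ ^ 2) * ww ν R z := by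
        gcongr; linarith
      have h8 : 2 * ‖z‖ ^ 2 * ((2 * pp R z / R ^ 2 + ν * pp R z ^ 2) * e) * ‖f z‖ ^ 2 =
        2 * ‖z‖ ^ 2 * (2 * pp R z / R ^ 2 * e) * ‖f z‖ ^ 2 + 2 * ν * ‖z‖ ^ 2 * ‖f z‖ ^ 2 * ww ν R z := by
        rw [hweq]; ring
      rw [h8]
      linarith
  unfold GaussianL2
  refine (aecover_closedBall (x := (0 : ℂ)) (tendsto_natCast_atTop_atTop (R := ℝ))).integrable_of_integral_bounded_of_nonneg_ae
    (2 * ∫ z, B z) (fun n => hec.continuousOn.integrableOn_compact (isCompact_closedBall _ _))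
    (Filter.Eventually.of_forall fun z => by positivity) ?_
  filter_upwards with n
  have hR : (0 : ℝ) < 2 * (n + 1) := by positivity
  have hn0 : ∀ z, 0 ≤ ‖f z‖ ^ 2 * ww ν (2 * (n + 1)) z := fun z =>
    mul_nonneg (by positivity) (ww_nonneg _ _ _)
  calc ∫ z in Metric.closedBall 0 (n : ℝ), ‖f z‖ ^ 2 * Real.exp (-ν * ‖z‖ ^ 2)
      ≤ ∫ z in Metric.closedBall 0 (n : ℝ), 2 * (‖f z‖ ^ 2 * ww ν (2 * (n + 1)) z) := by
        refine setIntegral_mono_on (hec.continuousOn.integrableOn_compact (isCompact_closedBall _ _))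
          ((iF _ hR).const_mul 2).integrableOn Metric.isClosed_closedBall.measurableSet ?_
        intro z hz
        have hz : ‖z‖ ≤ n := by simpa using hz
        rw [ww_eq]
        have h1 : 3 / 4 ≤ pp (2 * (n + 1)) z := by
          refine le_max_of_le_right ?_
          have : ‖z‖ ^ 2 / (2 * ((n : ℝ) + 1)) ^ 2 ≤ 1 / 4 := by
            rw [div_le_iff₀ (by positivity)]
            have := norm_nonneg z
            nlinarith
          linarith
        have h2 : 1 ≤ 2 * pp (2 * (n + 1)) z ^ 2 := by nlinarith
        have h3 : 0 ≤ ‖f z‖ ^ 2 * Real.exp (-ν * ‖z‖ ^ 2) := by positivity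
        nlinarith
    _ ≤ ∫ z, 2 * (‖f z‖ ^ 2 * ww ν (2 * (n + 1)) z) :=
        setIntegral_le_integral ((iF _ hR).const_mul 2)
          (Filter.Eventually.of_forall fun z => mul_nonneg zero_le_two (hn0 z))
    _ = 2 * ∫ z, ‖f z‖ ^ 2 * ww ν (2 * (n + 1)) z := integral_const_mul _ _
    _ ≤ _ := mul_le_mul_of_nonneg_left (key _ hR) zero_le_two

theorem dir_iter (ν : ℝ) (hν : 0 < ν) (m : ℕ) : ∀ (f : ℂ → ℂ), Differentiable ℂ f →
    GaussianL2 ν (iteratedDeriv m f) → GaussianL2 ν f := by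
  induction m with
  | zero => intro f _ h; simpa using h
  | succ k ih =>
    intro f hf h
    rw [iteratedDeriv_succ'] at h
    exact dir_bound ν hν f hf (ih _ hf.deriv h)

theorem wirtinger_holo (f : ℂ → ℂ) (hf : Differentiable ℂ f) : wirtinger f = deriv f := by
  funext z
  simp only [wirtinger, fderiv_real_eq f hf]
  linear_combination (-(1 / 2) * deriv f z) * Complex.I_sq

theorem wirtinger_iter (m : ℕ) : ∀ (f : ℂ → ℂ), Differentiable ℂ f →
    wirtinger^[m] f = iteratedDeriv m f := by
  induction m with
  | zero => intro f _; simp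
  | succ k ih =>
    intro f hf
    rw [iteratedDeriv_succ', Function.iterate_succ_apply, wirtinger_holo f hf, ih _ hf.deriv]

theorem magLap_holo (ν : ℝ) (f : ℂ → ℂ) (hf : Differentiable ℂ f) (z : ℂ) : magLap ν f z = 0 := by
  have h1 : (fun w => fderiv ℝ f w 1) = fun w => deriv f w * 1 :=
    funext fun w => fderiv_real_eq f hf w 1
  have h2 : (fun w => fderiv ℝ f w Complex.I) = fun w => deriv f w * Complex.I :=
    funext fun w => fderiv_real_eq f hf w _
  have hd := hf.deriv
  have hdI : deriv (fun w => deriv f w * Complex.I) z = deriv (deriv f) z * Complex.I :=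
    deriv_mul_const (hd z) _
  unfold magLap
  rw [h1, h2, fderiv_real_eq _ (hd.mul_const _), fderiv_real_eq _ (hd.mul_const _),
    fderiv_real_eq f hf, fderiv_real_eq f hf, hdI]
  simp only [mul_one]
  linear_combination (-(1 / 4) * deriv (deriv f) z + ν / 2 * starRingEnd ℂ z * deriv f z) * Complex.I_sq

theorem stmt17 (ν : ℝ) (hν : 0 < ν) (m : ℕ) (hm : 2 ≤ m)
    (F : ℂ → ℂ) (hF : ContDiff ℝ (⊤ : ℕ∞) F) :
    (GaussianL2 ν F ∧ GaussianL2 ν (wirtinger^[m] F) ∧ ∀ z : ℂ, magLap ν F z = 0) ↔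
      (Differentiable ℂ F ∧ GaussianL2 ν (iteratedDeriv m F)) := by
  constructor
  · rintro ⟨h1, h2, h3⟩
    have h := holo_of_i ν F hF h1 h3
    exact ⟨h, by rwa [← wirtinger_iter m F h]⟩
  · rintro ⟨h, h2⟩
    exact ⟨dir_iter ν hν m F h h2, by rwa [wirtinger_iter m F h], magLap_holo ν F h⟩
end
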